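/- For every integer N ≥ 0 there exist a constant C > 0 and an integer M ≥ 0 such that ‖χ₁ Op(a) χ₂ u‖_{L²(dq)} ≤ C dist(supp(χ₁), supp(χ₂))^{−N} |χ₁|_M |χ₂|_M (Σ_{|B|=N} |∂_p^B a|_{M,0,0}) ‖u‖_{L²(dq)} for all a ∈ BS^0_0(1), all u ∈ C_c^∞(ℝ^n) and all χ₁, χ₂ ∈ 𝓑 with dist(supp(χ₁), supp(χ₂)) > 0. -/

import Mathlib

open MeasureTheory Real
open scoped BigOperators Classical

noncomputable section

/-- Points of `ℝⁿ`. The coordinate `q 0` plays the role of the radial variable `r`,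
the remaining coordinates are the angular variables `θ`. -/
abbrev Vec (n : ℕ) := Fin n → ℝ

/-- Complex-valued partial derivative in the coordinate direction `i`. -/
def pdC {n : ℕ} (i : Fin n) (f : Vec n → ℂ) : Vec n → ℂ :=
  fun x => fderiv ℝ f x (Pi.single i 1)

/-- Iterated (multiindex) partial derivative `∂^A f`. -/
def mpd {n : ℕ} (A : Fin n → ℕ) (f : Vec n → ℂ) : Vec n → ℂ :=
  (List.finRange n).foldr (fun i g => (pdC i)^[A i] g) f

/-- Real-valued partial derivative in the coordinate direction `i`. -/
def pdR {n : ℕ} (i : Fin n) (f : Vec n → ℝ) : Vec n → ℝ :=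
  fun x => fderiv ℝ f x (Pi.single i 1)

/-- Iterated (multiindex) partial derivative, real valued. -/
def mpdR {n : ℕ} (A : Fin n → ℕ) (f : Vec n → ℝ) : Vec n → ℝ :=
  (List.finRange n).foldr (fun i g => (pdR i)^[A i] g) f

/-- Total length `|A| = α₀ + |α|` of a multiindex. -/
def fullLen {n : ℕ} (A : Fin n → ℕ) : ℕ := ∑ i, A i

/-- Angular length `|α|` of a multiindex `A = (α₀, α)`. -/
def angLen {n : ℕ} [NeZero n] (A : Fin n → ℕ) : ℕ := ∑ i, if i = 0 then 0 else A i

/-- The weighted Japanese bracket `⟨ρ ⊕ μ⁻¹ η⟩ = (1 + ρ² + μ⁻²|η|²)^(1/2)`,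
where `ρ = p 0` and `η` are the remaining coordinates of `p`. -/
def jbr {n : ℕ} [NeZero n] (μ : ℝ) (p : Vec n) : ℝ :=
  Real.sqrt (1 + ∑ i, (if i = 0 then p i else μ⁻¹ * p i) ^ 2)

/-- Derivative `∂_q^A` of a function `a(q, p)` in the first slot. -/
def dqS {n : ℕ} (A : Fin n → ℕ) (a : Vec n → Vec n → ℂ) : Vec n → Vec n → ℂ :=
  fun q p => mpd A (fun x => a x p) q

/-- Derivative `∂_p^B` of a function `a(q, p)` in the second slot. -/
def dpS {n : ℕ} (B : Fin n → ℕ) (a : Vec n → Vec n → ℂ) : Vec n → Vec n → ℂ :=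
  fun q p => mpd B (fun x => a q x) p

/-- Derivative `∂_q^A` of a function `a(q, p, q')` in the first slot. -/
def d1B {n : ℕ} (A : Fin n → ℕ) (a : Vec n → Vec n → Vec n → ℂ) :
    Vec n → Vec n → Vec n → ℂ :=
  fun q p q' => mpd A (fun x => a x p q') q

/-- Derivative `∂_p^B` of a function `a(q, p, q')` in the second slot. -/
def d2B {n : ℕ} (B : Fin n → ℕ) (a : Vec n → Vec n → Vec n → ℂ) :
    Vec n → Vec n → Vec n → ℂ :=
  fun q p q' => mpd B (fun x => a q x q') p

/-- Derivative `∂_{q'}^{A'}` of a function `a(q, p, q')` in the third slot. -/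
def d3B {n : ℕ} (A' : Fin n → ℕ) (a : Vec n → Vec n → Vec n → ℂ) :
    Vec n → Vec n → Vec n → ℂ :=
  fun q p q' => mpd A' (fun x => a q p x) q'

/-- The admissibility condition for the weight `λ : ℝ → (0,∞)`:
`λ` is positive and `C₀⁻¹ ≤ λ(r)/λ(r') ≤ C₀` whenever `|r - r'| ≤ 1`. -/
def Admissible (lam : ℝ → ℝ) : Prop :=
  (∀ r, 0 < lam r) ∧
  ∃ C > 0, ∀ r r' : ℝ, |r - r'| ≤ 1 → C⁻¹ ≤ lam r / lam r' ∧ lam r / lam r' ≤ C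

/-- The symbol class `S^m_σ(λ)`:  `a` is smooth on `ℝ^{2n}` and for all multiindices
`A = (α₀, α)`, `B = (β₀, β)`,
`|(λ(r)⁻¹∂_θ)^α (λ(r)∂_η)^β ∂_r^{α₀} ∂_ρ^{β₀} a(q,p)| ≤ C ⟨ρ ⊕ λ(r)⁻¹η⟩^{m - σ|B|}`.
(The weights `λ(r)^{±1}` commute with the `θ`- and `η`-derivatives, so the weighted
derivative equals `λ(r)^{|β| - |α|}` times the plain mixed partial derivative.) -/
def IsSymbol {n : ℕ} [NeZero n] (lam : ℝ → ℝ) (m σ : ℝ) (a : Vec n → Vec n → ℂ) : Prop :=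
  ContDiff ℝ (⊤ : ℕ∞) (fun x : Vec n × Vec n => a x.1 x.2) ∧
  ∀ A B : Fin n → ℕ, ∃ C > 0, ∀ q p : Vec n,
    lam (q 0) ^ ((angLen B : ℤ) - (angLen A : ℤ)) * ‖dqS A (dpS B a) q p‖
      ≤ C * jbr (lam (q 0)) p ^ (m - σ * (fullLen B : ℝ))

/-- The seminorm `|a|_{λ : M, m, σ}` on the symbol class `S^m_σ(λ)`. -/
def symSeminorm {n : ℕ} [NeZero n] (lam : ℝ → ℝ) (M : ℕ) (m σ : ℝ)
    (a : Vec n → Vec n → ℂ) : ℝ :=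
  ∑ A : Fin n → Fin (M + 1), ∑ B : Fin n → Fin (M + 1),
    if fullLen (fun i => (A i : ℕ)) + fullLen (fun i => (B i : ℕ)) ≤ M then
      ⨆ q : Vec n, ⨆ p : Vec n,
        jbr (lam (q 0)) p ^ (-m + σ * (fullLen (fun i => (B i : ℕ)) : ℝ)) *
          (lam (q 0) ^ ((angLen (fun i => (B i : ℕ)) : ℤ) - (angLen (fun i => (A i : ℕ)) : ℤ)) *
            ‖dqS (fun i => (A i : ℕ)) (dpS (fun i => (B i : ℕ)) a) q p‖)
    else 0

/-- `λ^t_{jk} := λ(tj + (1-t)k)`. -/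
def lamT (lam : ℝ → ℝ) (t : ℝ) (j k : ℤ) : ℝ := lam (t * j + (1 - t) * k)

/-- The bisymbol class `BS^m_σ(λ; t)`. -/
def IsBisymbol {n : ℕ} [NeZero n] (lam : ℝ → ℝ) (m σ t : ℝ)
    (a : Vec n → Vec n → Vec n → ℂ) : Prop :=
  ContDiff ℝ (⊤ : ℕ∞) (fun x : Vec n × Vec n × Vec n => a x.1 x.2.1 x.2.2) ∧
  ∀ A B A' : Fin n → ℕ, ∃ C > 0, ∀ (j k : ℤ) (q p q' : Vec n),
    |q 0 - (j : ℝ)| ≤ 1 → |q' 0 - (k : ℝ)| ≤ 1 →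
    lamT lam t j k ^ ((angLen B : ℤ) - (angLen A : ℤ) - (angLen A' : ℤ)) *
        ‖d1B A (d2B B (d3B A' a)) q p q'‖
      ≤ C * jbr (lamT lam t j k) p ^ (m - σ * (fullLen B : ℝ))

/-- The seminorm `|a|_{λ : M, m, σ, t}` on `BS^m_σ(λ; t)`. -/
def bisymSeminorm {n : ℕ} [NeZero n] (lam : ℝ → ℝ) (M : ℕ) (m σ t : ℝ)
    (a : Vec n → Vec n → Vec n → ℂ) : ℝ :=
  ∑ A : Fin n → Fin (M + 1), ∑ B : Fin n → Fin (M + 1), ∑ A' : Fin n → Fin (M + 1),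
    if fullLen (fun i => (A i : ℕ)) + fullLen (fun i => (B i : ℕ))
        + fullLen (fun i => (A' i : ℕ)) ≤ M then
      ⨆ j : ℤ, ⨆ k : ℤ, ⨆ q : Vec n, ⨆ p : Vec n, ⨆ q' : Vec n,
        if |q 0 - (j : ℝ)| ≤ 1 ∧ |q' 0 - (k : ℝ)| ≤ 1 then
          jbr (lamT lam t j k) p ^ (-m + σ * (fullLen (fun i => (B i : ℕ)) : ℝ)) *
            (lamT lam t j k ^ ((angLen (fun i => (B i : ℕ)) : ℤ)
                - (angLen (fun i => (A i : ℕ)) : ℤ) - (angLen (fun i => (A' i : ℕ)) : ℤ)) *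
              ‖d1B (fun i => (A i : ℕ)) (d2B (fun i => (B i : ℕ))
                  (d3B (fun i => (A' i : ℕ)) a)) q p q'‖)
        else 0
    else 0

/-- The plain bisymbol class `BS^m_σ(1)` (the case `λ ≡ 1`). -/
def IsBisymbolOne {n : ℕ} [NeZero n] (m σ : ℝ) (a : Vec n → Vec n → Vec n → ℂ) : Prop :=
  ContDiff ℝ (⊤ : ℕ∞) (fun x : Vec n × Vec n × Vec n => a x.1 x.2.1 x.2.2) ∧
  ∀ A B A' : Fin n → ℕ, ∃ C > 0, ∀ q p q' : Vec n,
    ‖d1B A (d2B B (d3B A' a)) q p q'‖ ≤ C * jbr 1 p ^ (m - σ * (fullLen B : ℝ))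

/-- The seminorm `|a|_{M, m, σ}` on `BS^m_σ(1)`. -/
def bisymSeminormOne {n : ℕ} [NeZero n] (M : ℕ) (m σ : ℝ)
    (a : Vec n → Vec n → Vec n → ℂ) : ℝ :=
  ∑ A : Fin n → Fin (M + 1), ∑ B : Fin n → Fin (M + 1), ∑ A' : Fin n → Fin (M + 1),
    if fullLen (fun i => (A i : ℕ)) + fullLen (fun i => (B i : ℕ))
        + fullLen (fun i => (A' i : ℕ)) ≤ M then
      ⨆ q : Vec n, ⨆ p : Vec n, ⨆ q' : Vec n,
        jbr 1 p ^ (-m + σ * (fullLen (fun i => (B i : ℕ)) : ℝ)) *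
          ‖d1B (fun i => (A i : ℕ)) (d2B (fun i => (B i : ℕ))
              (d3B (fun i => (A' i : ℕ)) a)) q p q'‖
    else 0

/-- The oscillatory phase `e^{i p · (q - q')}`. -/
def phase {n : ℕ} (p q q' : Vec n) : ℂ :=
  Complex.exp (Complex.I * ((∑ i, p i * (q i - q' i) : ℝ) : ℂ))

/-- The pseudodifferential operator `Op^g(a)` with bisymbol `a`, as an iterated integral:
`Op^g(a)u(q) = (2π)^{-n} g(q)^{-1/4} ∫ dp ∫ dq' a(q,p,q') e^{ip⋅(q-q')} u(q') g(q')^{1/4}`. -/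
def OpG {n : ℕ} (g : Vec n → ℝ) (a : Vec n → Vec n → Vec n → ℂ) (u : Vec n → ℂ) :
    Vec n → ℂ :=
  fun q => (((2 * Real.pi) ^ (-(n : ℤ)) : ℝ) : ℂ) * ((g q ^ (-(1 : ℝ) / 4) : ℝ) : ℂ) *
    ∫ p : Vec n, ∫ q' : Vec n,
      a q p q' * phase p q q' * u q' * ((g q' ^ ((1 : ℝ) / 4) : ℝ) : ℂ)

/-- The pseudodifferential operator `Op(a) = Op^1(a)` with bisymbol `a`. -/
def Op {n : ℕ} (a : Vec n → Vec n → Vec n → ℂ) (u : Vec n → ℂ) : Vec n → ℂ :=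
  fun q => (((2 * Real.pi) ^ (-(n : ℤ)) : ℝ) : ℂ) *
    ∫ p : Vec n, ∫ q' : Vec n, a q p q' * phase p q q' * u q'

/-- The `t`-quantization `Op^{g,t}(a)` of a symbol `a`. -/
def OpSt {n : ℕ} (g : Vec n → ℝ) (t : ℝ) (a : Vec n → Vec n → ℂ) (u : Vec n → ℂ) :
    Vec n → ℂ :=
  OpG g (fun q p q' => a (t • q + (1 - t) • q') p) u

/-- The quantization `Op(b)` of a symbol `b` (the case `t = 1`, `g ≡ 1`). -/
def OpSym {n : ℕ} (b : Vec n → Vec n → ℂ) (u : Vec n → ℂ) : Vec n → ℂ :=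
  Op (fun q p _ => b q p) u

/-- The `L²(g^{1/2}dq)` norm. -/
def L2g {n : ℕ} (g : Vec n → ℝ) (f : Vec n → ℂ) : ℝ :=
  Real.sqrt (∫ q : Vec n, ‖f q‖ ^ 2 * Real.sqrt (g q))

/-- The `L²(dq)` norm. -/
def L2 {n : ℕ} (f : Vec n → ℂ) : ℝ :=
  Real.sqrt (∫ q : Vec n, ‖f q‖ ^ 2)

end

noncomputable section

/-- The class `𝓑` of smooth functions with all derivatives bounded. -/
def InBClass {n : ℕ} (χ : Vec n → ℂ) : Prop :=
  ContDiff ℝ (⊤ : ℕ∞) χ ∧ ∀ A : Fin n → ℕ, ∃ C : ℝ, ∀ q : Vec n, ‖mpd A χ q‖ ≤ C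

/-- The seminorm `|χ|_M = ∑_{|A| ≤ M} ‖∂^A χ‖_{L^∞}` on `𝓑`. -/
def bSeminorm {n : ℕ} (M : ℕ) (χ : Vec n → ℂ) : ℝ :=
  ∑ A : Fin n → Fin (M + 1),
    if fullLen (fun i => (A i : ℕ)) ≤ M then
      ⨆ q : Vec n, ‖mpd (fun i => (A i : ℕ)) χ q‖
    else 0

/-- The distance between two subsets of `ℝⁿ`. -/
def setDist {n : ℕ} (S T : Set (Vec n)) : ℝ :=
  sInf {d : ℝ | ∃ x ∈ S, ∃ y ∈ T, d = dist x y}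

end


section DirectionalDerivatives

variable {E : Type*} [NormedAddCommGroup E] [NormedSpace ℝ E]

/-- The derivative of `f` in the direction `v`. -/
noncomputable def dirDeriv (v : E) (f : E → ℂ) : E → ℂ := fun z => fderiv ℝ f z v

/-- The iterated derivative of `f` along a list of directions. -/
noncomputable def dirDerivs (L : List E) (f : E → ℂ) : E → ℂ := L.foldr dirDeriv f

lemma contDiff_dirDeriv {f : E → ℂ} (hf : ContDiff ℝ (⊤ : ℕ∞) f) (v : E) :
    ContDiff ℝ (⊤ : ℕ∞) (dirDeriv v f) :=
  (hf.fderiv_right (m := (⊤ : ℕ∞)) (by simp)).clm_apply contDiff_const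

lemma contDiff_dirDerivs {f : E → ℂ} (hf : ContDiff ℝ (⊤ : ℕ∞) f) (L : List E) :
    ContDiff ℝ (⊤ : ℕ∞) (dirDerivs L f) := by
  induction L with
  | nil => exact hf
  | cons v L ih => exact contDiff_dirDeriv ih v

lemma dirDerivs_append (L₁ L₂ : List E) (f : E → ℂ) :
    dirDerivs (L₁ ++ L₂) f = dirDerivs L₁ (dirDerivs L₂ f) := by
  simp [dirDerivs, List.foldr_append]

lemma dirDeriv_comm {f : E → ℂ} (hf : ContDiff ℝ (⊤ : ℕ∞) f) (v w : E) :
    dirDeriv v (dirDeriv w f) = dirDeriv w (dirDeriv v f) := by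
  funext z
  have hd : DifferentiableAt ℝ (fderiv ℝ f) z :=
    ((hf.fderiv_right (m := (⊤ : ℕ∞)) (by simp)).differentiable (by simp)).differentiableAt
  have key : ∀ a b : E, dirDeriv a (dirDeriv b f) z = fderiv ℝ (fderiv ℝ f) z a b := by
    intro a b
    have := fderiv_clm_apply hd (differentiableAt_const b)
    change fderiv ℝ (fun y => fderiv ℝ f y b) z a = _
    rw [this]
    simp
  rw [key, key]
  exact (hf.contDiffAt.isSymmSndFDerivAt (by
    rw [minSmoothness_of_isRCLikeNormedField]
    exact WithTop.coe_le_coe.2 (le_top : (2 : ℕ∞) ≤ ⊤))) v w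

lemma dirDerivs_perm {L₁ L₂ : List E} (h : L₁.Perm L₂) {f : E → ℂ}
    (hf : ContDiff ℝ (⊤ : ℕ∞) f) : dirDerivs L₁ f = dirDerivs L₂ f := by
  induction h with
  | nil => rfl
  | cons v _ ih => simp only [dirDerivs, List.foldr_cons] at ih ⊢; rw [ih]
  | swap v w l => exact dirDeriv_comm (contDiff_dirDerivs hf l) w v
  | trans _ _ ih₁ ih₂ => exact ih₁.trans ih₂

lemma iteratedFDeriv_apply_eq_dirDerivs {f : E → ℂ} (hf : ContDiff ℝ (⊤ : ℕ∞) f) {k : ℕ}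
    (m : Fin k → E) (z : E) :
    iteratedFDeriv ℝ k f z m = dirDerivs (List.ofFn m) f z := by
  induction k generalizing z with
  | zero => simp [dirDerivs]
  | succ k ih =>
    have hd : DifferentiableAt ℝ (iteratedFDeriv ℝ k f) z :=
      (hf.differentiable_iteratedFDeriv (by exact_mod_cast ENat.natCast_lt_top k)).differentiableAt
    rw [iteratedFDeriv_succ_apply_left, List.ofFn_succ]
    change _ = fderiv ℝ (dirDerivs (List.ofFn fun i => m i.succ) f) z (m 0)
    have : dirDerivs (List.ofFn fun i => m i.succ) f
        = fun y => iteratedFDeriv ℝ k f y (Fin.tail m) := by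
      funext y
      exact (ih (Fin.tail m) y).symm
    rw [this, fderiv_continuousMultilinear_apply_const_apply hd]

lemma norm_iteratedFDeriv_dirDeriv_le {f : E → ℂ} (hf : ContDiff ℝ (⊤ : ℕ∞) f) (v z : E) (k : ℕ) :
    ‖iteratedFDeriv ℝ k (dirDeriv v f) z‖ ≤ ‖v‖ * ‖iteratedFDeriv ℝ (k + 1) f z‖ := by
  have h : dirDeriv v f = (ContinuousLinearMap.apply ℝ ℂ v) ∘ fderiv ℝ f := rfl
  rw [h, ← norm_iteratedFDeriv_fderiv]
  have hc : ContDiff ℝ (⊤ : ℕ∞) (fderiv ℝ f) := hf.fderiv_right (by simp)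
  refine (ContinuousLinearMap.norm_iteratedFDeriv_comp_left _ hc.contDiffAt
    (by exact_mod_cast le_top)).trans ?_
  gcongr
  refine ContinuousLinearMap.opNorm_le_bound _ (norm_nonneg _) fun T => ?_
  simpa [mul_comm] using T.le_opNorm v

lemma norm_iteratedFDeriv_dirDerivs_le {f : E → ℂ} (hf : ContDiff ℝ (⊤ : ℕ∞) f) (L : List E)
    (hL : ∀ v ∈ L, ‖v‖ ≤ 1) (z : E) (k : ℕ) :
    ‖iteratedFDeriv ℝ k (dirDerivs L f) z‖ ≤ ‖iteratedFDeriv ℝ (k + L.length) f z‖ := by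
  induction L generalizing k with
  | nil => simp [dirDerivs]
  | cons v L ih =>
    refine (norm_iteratedFDeriv_dirDeriv_le (contDiff_dirDerivs hf L) v z k).trans ?_
    have h1 := ih (fun w hw => hL w (List.mem_cons_of_mem _ hw)) (k + 1)
    have h2 := hL v List.mem_cons_self
    calc _ ≤ 1 * ‖iteratedFDeriv ℝ (k + 1) (dirDerivs L f) z‖ := by gcongr
      _ ≤ _ := by
        rw [one_mul, List.length_cons, show k + (L.length + 1) = k + 1 + L.length by ring]
        exact h1

lemma norm_iteratedFDeriv_le_of_dirDerivs {κ : Type*} [Fintype κ] {e : κ → E} {coord : κ → E → ℝ}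
    (hsum : ∀ z, z = ∑ c, coord c z • e c) (hcoord : ∀ c z, |coord c z| ≤ ‖z‖)
    {f : E → ℂ} (hf : ContDiff ℝ (⊤ : ℕ∞) f) {k : ℕ} {z : E} {K : ℝ}
    (hK : ∀ c : Fin k → κ, ‖dirDerivs (List.ofFn fun i => e (c i)) f z‖ ≤ K) :
    ‖iteratedFDeriv ℝ k f z‖ ≤ (Fintype.card κ : ℝ) ^ k * K := by
  have hK0 : 0 ≤ (Fintype.card κ : ℝ) ^ k * K := by
    rcases isEmpty_or_nonempty (Fin k → κ) with hE | ⟨⟨c⟩⟩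
    · have : (Fintype.card κ : ℝ) ^ k = 0 := by
        have := Fintype.card_eq_zero (α := Fin k → κ)
        rw [Fintype.card_fun, Fintype.card_fin] at this
        exact_mod_cast this
      simp [this]
    · have := (norm_nonneg _).trans (hK c)
      positivity
  refine ContinuousMultilinearMap.opNorm_le_bound hK0 fun m => ?_
  have hm : m = fun i => ∑ c, coord c (m i) • e c := funext fun i => hsum (m i)
  have expand : iteratedFDeriv ℝ k f z m
      = ∑ c : Fin k → κ, (∏ i, coord (c i) (m i)) •
          iteratedFDeriv ℝ k f z (fun i => e (c i)) := by
    conv_lhs => rw [hm]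
    have := (iteratedFDeriv ℝ k f z).toMultilinearMap.map_sum
      (fun i c => coord c (m i) • e c)
    simp only [ContinuousMultilinearMap.coe_coe] at this
    rw [this]
    refine Finset.sum_congr rfl fun c _ => ?_
    exact (iteratedFDeriv ℝ k f z).toMultilinearMap.map_smul_univ _ _
  rw [expand]
  calc _ ≤ ∑ c : Fin k → κ, (∏ i, ‖m i‖) * K := by
        refine norm_sum_le_of_le _ fun c _ => ?_
        rw [norm_smul, iteratedFDeriv_apply_eq_dirDerivs hf]
        refine mul_le_mul ?_ (hK c) (norm_nonneg _) (by positivity)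
        rw [Real.norm_eq_abs, Finset.abs_prod]
        exact Finset.prod_le_prod (fun _ _ => abs_nonneg _) fun i _ => hcoord _ _
    _ = _ := by
        simp only [Finset.sum_const, Finset.card_univ, nsmul_eq_mul, Fintype.card_fun,
          Fintype.card_fin]
        push_cast
        ring

end DirectionalDerivatives

section Plancherel

open FourierTransform SchwartzMap in
/-- The integral Fourier transform of an integrable `L²` function agrees with its `L²` Fourier
transform. -/
lemma fourier_toLp_ae_eq {V : Type*} [NormedAddCommGroup V] [InnerProductSpace ℝ V]
    [FiniteDimensional ℝ V] [MeasurableSpace V] [BorelSpace V] {f : V → ℂ}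
    (hf : Integrable f) (hf2 : MemLp f 2) :
    ∀ᵐ ξ, (𝓕 (hf2.toLp f) : Lp (α := V) ℂ 2 volume) ξ = 𝓕 f ξ := by
  have hcont : Continuous (𝓕 f) :=
    VectorFourier.fourierIntegral_continuous Real.continuous_fourierChar
      (by exact continuous_inner) hf
  refine ae_eq_of_integral_contDiff_smul_eq ?_ hcont.locallyIntegrable ?_
  · exact (Lp.memLp (𝓕 (hf2.toLp f) : Lp (α := V) ℂ 2 volume)).locallyIntegrable one_le_two
  · intro g hg hgs
    have hgc : ContDiff ℝ (⊤ : ℕ∞) (fun x => (g x : ℂ)) := Complex.ofRealCLM.contDiff.comp hg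
    have hgcs : HasCompactSupport (fun x => (g x : ℂ)) :=
      HasCompactSupport.comp_left (g := Complex.ofReal) hgs Complex.ofReal_zero
    set φ : 𝓢(V, ℂ) := hgcs.toSchwartzMap hgc with hφ
    have hφx : ∀ x, φ x = (g x : ℂ) := fun x => rfl
    have h1 := congrArg (fun T => T φ) (Lp.fourier_toTemperedDistribution_eq (hf2.toLp f))
    simp only [TemperedDistribution.fourier_apply, Lp.toTemperedDistribution_apply] at h1
    have h2 : ∫ x, (𝓕 φ) x • (hf2.toLp f) x = ∫ x, (𝓕 φ) x • f x := by
      refine integral_congr_ae ?_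
      filter_upwards [hf2.coeFn_toLp] with x hx
      rw [hx]
    have h3 : ∫ ξ, 𝓕 f ξ • φ ξ = ∫ x, f x • (𝓕 φ) x := by
      rw [SchwartzMap.fourier_coe]
      have := VectorFourier.integral_fourierIntegral_smul_eq_flip (L := innerₗ V)
        (e := Real.fourierChar) (μ := volume) (ν := volume) (g := φ)
        Real.continuous_fourierChar (by exact continuous_inner) hf φ.integrable
      rw [flip_innerₗ] at this
      exact this
    calc ∫ x, g x • (𝓕 (hf2.toLp f) : Lp (α := V) ℂ 2 volume) x
        = ∫ x, φ x • (𝓕 (hf2.toLp f) : Lp (α := V) ℂ 2 volume) x := by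
          simp only [hφx, Complex.real_smul, smul_eq_mul]
      _ = ∫ x, (𝓕 φ) x • f x := by rw [← h1, h2]
      _ = ∫ ξ, 𝓕 f ξ • φ ξ := by rw [h3]; simp only [smul_eq_mul, mul_comm]
      _ = _ := by simp only [hφx, Complex.real_smul, smul_eq_mul, mul_comm]

lemma lintegral_enorm_sq_eq_eLpNorm_sq {α : Type*} [MeasurableSpace α] (μ : Measure α)
    (f : α → ℂ) : ∫⁻ x, ‖f x‖ₑ ^ 2 ∂μ = eLpNorm f 2 μ ^ 2 := by
  have := eLpNorm_nnreal_pow_eq_lintegral (f := f) (μ := μ) (p := 2) two_ne_zero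
  simp only [NNReal.coe_ofNat, ENNReal.rpow_ofNat, ENNReal.coe_ofNat] at this
  exact this.symm

open FourierTransform in
lemma lintegral_enorm_sq_fourier {V : Type*} [NormedAddCommGroup V] [InnerProductSpace ℝ V]
    [FiniteDimensional ℝ V] [MeasurableSpace V] [BorelSpace V] {f : V → ℂ}
    (hf : Integrable f) (hf2 : MemLp f 2) :
    ∫⁻ ξ, ‖𝓕 f ξ‖ₑ ^ 2 = ∫⁻ x, ‖f x‖ₑ ^ 2 := by
  have h1 : ∫⁻ ξ, ‖𝓕 f ξ‖ₑ ^ 2 = ∫⁻ ξ, ‖(𝓕 (hf2.toLp f) : Lp (α := V) ℂ 2 volume) ξ‖ₑ ^ 2 := by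
    refine lintegral_congr_ae ?_
    filter_upwards [fourier_toLp_ae_eq hf hf2] with x hx
    rw [hx]
  rw [h1, lintegral_enorm_sq_eq_eLpNorm_sq, lintegral_enorm_sq_eq_eLpNorm_sq]
  have h2 := Lp.norm_fourier_eq (hf2.toLp f)
  rw [← eLpNorm_congr_ae hf2.coeFn_toLp, ← Lp.enorm_def, ← Lp.enorm_def, ← ofReal_norm,
    ← ofReal_norm, h2]

open FourierTransform in
lemma phase_integral_eq_fourier {n : ℕ} (f : Vec n → ℂ) (p : Vec n) :
    ∫ x, phase p 0 x * f x =
      𝓕 (fun y : EuclideanSpace ℝ (Fin n) => f (WithLp.ofLp y))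
        (WithLp.toLp 2 ((2 * π)⁻¹ • p)) := by
  rw [Real.fourier_eq', ← (PiLp.volume_preserving_ofLp (Fin n)).integral_comp
    (MeasurableEquiv.toLp 2 (Fin n → ℝ)).symm.measurableEmbedding]
  refine integral_congr_ae (Filter.Eventually.of_forall fun y => ?_)
  simp only [phase, smul_eq_mul, Pi.zero_apply, zero_sub]
  congr 2
  rw [PiLp.inner_apply]
  simp only [RCLike.inner_apply, conj_trivial, Pi.smul_apply, smul_eq_mul]
  rw [mul_comm Complex.I]
  congr 1
  congr 1
  rw [Finset.mul_sum]
  refine Finset.sum_congr rfl fun i _ => ?_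
  field_simp

/-- Plancherel's inequality for the non-normalized Fourier transform on `ℝⁿ`. -/
lemma lintegral_enorm_sq_phase_integral {n : ℕ} {f : Vec n → ℂ} (hf : Integrable f)
    (hf2 : MemLp f 2) :
    ∫⁻ p, ‖∫ x, phase p 0 x * f x‖ₑ ^ 2
      = ENNReal.ofReal ((2 * π) ^ n) * ∫⁻ x, ‖f x‖ₑ ^ 2 := by
  have hmp := PiLp.volume_preserving_ofLp (Fin n)
  have hemb := (MeasurableEquiv.toLp 2 (Fin n → ℝ)).symm.measurableEmbedding
  set g : EuclideanSpace ℝ (Fin n) → ℂ := fun y => f (WithLp.ofLp y) with hg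
  have hgi : Integrable g := (hmp.integrable_comp_emb hemb).2 hf
  have hg2 : MemLp g 2 := hf2.comp_measurePreserving hmp
  have h1 := lintegral_enorm_sq_fourier hgi hg2
  have h2 : ∫⁻ x, ‖g x‖ₑ ^ 2 = ∫⁻ x, ‖f x‖ₑ ^ 2 :=
    hmp.lintegral_comp_emb hemb fun x => ‖f x‖ₑ ^ 2
  have h3 := (PiLp.volume_preserving_toLp (Fin n)).lintegral_comp_emb
    (MeasurableEquiv.toLp 2 (Fin n → ℝ)).measurableEmbedding
    (fun ξ => ‖FourierTransform.fourier g ξ‖ₑ ^ 2)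
  rw [← h2, ← h1, ← h3]
  simp_rw [phase_integral_eq_fourier]
  have hpi : (2 * π)⁻¹ ≠ 0 := by positivity
  have h4 := (Homeomorph.smulOfNeZero (α := Vec n) _ hpi).measurableEmbedding.lintegral_map
    (μ := (volume : Measure (Vec n)))
    (fun p : Vec n => ‖FourierTransform.fourier g (WithLp.toLp 2 p)‖ₑ ^ 2)
  have h5 : Measure.map (Homeomorph.smulOfNeZero (α := Vec n) _ hpi) volume
      = ENNReal.ofReal ((2 * π) ^ n) • (volume : Measure (Vec n)) := by
    have := Measure.map_addHaar_smul (volume : Measure (Vec n)) hpi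
    rw [Module.finrank_fin_fun, inv_pow, inv_inv, abs_of_pos (by positivity)] at this
    exact this
  rw [h5, lintegral_smul_measure] at h4
  exact h4.symm

end Plancherel

section Seminorms

/-- All derivatives of `f` exist and are bounded. -/
def BddDerivs {E : Type*} [NormedAddCommGroup E] [NormedSpace ℝ E] (f : E → ℂ) : Prop :=
  ContDiff ℝ (⊤ : ℕ∞) f ∧ ∀ k : ℕ, ∃ C : ℝ, ∀ z, ‖iteratedFDeriv ℝ k f z‖ ≤ C

/-- A function of three vector variables, as a function on the product space. -/
def uncurry3 {n : ℕ} (a : Vec n → Vec n → Vec n → ℂ) : Vec n × Vec n × Vec n → ℂ :=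
  fun z => a z.1 z.2.1 z.2.2

/-- The list of directions `e i`, each repeated `A i` times. -/
def dirList {n : ℕ} {E : Type*} (e : Fin n → E) (A : Fin n → ℕ) : List E :=
  (List.finRange n).flatMap fun i => List.replicate (A i) (e i)

lemma coe_dirList {n : ℕ} {E : Type*} (e : Fin n → E) (A : Fin n → ℕ) :
    (dirList e A : Multiset E) = ∑ i, A i • {e i} := by
  have key : ∀ l : List (Fin n), ((l.flatMap fun i => List.replicate (A i) (e i) : List E) :
      Multiset E) = (l.map fun i => A i • ({e i} : Multiset E)).sum := by
    intro l
    induction l with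
    | nil => rfl
    | cons i l ih =>
      rw [List.flatMap_cons, ← Multiset.coe_add, ih, List.map_cons, List.sum_cons,
        Multiset.nsmul_singleton, Multiset.coe_replicate]
  rw [dirList, key, ← List.ofFn_eq_map, List.sum_ofFn]

lemma map_dirList {n : ℕ} {E F : Type*} (e : Fin n → E) (A : Fin n → ℕ) (ι : E → F) :
    (dirList e A).map ι = dirList (fun i => ι (e i)) A := by
  simp [dirList, List.map_flatMap]

lemma mem_dirList {n : ℕ} {E : Type*} {e : Fin n → E} {A : Fin n → ℕ} {v : E}
    (hv : v ∈ dirList e A) : ∃ i, v = e i := by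
  simp only [dirList, List.mem_flatMap, List.mem_replicate] at hv
  obtain ⟨i, -, -, h⟩ := hv
  exact ⟨i, h⟩

lemma length_dirList {n : ℕ} {E : Type*} (e : Fin n → E) (A : Fin n → ℕ) :
    (dirList e A).length = fullLen A := by
  have h := congrArg Multiset.card (coe_dirList e A)
  rw [Multiset.coe_card] at h
  rw [h]
  simp [fullLen, Multiset.card_sum]

lemma mpd_eq_dirDerivs {n : ℕ} (A : Fin n → ℕ) (f : Vec n → ℂ) :
    mpd A f = dirDerivs (dirList (fun i => Pi.single i 1) A) f := by
  have hrep : ∀ (i : Fin n) (k : ℕ) (g : Vec n → ℂ),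
      (pdC i)^[k] g = dirDerivs (List.replicate k (Pi.single i 1)) g := by
    intro i k g
    induction k with
    | zero => rfl
    | succ k ih => rw [Function.iterate_succ_apply', ih]; rfl
  have key : ∀ l : List (Fin n), l.foldr (fun i g => (pdC i)^[A i] g) f
      = dirDerivs (l.flatMap fun i => List.replicate (A i) (Pi.single i (1 : ℝ))) f := by
    intro l
    induction l with
    | nil => rfl
    | cons i l ih => rw [List.foldr_cons, ih, List.flatMap_cons, dirDerivs_append, hrep]
  exact key _

variable {E E' : Type*} [NormedAddCommGroup E] [NormedSpace ℝ E] [NormedAddCommGroup E']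
  [NormedSpace ℝ E']

lemma dirDerivs_comp_affine {F : E → ℂ} (hF : ContDiff ℝ (⊤ : ℕ∞) F) (ι : E' →L[ℝ] E) (c : E)
    (L : List E') :
    dirDerivs L (fun x => F (c + ι x)) = fun x => dirDerivs (L.map ι) F (c + ι x) := by
  induction L with
  | nil => rfl
  | cons v L ih =>
    change dirDeriv v (dirDerivs L _) = _
    rw [ih]
    funext x
    have h1 : HasFDerivAt (fun x => c + ι x) ι x := ι.hasFDerivAt.const_add c
    have h2 := (((contDiff_dirDerivs hF (L.map ι)).differentiable (by simp)) (c + ι x)).hasFDerivAt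
    change fderiv ℝ _ x v = _
    have h3 : HasFDerivAt (fun x => dirDerivs (L.map ι) F (c + ι x)) _ x := h2.comp x h1
    rw [h3.fderiv]
    rfl

lemma uncurry3_d2B {n : ℕ} {b : Vec n → Vec n → Vec n → ℂ} (hb : ContDiff ℝ (⊤ : ℕ∞) (uncurry3 b))
    (B : Fin n → ℕ) :
    uncurry3 (d2B B b) = dirDerivs (dirList (fun i => (0, Pi.single i 1, 0)) B) (uncurry3 b) := by
  funext ⟨q, p, q'⟩
  have := congrFun (dirDerivs_comp_affine hb ((ContinuousLinearMap.inr ℝ (Vec n) (Vec n × Vec n)).comp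
    (ContinuousLinearMap.inl ℝ (Vec n) (Vec n))) (q, 0, q')
    (dirList (fun i => Pi.single i 1) B)) p
  simpa [uncurry3, d2B, mpd_eq_dirDerivs, map_dirList] using this

lemma uncurry3_derivs {n : ℕ} {a : Vec n → Vec n → Vec n → ℂ}
    (ha : ContDiff ℝ (⊤ : ℕ∞) (uncurry3 a)) (A B A' : Fin n → ℕ) :
    uncurry3 (d1B A (d2B B (d3B A' a))) =
      dirDerivs (dirList (fun i => (Pi.single i 1, 0, 0)) A ++
        (dirList (fun i => (0, Pi.single i 1, 0)) B ++
          dirList (fun i => (0, 0, Pi.single i 1)) A')) (uncurry3 a) := by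
  have h3 : ∀ {b : Vec n → Vec n → Vec n → ℂ}, ContDiff ℝ (⊤ : ℕ∞) (uncurry3 b) → ∀ A,
      uncurry3 (d3B A b) = dirDerivs (dirList (fun i => (0, 0, Pi.single i 1)) A) (uncurry3 b) := by
    rintro b hb A
    funext ⟨q, p, q'⟩
    have := congrFun (dirDerivs_comp_affine hb ((ContinuousLinearMap.inr ℝ (Vec n) (Vec n × Vec n)).comp
      (ContinuousLinearMap.inr ℝ (Vec n) (Vec n))) (q, p, 0)
      (dirList (fun i => Pi.single i 1) A)) q'
    simpa [uncurry3, d3B, mpd_eq_dirDerivs, map_dirList] using this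
  have h1 : ∀ {b : Vec n → Vec n → Vec n → ℂ}, ContDiff ℝ (⊤ : ℕ∞) (uncurry3 b) → ∀ A,
      uncurry3 (d1B A b) = dirDerivs (dirList (fun i => (Pi.single i 1, 0, 0)) A) (uncurry3 b) := by
    rintro b hb A
    funext ⟨q, p, q'⟩
    have := congrFun (dirDerivs_comp_affine hb
      (ContinuousLinearMap.inl ℝ (Vec n) (Vec n × Vec n)) (0, p, q')
      (dirList (fun i => Pi.single i 1) A)) q
    simpa [uncurry3, d1B, mpd_eq_dirDerivs, map_dirList, Prod.zero_eq_mk] using this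
  have s3 : ContDiff ℝ (⊤ : ℕ∞) (uncurry3 (d3B A' a)) := by
    rw [h3 ha]; exact contDiff_dirDerivs ha _
  have s2 : ContDiff ℝ (⊤ : ℕ∞) (uncurry3 (d2B B (d3B A' a))) := by
    rw [uncurry3_d2B s3]; exact contDiff_dirDerivs s3 _
  rw [h1 s2, uncurry3_d2B s3, h3 ha, dirDerivs_append, dirDerivs_append]

/-- Any list of coordinate directions in the product space is a rearrangement of a multiindex. -/
lemma exists_perm_dirList {n : ℕ} {E : Type*} (e₁ e₂ e₃ : Fin n → E)
    (l : List (Fin n ⊕ Fin n ⊕ Fin n)) :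
    ∃ A B A' : Fin n → ℕ, (l.map (Sum.elim e₁ (Sum.elim e₂ e₃))).Perm
      (dirList e₁ A ++ (dirList e₂ B ++ dirList e₃ A')) := by
  have hs : ∀ (e : Fin n → E) (A : Fin n → ℕ) (i : Fin n),
      ∑ j, (Pi.single i 1 + A : Fin n → ℕ) j • ({e j} : Multiset E) = {e i} + ∑ j, A j • {e j} := by
    intro e A i
    simp [add_smul, Finset.sum_add_distrib, Pi.single_apply, ite_smul]
  simp only [← Multiset.coe_eq_coe, ← Multiset.coe_add, coe_dirList]
  induction l with
  | nil => exact ⟨0, 0, 0, by simp⟩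
  | cons x l ih =>
    obtain ⟨A, B, A', h⟩ := ih
    rw [List.map_cons, ← Multiset.cons_coe, h, ← Multiset.singleton_add]
    rcases x with i | i | i
    · exact ⟨Pi.single i 1 + A, B, A', by rw [hs]; simp only [Sum.elim_inl]; abel⟩
    · exact ⟨A, Pi.single i 1 + B, A', by rw [hs]; simp only [Sum.elim_inl, Sum.elim_inr]; abel⟩
    · exact ⟨A, B, Pi.single i 1 + A', by rw [hs]; simp only [Sum.elim_inr]; abel⟩

lemma fullLen_le_iff_fin {n M : ℕ} {A : Fin n → ℕ} (h : fullLen A ≤ M) :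
    ∃ A₀ : Fin n → Fin (M + 1), (fun i => (A₀ i : ℕ)) = A := by
  have hi : ∀ i, A i < M + 1 := fun i =>
    Nat.lt_succ_of_le ((Finset.single_le_sum (fun _ _ => Nat.zero_le _) (Finset.mem_univ i)).trans h)
  exact ⟨fun i => ⟨A i, hi i⟩, rfl⟩

/-- If all mixed coordinate derivatives of total order `k` are bounded at `z`,
so is the `k`-th derivative. -/
lemma norm_iteratedFDeriv_uncurry3_le {n : ℕ} {a : Vec n → Vec n → Vec n → ℂ}
    (ha : ContDiff ℝ (⊤ : ℕ∞) (uncurry3 a)) {k : ℕ} {K : ℝ} (z : Vec n × Vec n × Vec n)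
    (h : ∀ A B A' : Fin n → ℕ, fullLen A + fullLen B + fullLen A' = k →
      ‖d1B A (d2B B (d3B A' a)) z.1 z.2.1 z.2.2‖ ≤ K) :
    ‖iteratedFDeriv ℝ k (uncurry3 a) z‖ ≤ (3 * n : ℝ) ^ k * K := by
  have key := norm_iteratedFDeriv_le_of_dirDerivs (κ := Fin n ⊕ Fin n ⊕ Fin n) (k := k) (z := z)
    (f := uncurry3 a) (K := K)
    (e := Sum.elim (fun i => ((Pi.single i 1, 0, 0) : Vec n × Vec n × Vec n))
      (Sum.elim (fun i => (0, Pi.single i 1, 0)) (fun i => (0, 0, Pi.single i 1))))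
    (coord := Sum.elim (fun i z => z.1 i) (Sum.elim (fun i z => z.2.1 i) (fun i z => z.2.2 i)))
    ?_ ?_ ha ?_
  · convert key using 2
    simp; ring
  · rintro ⟨q, p, q'⟩
    have hx : ∀ x : Vec n, ∑ i, x i • (Pi.single i 1 : Vec n) = x := by
      intro x; ext j; simp [Finset.sum_apply, Pi.single_apply]
    simp only [Fintype.sum_sum_type, Sum.elim_inl, Sum.elim_inr, Prod.smul_mk, smul_zero]
    ext1
    · simp [Prod.fst_sum, hx]
    · ext1 <;> simp [Prod.fst_sum, Prod.snd_sum, hx]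
  · rintro (i | i | i) w
    · exact (norm_le_pi_norm w.1 i).trans (norm_fst_le w)
    · exact (norm_le_pi_norm w.2.1 i).trans ((norm_fst_le w.2).trans (norm_snd_le w))
    · exact (norm_le_pi_norm w.2.2 i).trans ((norm_snd_le w.2).trans (norm_snd_le w))
  · intro c
    obtain ⟨A, B, A', hp⟩ := exists_perm_dirList
      (fun i => ((Pi.single i 1, 0, 0) : Vec n × Vec n × Vec n))
      (fun i => (0, Pi.single i 1, 0)) (fun i => (0, 0, Pi.single i 1)) (List.ofFn c)
    rw [List.map_ofFn] at hp
    have hlen := hp.length_eq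
    simp only [List.length_ofFn, List.length_append, length_dirList] at hlen
    have := h A B A' (by omega)
    change ‖uncurry3 (d1B A (d2B B (d3B A' a))) z‖ ≤ K at this
    rw [uncurry3_derivs ha, ← dirDerivs_perm hp ha] at this
    exact this

lemma BddDerivs.exists_norm_derivs_le {n : ℕ} {a : Vec n → Vec n → Vec n → ℂ}
    (ha : BddDerivs (uncurry3 a)) (A B A' : Fin n → ℕ) :
    ∃ C, ∀ z, ‖uncurry3 (d1B A (d2B B (d3B A' a))) z‖ ≤ C := by
  rw [uncurry3_derivs ha.1]
  set L := dirList (fun i => ((Pi.single i 1, 0, 0) : Vec n × Vec n × Vec n)) A ++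
        (dirList (fun i => (0, Pi.single i 1, 0)) B ++
          dirList (fun i => (0, 0, Pi.single i 1)) A') with hL
  obtain ⟨C, hC⟩ := ha.2 (0 + L.length)
  refine ⟨C, fun z => ?_⟩
  have hsingle : ∀ i : Fin n, ‖(Pi.single i 1 : Vec n)‖ ≤ 1 := fun i => by
    rw [Pi.norm_single]; simp
  have := norm_iteratedFDeriv_dirDerivs_le ha.1 L (fun v hv => ?_) z 0
  · rw [norm_iteratedFDeriv_zero] at this
    exact this.trans (hC z)
  · simp only [hL, List.mem_append] at hv
    rcases hv with hv | hv | hv <;> obtain ⟨i, rfl⟩ := mem_dirList hv <;> simp [Prod.norm_def, hsingle]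

lemma IsBisymbolOne.bddDerivs {n : ℕ} [NeZero n] {a : Vec n → Vec n → Vec n → ℂ}
    (ha : IsBisymbolOne 0 0 a) : BddDerivs (uncurry3 a) := by
  refine ⟨ha.1, fun k => ?_⟩
  choose C hC0 hC using ha.2
  refine ⟨(3 * n : ℝ) ^ k * ∑ A : Fin n → Fin (k + 1), ∑ B : Fin n → Fin (k + 1),
    ∑ A' : Fin n → Fin (k + 1), C (fun i => A i) (fun i => B i) (fun i => A' i), fun z => ?_⟩
  refine norm_iteratedFDeriv_uncurry3_le ha.1 z fun A B A' h => ?_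
  obtain ⟨A, rfl⟩ := fullLen_le_iff_fin (M := k) (A := A) (by omega)
  obtain ⟨B, rfl⟩ := fullLen_le_iff_fin (M := k) (A := B) (by omega)
  obtain ⟨A', rfl⟩ := fullLen_le_iff_fin (M := k) (A := A') (by omega)
  have h1 := hC (fun i => A i) (fun i => B i) (fun i => A' i) z.1 z.2.1 z.2.2
  simp only [zero_mul, sub_zero, Real.rpow_zero, mul_one] at h1
  refine h1.trans ?_
  refine le_trans ?_ (Finset.single_le_sum (f := fun A : Fin n → Fin (k + 1) =>
    ∑ B : Fin n → Fin (k + 1), ∑ A' : Fin n → Fin (k + 1),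
      C (fun i => A i) (fun i => B i) (fun i => A' i))
    (fun _ _ => Finset.sum_nonneg fun _ _ => Finset.sum_nonneg fun _ _ => (hC0 _ _ _).le)
    (Finset.mem_univ A))
  refine le_trans ?_ (Finset.single_le_sum (f := fun B : Fin n → Fin (k + 1) =>
    ∑ A' : Fin n → Fin (k + 1), C (fun i => A i) (fun i => B i) (fun i => A' i))
    (fun _ _ => Finset.sum_nonneg fun _ _ => (hC0 _ _ _).le) (Finset.mem_univ B))
  exact Finset.single_le_sum (f := fun A' : Fin n → Fin (k + 1) =>
    C (fun i => A i) (fun i => B i) (fun i => A' i)) (fun _ _ => (hC0 _ _ _).le)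
    (Finset.mem_univ A')

lemma bisymSeminormOne_nonneg {n : ℕ} [NeZero n] (M : ℕ) (a : Vec n → Vec n → Vec n → ℂ) :
    0 ≤ bisymSeminormOne M 0 0 a := by
  refine Finset.sum_nonneg fun _ _ => Finset.sum_nonneg fun _ _ => Finset.sum_nonneg fun _ _ => ?_
  split_ifs
  · refine Real.iSup_nonneg fun _ => Real.iSup_nonneg fun _ => Real.iSup_nonneg fun _ => ?_
    simp only [neg_zero, zero_mul, add_zero, Real.rpow_zero, one_mul, norm_nonneg]
  · exact le_rfl

lemma norm_iteratedFDeriv_le_bisymSeminormOne {n : ℕ} [NeZero n]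
    {a : Vec n → Vec n → Vec n → ℂ} (ha : BddDerivs (uncurry3 a)) {k M : ℕ} (hk : k ≤ M)
    (z : Vec n × Vec n × Vec n) :
    ‖iteratedFDeriv ℝ k (uncurry3 a) z‖ ≤ (3 * n : ℝ) ^ k * bisymSeminormOne M 0 0 a := by
  refine norm_iteratedFDeriv_uncurry3_le ha.1 z fun A B A' h => ?_
  obtain ⟨C, hC⟩ := ha.exists_norm_derivs_le A B A'
  obtain ⟨A, rfl⟩ := fullLen_le_iff_fin (M := M) (A := A) (by omega)
  obtain ⟨B, rfl⟩ := fullLen_le_iff_fin (M := M) (A := B) (by omega)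
  obtain ⟨A', rfl⟩ := fullLen_le_iff_fin (M := M) (A := A') (by omega)
  have hC' : ∀ q p q', ‖d1B (fun i => (A i : ℕ)) (d2B (fun i => (B i : ℕ))
      (d3B (fun i => (A' i : ℕ)) a)) q p q'‖ ≤ C := fun q p q' => hC (q, p, q')
  have hC0 : 0 ≤ C := (norm_nonneg _).trans (hC z)
  set T : (Fin n → Fin (M + 1)) → (Fin n → Fin (M + 1)) → (Fin n → Fin (M + 1)) → ℝ :=
    fun A B A' => if fullLen (fun i => (A i : ℕ)) + fullLen (fun i => (B i : ℕ))
        + fullLen (fun i => (A' i : ℕ)) ≤ M then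
      ⨆ q : Vec n, ⨆ p : Vec n, ⨆ q' : Vec n,
        jbr 1 p ^ (-(0 : ℝ) + 0 * (fullLen (fun i => (B i : ℕ)) : ℝ)) *
          ‖d1B (fun i => (A i : ℕ)) (d2B (fun i => (B i : ℕ))
              (d3B (fun i => (A' i : ℕ)) a)) q p q'‖ else 0 with hT
  have hT0 : ∀ A B A', 0 ≤ T A B A' := by
    intro A B A'
    simp only [hT]
    split_ifs
    · refine Real.iSup_nonneg fun _ => Real.iSup_nonneg fun _ => Real.iSup_nonneg fun _ => ?_
      simp only [neg_zero, zero_mul, add_zero, Real.rpow_zero, one_mul, norm_nonneg]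
    · exact le_rfl
  have h1 : ‖d1B (fun i => (A i : ℕ)) (d2B (fun i => (B i : ℕ))
      (d3B (fun i => (A' i : ℕ)) a)) z.1 z.2.1 z.2.2‖ ≤ T A B A' := by
    simp only [hT, neg_zero, zero_mul, add_zero, Real.rpow_zero, one_mul]
    rw [if_pos (h.le.trans hk)]
    refine le_trans ?_ (le_ciSup (f := fun q : Vec n => ⨆ p : Vec n, ⨆ q' : Vec n,
      ‖d1B (fun i => (A i : ℕ)) (d2B (fun i => (B i : ℕ))
      (d3B (fun i => (A' i : ℕ)) a)) q p q'‖) ⟨C, ?_⟩ z.1)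
    · refine le_trans ?_ (le_ciSup (f := fun p : Vec n => ⨆ q' : Vec n,
        ‖d1B (fun i => (A i : ℕ)) (d2B (fun i => (B i : ℕ))
        (d3B (fun i => (A' i : ℕ)) a)) z.1 p q'‖) ⟨C, ?_⟩ z.2.1)
      · refine le_ciSup (f := fun q' : Vec n =>
          ‖d1B (fun i => (A i : ℕ)) (d2B (fun i => (B i : ℕ))
          (d3B (fun i => (A' i : ℕ)) a)) z.1 z.2.1 q'‖) ⟨C, ?_⟩ z.2.2
        rintro _ ⟨q', rfl⟩
        exact hC' _ _ _
      · rintro _ ⟨p, rfl⟩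
        exact Real.iSup_le (fun q' => hC' _ _ _) hC0
    · rintro _ ⟨q, rfl⟩
      exact Real.iSup_le (fun p => Real.iSup_le (fun q' => hC' _ _ _) hC0) hC0
  refine h1.trans ?_
  change T A B A' ≤ ∑ A, ∑ B, ∑ A', T A B A'
  refine le_trans ?_ (Finset.single_le_sum (f := fun A => ∑ B, ∑ A', T A B A')
    (fun _ _ => Finset.sum_nonneg fun _ _ => Finset.sum_nonneg fun _ _ => hT0 _ _ _)
    (Finset.mem_univ A))
  refine le_trans ?_ (Finset.single_le_sum (f := fun B => ∑ A', T A B A')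
    (fun _ _ => Finset.sum_nonneg fun _ _ => hT0 _ _ _) (Finset.mem_univ B))
  exact Finset.single_le_sum (f := fun A' => T A B A') (fun _ _ => hT0 _ _ _)
    (Finset.mem_univ A')

lemma bSeminorm_nonneg {n : ℕ} (M : ℕ) (χ : Vec n → ℂ) : 0 ≤ bSeminorm M χ := by
  refine Finset.sum_nonneg fun _ _ => ?_
  split_ifs
  · exact Real.iSup_nonneg fun _ => norm_nonneg _
  · exact le_rfl

lemma norm_iteratedFDeriv_le_bSeminorm {n : ℕ} {χ : Vec n → ℂ} (hχ : InBClass χ) {k M : ℕ}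
    (hk : k ≤ M) (q : Vec n) :
    ‖iteratedFDeriv ℝ k χ q‖ ≤ (n : ℝ) ^ k * bSeminorm M χ := by
  have key := norm_iteratedFDeriv_le_of_dirDerivs (κ := Fin n) (k := k) (z := q)
    (f := χ) (K := bSeminorm M χ) (e := fun i => (Pi.single i 1 : Vec n))
    (coord := fun i z => z i) ?_ ?_ hχ.1 ?_
  · simpa using key
  · intro x; ext j; simp [Finset.sum_apply, Pi.single_apply]
  · exact fun i w => norm_le_pi_norm w i
  · intro c
    have hp : ∃ A : Fin n → ℕ, (List.ofFn fun i => (Pi.single (c i) 1 : Vec n)).Perm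
        (dirList (fun i => Pi.single i 1) A) := by
      simp only [← Multiset.coe_eq_coe, coe_dirList]
      rw [List.ofFn_eq_map]
      generalize List.finRange k = l
      induction l with
      | nil => exact ⟨0, by simp⟩
      | cons x l ih =>
        obtain ⟨A, h⟩ := ih
        refine ⟨Pi.single (c x) 1 + A, ?_⟩
        rw [List.map_cons, ← Multiset.cons_coe, h, ← Multiset.singleton_add]
        simp [add_smul, Finset.sum_add_distrib, Pi.single_apply, ite_smul]
    obtain ⟨A, hp⟩ := hp
    have hlen := hp.length_eq
    rw [List.length_ofFn, length_dirList] at hlen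
    rw [dirDerivs_perm hp hχ.1, ← mpd_eq_dirDerivs]
    obtain ⟨A, rfl⟩ := fullLen_le_iff_fin (M := M) (A := A) (by omega)
    obtain ⟨C, hC⟩ := hχ.2 (fun i => (A i : ℕ))
    have h1 : ‖mpd (fun i => (A i : ℕ)) χ q‖ ≤ if fullLen (fun i => (A i : ℕ)) ≤ M then
        ⨆ q : Vec n, ‖mpd (fun i => (A i : ℕ)) χ q‖ else 0 := by
      rw [if_pos (hlen.symm.le.trans hk)]
      refine le_ciSup (f := fun q : Vec n => ‖mpd (fun i => (A i : ℕ)) χ q‖) ⟨C, ?_⟩ q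
      rintro _ ⟨q, rfl⟩
      exact hC q
    refine h1.trans ?_
    refine Finset.single_le_sum (f := fun A : Fin n → Fin (M + 1) =>
      if fullLen (fun i => (A i : ℕ)) ≤ M then
        ⨆ q : Vec n, ‖mpd (fun i => (A i : ℕ)) χ q‖ else 0) (fun A _ => ?_) (Finset.mem_univ A)
    split_ifs
    · exact Real.iSup_nonneg fun _ => norm_nonneg _
    · exact le_rfl

end Seminorms

section LocalBounds

variable {E E' : Type*} [NormedAddCommGroup E] [NormedSpace ℝ E] [NormedAddCommGroup E']
  [NormedSpace ℝ E']

lemma norm_iteratedFDeriv_comp_clm_le {f : E → ℂ} {s : Set E} (hs : IsOpen s)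
    (hf : ContDiffOn ℝ (⊤ : ℕ∞) f s) (g : E' →L[ℝ] E) {x : E'} (hx : g x ∈ s) (k : ℕ) :
    ‖iteratedFDeriv ℝ k (fun y => f (g y)) x‖ ≤ ‖g‖ ^ k * ‖iteratedFDeriv ℝ k f (g x)‖ := by
  have hs' : IsOpen (g ⁻¹' s) := hs.preimage g.continuous
  have h := g.iteratedFDerivWithin_comp_right hf hs.uniqueDiffOn hs'.uniqueDiffOn hx
    (i := k) (by exact_mod_cast le_top)
  rw [iteratedFDerivWithin_of_isOpen k hs' (by exact hx), iteratedFDerivWithin_of_isOpen k hs hx] at h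
  change ‖iteratedFDeriv ℝ k (f ∘ g) x‖ ≤ _
  rw [h]
  refine (ContinuousMultilinearMap.norm_compContinuousLinearMap_le _ _).trans ?_
  rw [Finset.prod_const, Finset.card_univ, Fintype.card_fin, mul_comm]

lemma norm_iteratedFDeriv_mul_le_of_forall {f g : E → ℂ} {s : Set E} (hs : IsOpen s)
    (hf : ContDiffOn ℝ (⊤ : ℕ∞) f s) (hg : ContDiffOn ℝ (⊤ : ℕ∞) g s) {z : E} (hz : z ∈ s)
    {k : ℕ} {P : ℝ}
    (h : ∀ i ≤ k, ∀ j ≤ k, ‖iteratedFDeriv ℝ i f z‖ * ‖iteratedFDeriv ℝ j g z‖ ≤ P) :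
    ∀ i ≤ k, ‖iteratedFDeriv ℝ i (fun y => f y * g y) z‖ ≤ 2 ^ k * P := by
  intro i hi
  have h1 := norm_iteratedFDerivWithin_mul_le hf hg hs.uniqueDiffOn hz (n := i)
    (by exact_mod_cast le_top)
  simp only [iteratedFDerivWithin_of_isOpen _ hs hz] at h1
  have hP : 0 ≤ P := (mul_nonneg (norm_nonneg _) (norm_nonneg _)).trans
    (h 0 (Nat.zero_le _) 0 (Nat.zero_le _))
  calc _ ≤ _ := h1
    _ ≤ ∑ j ∈ Finset.range (i + 1), (i.choose j : ℝ) * P := by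
        refine Finset.sum_le_sum fun j hj => ?_
        rw [mul_assoc]
        exact mul_le_mul_of_nonneg_left (h _ (by have := Finset.mem_range.1 hj; omega) _ (by omega))
          (Nat.cast_nonneg _)
    _ = 2 ^ i * P := by
        rw [← Finset.sum_mul]
        exact_mod_cast congrArg (fun m : ℕ => (m : ℝ) * P) (Nat.sum_range_choose i)
    _ ≤ 2 ^ k * P := by gcongr; norm_num

/-- Derivatives of positively homogeneous functions of degree `-m`. -/
lemma exists_norm_iteratedFDeriv_le_of_homogeneous [FiniteDimensional ℝ E] {H : E → ℂ} (m : ℕ)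
    (hH : ContDiffOn ℝ (⊤ : ℕ∞) H {0}ᶜ)
    (hom : ∀ t : ℝ, 0 < t → ∀ y, H y = (t : ℂ) ^ m * H (t • y)) (k : ℕ) :
    ∃ C, 0 ≤ C ∧ ∀ y ≠ 0, ‖iteratedFDeriv ℝ k H y‖ ≤ C * ‖y‖⁻¹ ^ (m + k) := by
  have hopen : IsOpen ({0}ᶜ : Set E) := isOpen_compl_singleton
  have hcont : ContinuousOn (fun y => ‖iteratedFDeriv ℝ k H y‖) (Metric.sphere (0 : E) 1) := by
    intro y hy
    have hy0 : y ≠ 0 := by rintro rfl; simp at hy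
    have : ContDiffAt ℝ (⊤ : ℕ∞) H y := hH.contDiffAt (hopen.mem_nhds hy0)
    exact (this.continuousAt_iteratedFDeriv (by exact_mod_cast le_top)).norm.continuousWithinAt
  obtain ⟨C, hC⟩ := (isCompact_sphere (0 : E) 1).exists_bound_of_continuousOn hcont
  refine ⟨max C 0, le_max_right _ _, fun y hy => ?_⟩
  have hn : 0 < ‖y‖ := norm_pos_iff.2 hy
  set t : ℝ := ‖y‖⁻¹ with ht
  have ht0 : 0 < t := inv_pos.2 hn
  have hty : t • y ≠ 0 := smul_ne_zero ht0.ne' hy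
  have hsph : t • y ∈ Metric.sphere (0 : E) 1 := by
    rw [mem_sphere_zero_iff_norm, norm_smul, Real.norm_of_nonneg ht0.le, ht, inv_mul_cancel₀ hn.ne']
  have h1 : H = ((t : ℂ) ^ m) • fun y => H ((t • ContinuousLinearMap.id ℝ E) y) := by
    funext y
    simpa using hom t ht0 y
  have h2 := norm_iteratedFDeriv_comp_clm_le hopen hH (t • ContinuousLinearMap.id ℝ E) (x := y)
    (by simpa using hty) k
  have h3 : ContDiffAt ℝ k (fun y => H ((t • ContinuousLinearMap.id ℝ E) y)) y := by
    have : ContDiffAt ℝ (⊤ : ℕ∞) H (t • y) := hH.contDiffAt (hopen.mem_nhds hty)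
    have := ContDiffAt.comp y (g := H) (f := (t • ContinuousLinearMap.id ℝ E)) (by simpa using this)
      (ContinuousLinearMap.contDiff _).contDiffAt
    exact this.of_le (by exact_mod_cast le_top)
  rw [h1, iteratedFDeriv_const_smul_apply h3, norm_smul]
  have h4 : ‖(t • ContinuousLinearMap.id ℝ E)‖ ≤ t := by
    rw [norm_smul, Real.norm_of_nonneg ht0.le]
    exact mul_le_of_le_one_right ht0.le ContinuousLinearMap.norm_id_le
  have h5 : ‖(t : ℂ) ^ m‖ = t ^ m := by
    rw [norm_pow, Complex.norm_real, Real.norm_of_nonneg ht0.le]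
  have h6 : ‖iteratedFDeriv ℝ k H (t • y)‖ ≤ max C 0 := by
    have := hC _ hsph
    rw [norm_norm] at this
    exact this.trans (le_max_left _ _)
  rw [h5, pow_add]
  calc _ ≤ t ^ m * (t ^ k * max C 0) := by
        refine mul_le_mul_of_nonneg_left (h2.trans ?_) (by positivity)
        refine mul_le_mul (pow_le_pow_left₀ (norm_nonneg _) h4 k) ?_ (norm_nonneg _) (by positivity)
        simpa using h6
    _ = _ := by ring

/-- Taylor-type bound near a zero of infinite order. -/
lemma norm_iteratedFDeriv_le_of_notMem_tsupport {f : E → ℂ} (hf : ContDiff ℝ (⊤ : ℕ∞) f)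
    {K : ℝ} {m : ℕ} (hK : ∀ k ≤ m, ∀ x, ‖iteratedFDeriv ℝ k f x‖ ≤ K) {y : E}
    (hy : y ∉ tsupport f) (l : ℕ) :
    ∀ i, i + l ≤ m → ∀ x, ‖iteratedFDeriv ℝ i f x‖ ≤ K * ‖x - y‖ ^ l := by
  induction l with
  | zero => intro i hi x; simpa using hK i hi x
  | succ l ih =>
    intro i hi x
    have hzero : iteratedFDeriv ℝ i f y = 0 := by
      have : f =ᶠ[nhds y] fun _ => 0 := notMem_tsupport_iff_eventuallyEq.1 hy
      rw [(this.iteratedFDeriv ℝ i).eq_of_nhds]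
      exact congrFun (iteratedFDeriv_fun_zero) y
    have hK0 : 0 ≤ K := (norm_nonneg _).trans (hK 0 (Nat.zero_le _) x)
    have hd := hf.differentiable_iteratedFDeriv (m := i) (by exact_mod_cast ENat.natCast_lt_top _)
    have h1 := Convex.norm_image_sub_le_of_norm_fderiv_le (𝕜 := ℝ) (f := iteratedFDeriv ℝ i f)
      (C := K * ‖x - y‖ ^ l) (s := Metric.closedBall y ‖x - y‖) (x := y) (y := x)
      (fun w _ => hd w) (fun w hw => ?_) (convex_closedBall _ _)
      (Metric.mem_closedBall_self (norm_nonneg _)) (by rw [Metric.mem_closedBall, dist_eq_norm])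
    · rw [hzero, sub_zero] at h1
      rwa [pow_succ, ← mul_assoc]
    · rw [norm_fderiv_iteratedFDeriv]
      refine (ih (i + 1) (by omega) w).trans ?_
      rw [Metric.mem_closedBall, dist_eq_norm] at hw
      gcongr

end LocalBounds

section KernelBounds

/-- The functions `y_j^N / ∑ y_k^{2N}`, which satisfy `∑ y_j^N h_j = 1` off the origin. -/
noncomputable def divFun {n : ℕ} (N : ℕ) (j : Fin n) (y : Vec n) : ℂ :=
  ((y j ^ N / ∑ k, y k ^ (2 * N) : ℝ) : ℂ)

/-- The function `1 / (1 + ∑ y_k^{2n})`. -/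
noncomputable def decayFun {n : ℕ} (y : Vec n) : ℂ := (((1 + ∑ k, y k ^ (2 * n))⁻¹ : ℝ) : ℂ)

/-- An integrable weight on `ℝⁿ`. -/
noncomputable def weight {n : ℕ} (y : Vec n) : ℝ := ((1 + ‖y‖) ^ (2 * n))⁻¹

lemma weight_pos {n : ℕ} (y : Vec n) : 0 < weight y := by
  unfold weight; positivity

lemma integrable_weight (n : ℕ) [NeZero n] : Integrable (weight : Vec n → ℝ) := by
  have hn : 0 < n := Nat.pos_of_ne_zero (NeZero.ne n)
  have h := integrable_one_add_norm (E := Vec n) (μ := volume) (r := ((2 * n : ℕ) : ℝ)) (by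
    rw [Module.finrank_fin_fun]; exact_mod_cast (by omega : n < 2 * n))
  refine h.congr (Filter.Eventually.of_forall fun y => ?_)
  simp only [weight]
  rw [Real.rpow_neg (by positivity), Real.rpow_natCast]

lemma sum_pow_two_mul_pos {n : ℕ} (N : ℕ) {y : Vec n} (hy : y ≠ 0) :
    0 < ∑ k, y k ^ (2 * N) := by
  obtain ⟨k, hk⟩ := Function.ne_iff.1 hy
  refine Finset.sum_pos' (fun i _ => by rw [pow_mul]; positivity) ⟨k, Finset.mem_univ k, ?_⟩
  rw [pow_mul]
  have : y k ≠ 0 := hk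
  positivity

lemma contDiffOn_divFun {n : ℕ} (N : ℕ) (j : Fin n) :
    ContDiffOn ℝ (⊤ : ℕ∞) (divFun N j) {0}ᶜ := by
  refine Complex.ofRealCLM.contDiff.comp_contDiffOn (ContDiffOn.div ?_ ?_ ?_)
  · exact ((contDiff_apply ℝ ℝ j).pow N).contDiffOn
  · exact (ContDiff.sum fun k _ => (contDiff_apply ℝ ℝ k).pow (2 * N)).contDiffOn
  · exact fun y hy => (sum_pow_two_mul_pos N hy).ne'

lemma sum_pow_mul_divFun {n : ℕ} (N : ℕ) {y : Vec n} (hy : y ≠ 0) :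
    ∑ j, (y j : ℂ) ^ N * divFun N j y = 1 := by
  have h := (sum_pow_two_mul_pos N hy).ne'
  have : ∑ j, y j ^ N * (y j ^ N / ∑ k, y k ^ (2 * N)) = 1 := by
    simp_rw [← mul_div_assoc, ← pow_add, ← two_mul]
    rw [← Finset.sum_div, div_self h]
  simp only [divFun]
  exact_mod_cast this

lemma exists_norm_iteratedFDeriv_divFun_le (n N m : ℕ) :
    ∃ C, 0 ≤ C ∧ ∀ j : Fin n, ∀ k ≤ m, ∀ y ≠ 0,
      ‖iteratedFDeriv ℝ k (divFun N j) y‖ ≤ C * ‖y‖⁻¹ ^ (N + k) := by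
  have h := fun (j : Fin n) (k : ℕ) => exists_norm_iteratedFDeriv_le_of_homogeneous N
    (contDiffOn_divFun N j) (fun t ht y => ?_) k
  · choose C hC0 hC using h
    refine ⟨∑ j, ∑ k ∈ Finset.range (m + 1), C j k,
      Finset.sum_nonneg fun _ _ => Finset.sum_nonneg fun _ _ => hC0 _ _, fun j k hk y hy => ?_⟩
    refine (hC j k y hy).trans (mul_le_mul_of_nonneg_right ?_ (by positivity))
    exact (Finset.single_le_sum (f := fun k => C j k) (fun _ _ => hC0 _ _)
      (Finset.mem_range.2 (Nat.lt_succ_of_le hk))).trans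
      (Finset.single_le_sum (f := fun j => ∑ k ∈ Finset.range (m + 1), C j k)
        (fun _ _ => Finset.sum_nonneg fun _ _ => hC0 _ _) (Finset.mem_univ j))
  · simp only [divFun, Pi.smul_apply, smul_eq_mul, mul_pow]
    rw [← Finset.mul_sum]
    norm_cast
    have : t ^ N ≠ 0 := by positivity
    by_cases hs : ∑ k, y k ^ (2 * N) = 0
    · simp [hs]
    · field_simp
      ring

lemma contDiff_decayFun {n : ℕ} : ContDiff ℝ (⊤ : ℕ∞) (decayFun : Vec n → ℂ) := by
  refine Complex.ofRealCLM.contDiff.comp (ContDiff.inv ?_ ?_)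
  · exact contDiff_const.add (ContDiff.sum fun k _ => (contDiff_apply ℝ ℝ k).pow (2 * n))
  · intro y
    have : 0 ≤ ∑ k, y k ^ (2 * n) := Finset.sum_nonneg fun k _ => by rw [pow_mul]; positivity
    positivity

lemma decayFun_mul {n : ℕ} (y : Vec n) : (1 + ∑ k, (y k : ℂ) ^ (2 * n)) * decayFun y = 1 := by
  have : 0 ≤ ∑ k, y k ^ (2 * n) := Finset.sum_nonneg fun k _ => by rw [pow_mul]; positivity
  have h : (1 + ∑ k, y k ^ (2 * n)) * (1 + ∑ k, y k ^ (2 * n))⁻¹ = 1 :=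
    mul_inv_cancel₀ (by positivity)
  simp only [decayFun]
  exact_mod_cast h

lemma exists_norm_iteratedFDeriv_decayFun_le (n m : ℕ) [NeZero n] :
    ∃ C, 0 ≤ C ∧ ∀ k ≤ m, ∀ y : Vec n,
      ‖iteratedFDeriv ℝ k (decayFun : Vec n → ℂ) y‖ ≤ C * weight y := by
  set R : ℝ × Vec n → ℂ := fun w => (((w.1 ^ (2 * n) + ∑ k, w.2 k ^ (2 * n))⁻¹ : ℝ) : ℂ) with hR
  have hpos : ∀ w : ℝ × Vec n, w ≠ 0 → 0 < w.1 ^ (2 * n) + ∑ k, w.2 k ^ (2 * n) := by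
    rintro ⟨t, y⟩ hw
    by_cases hy : y = 0
    · have ht : t ≠ 0 := by rintro rfl; exact hw (by simp [hy])
      have h1 : 0 ≤ ∑ k, y k ^ (2 * n) := Finset.sum_nonneg fun k _ => by rw [pow_mul]; positivity
      have h2 : 0 < t ^ (2 * n) := by rw [pow_mul]; positivity
      exact add_pos_of_pos_of_nonneg h2 h1
    · have h2 : 0 ≤ t ^ (2 * n) := by rw [pow_mul]; positivity
      exact add_pos_of_nonneg_of_pos h2 (sum_pow_two_mul_pos n hy)
  have hRc : ContDiffOn ℝ (⊤ : ℕ∞) R {0}ᶜ := by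
    refine Complex.ofRealCLM.contDiff.comp_contDiffOn (ContDiffOn.inv ?_ ?_)
    · refine ContDiff.contDiffOn (ContDiff.add (contDiff_fst.pow _) ?_)
      exact ContDiff.sum fun k _ => ((contDiff_apply ℝ ℝ k).comp contDiff_snd).pow (2 * n)
    · exact fun w hw => (hpos w hw).ne'
  have h := fun (k : ℕ) => exists_norm_iteratedFDeriv_le_of_homogeneous (2 * n) hRc
    (fun t ht w => ?_) k
  · choose C hC0 hC using h
    refine ⟨2 ^ (2 * n) * ∑ k ∈ Finset.range (m + 1), C k,
      mul_nonneg (by positivity) (Finset.sum_nonneg fun _ _ => hC0 _), fun k hk y => ?_⟩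
    have hne : ((1 : ℝ), y) ≠ 0 := fun h => one_ne_zero (congrArg Prod.fst h)
    have hshift : (fun w : ℝ × Vec n => R ((1, 0) + w)) ∘ ContinuousLinearMap.inr ℝ ℝ (Vec n)
        = decayFun := by
      funext y; simp [hR, decayFun]
    have h1 := norm_iteratedFDeriv_comp_clm_le (f := fun w : ℝ × Vec n => R ((1, 0) + w))
      (s := (fun w => (1, 0) + w) ⁻¹' {0}ᶜ)
      (isOpen_compl_singleton.preimage (continuous_const.add continuous_id))
      (hRc.comp (contDiff_const.add contDiff_id).contDiffOn fun w hw => hw)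
      (ContinuousLinearMap.inr ℝ ℝ (Vec n)) (x := y) (by simp) k
    rw [iteratedFDeriv_comp_add_left] at h1
    change ‖iteratedFDeriv ℝ k ((fun w : ℝ × Vec n => R ((1, 0) + w)) ∘
      ContinuousLinearMap.inr ℝ ℝ (Vec n)) y‖ ≤ _ at h1
    rw [hshift] at h1
    have h2 : ((1, 0) : ℝ × Vec n) + ContinuousLinearMap.inr ℝ ℝ (Vec n) y = (1, y) := by simp
    rw [h2] at h1
    have h3 : ‖ContinuousLinearMap.inr ℝ ℝ (Vec n)‖ ^ k ≤ 1 :=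
      pow_le_one₀ (norm_nonneg _) (ContinuousLinearMap.norm_inr_le_one ℝ ℝ (Vec n))
    have h4 : ‖((1 : ℝ), y)‖⁻¹ ^ (2 * n + k) ≤ 2 ^ (2 * n) * weight y := by
      have h5 : ‖((1 : ℝ), y)‖ = max 1 ‖y‖ := by simp [Prod.norm_def]
      have h6 : 1 + ‖y‖ ≤ 2 * max 1 ‖y‖ := by
        have := le_max_left 1 ‖y‖; have := le_max_right 1 ‖y‖; linarith
      have h7 : 1 ≤ max 1 ‖y‖ := le_max_left _ _
      rw [h5, weight]
      calc (max 1 ‖y‖)⁻¹ ^ (2 * n + k) ≤ (max 1 ‖y‖)⁻¹ ^ (2 * n) :=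
            pow_le_pow_of_le_one (by positivity) (inv_le_one_of_one_le₀ h7) (by omega)
        _ = 2 ^ (2 * n) * ((2 * max 1 ‖y‖) ^ (2 * n))⁻¹ := by
            rw [mul_pow, inv_pow]; field_simp
        _ ≤ _ := by gcongr
    calc _ ≤ _ := h1
      _ ≤ 1 * (C k * ‖((1 : ℝ), y)‖⁻¹ ^ (2 * n + k)) :=
          mul_le_mul h3 (hC k _ hne) (norm_nonneg _) zero_le_one
      _ ≤ 1 * ((∑ k ∈ Finset.range (m + 1), C k) * (2 ^ (2 * n) * weight y)) := by
          have := Finset.single_le_sum (f := C) (fun _ _ => hC0 _)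
            (Finset.mem_range.2 (Nat.lt_succ_of_le hk))
          gcongr
          exact (hC0 k).trans this
      _ = _ := by ring
  · simp only [hR, Prod.smul_fst, Prod.smul_snd, Pi.smul_apply, smul_eq_mul, mul_pow]
    rw [← Finset.mul_sum, ← mul_add, mul_inv]
    norm_cast
    rw [← mul_assoc, mul_inv_cancel₀ (by positivity), one_mul]

/-- The difference of the first and last components. -/
noncomputable def diffCLM (n : ℕ) : (Vec n × Vec n × Vec n) →L[ℝ] Vec n :=
  ContinuousLinearMap.fst ℝ _ _ -
    (ContinuousLinearMap.snd ℝ _ _).comp (ContinuousLinearMap.snd ℝ (Vec n) (Vec n × Vec n))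

lemma norm_diffCLM_le (n : ℕ) : ‖diffCLM n‖ ≤ 2 := by
  refine (norm_sub_le _ _).trans ?_
  have h1 := ContinuousLinearMap.norm_fst_le ℝ (Vec n) (Vec n × Vec n)
  have h2 : ‖(ContinuousLinearMap.snd ℝ (Vec n) (Vec n)).comp
      (ContinuousLinearMap.snd ℝ (Vec n) (Vec n × Vec n))‖ ≤ 1 * 1 :=
    (ContinuousLinearMap.opNorm_comp_le _ _).trans (mul_le_mul
      (ContinuousLinearMap.norm_snd_le _ _ _) (ContinuousLinearMap.norm_snd_le _ _ _)
      (norm_nonneg _) zero_le_one)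
  linarith

/-- The amplitude obtained from `α` after inserting cut-offs with disjoint supports. -/
noncomputable def cutAmp {n : ℕ} (N : ℕ) (j : Fin n) (χ₁ χ₂ : Vec n → ℂ)
    (α : Vec n × Vec n × Vec n → ℂ) (z : Vec n × Vec n × Vec n) : ℂ :=
  χ₁ z.1 * divFun N j (z.1 - z.2.2) * χ₂ z.2.2 * decayFun (z.1 - z.2.2) * α z

lemma exists_cutAmp_bound (n N : ℕ) [NeZero n] : ∃ C, 0 ≤ C ∧
    ∀ (j : Fin n) (χ₁ χ₂ : Vec n → ℂ) (α : Vec n × Vec n × Vec n → ℂ) (K₁ K₂ K d : ℝ),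
      ContDiff ℝ (⊤ : ℕ∞) χ₁ → ContDiff ℝ (⊤ : ℕ∞) χ₂ → ContDiff ℝ (⊤ : ℕ∞) α → 0 < d →
      (∀ q ∈ tsupport χ₁, ∀ q' ∈ tsupport χ₂, d ≤ ‖q - q'‖) →
      (∀ k ≤ 4 * n, ∀ q, ‖iteratedFDeriv ℝ k χ₁ q‖ ≤ K₁) →
      (∀ k ≤ 2 * n, ∀ q, ‖iteratedFDeriv ℝ k χ₂ q‖ ≤ K₂) →
      (∀ k ≤ 2 * n, ∀ z, ‖iteratedFDeriv ℝ k α z‖ ≤ K) →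
      ContDiff ℝ (⊤ : ℕ∞) (cutAmp N j χ₁ χ₂ α) ∧
      ∀ k ≤ 2 * n, ∀ z, ‖iteratedFDeriv ℝ k (cutAmp N j χ₁ χ₂ α) z‖
        ≤ C * d⁻¹ ^ N * K₁ * K₂ * K * weight (z.1 - z.2.2) := by
  obtain ⟨C₁, hC₁0, hC₁⟩ := exists_norm_iteratedFDeriv_divFun_le n N (2 * n)
  obtain ⟨C₂, hC₂0, hC₂⟩ := exists_norm_iteratedFDeriv_decayFun_le n (2 * n)
  refine ⟨16 ^ (2 * n) * (2 ^ (2 * n) * C₁) * (2 ^ (2 * n) * C₂), by positivity, ?_⟩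
  intro j χ₁ χ₂ α K₁ K₂ K d hχ₁ hχ₂ hα hd hsep hK₁ hK₂ hK
  set b := cutAmp N j χ₁ χ₂ α with hb
  have hK₁0 : 0 ≤ K₁ := (norm_nonneg _).trans (hK₁ 0 (Nat.zero_le _) 0)
  have hK₂0 : 0 ≤ K₂ := (norm_nonneg _).trans (hK₂ 0 (Nat.zero_le _) 0)
  have hK0 : 0 ≤ K := (norm_nonneg _).trans (hK 0 (Nat.zero_le _) 0)
  have hU : IsOpen ((diffCLM n) ⁻¹' {0}ᶜ) :=
    isOpen_compl_singleton.preimage (diffCLM n).continuous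
  have s1 : ContDiff ℝ (⊤ : ℕ∞) (fun z : Vec n × Vec n × Vec n => χ₁ z.1) :=
    hχ₁.comp contDiff_fst
  have s2 : ContDiff ℝ (⊤ : ℕ∞) (fun z : Vec n × Vec n × Vec n => χ₂ z.2.2) :=
    hχ₂.comp (contDiff_snd.comp contDiff_snd)
  have s3 : ContDiffOn ℝ (⊤ : ℕ∞)
      (fun z : Vec n × Vec n × Vec n => divFun N j (z.1 - z.2.2)) ((diffCLM n) ⁻¹' {0}ᶜ) :=
    (contDiffOn_divFun N j).comp (diffCLM n).contDiff.contDiffOn fun z hz => hz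
  have s4 : ContDiff ℝ (⊤ : ℕ∞)
      (fun z : Vec n × Vec n × Vec n => decayFun (z.1 - z.2.2)) :=
    contDiff_decayFun.comp (diffCLM n).contDiff
  have s13 := s1.contDiffOn.mul s3
  have s132 := s13.mul s2.contDiffOn
  have s1324 := s132.mul s4.contDiffOn
  have sb : ContDiffOn ℝ (⊤ : ℕ∞) b ((diffCLM n) ⁻¹' {0}ᶜ) := s1324.mul hα.contDiffOn
  have dich : ∀ z : Vec n × Vec n × Vec n, b =ᶠ[nhds z] (fun _ => 0) ∨
      (z ∈ (diffCLM n) ⁻¹' {0}ᶜ ∧ z.2.2 ∉ tsupport χ₁ ∧ d ≤ ‖z.1 - z.2.2‖) := by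
    intro z
    by_cases h1 : z.1 ∈ tsupport χ₁
    · by_cases h2 : z.2.2 ∈ tsupport χ₂
      · right
        have h3 := hsep _ h1 _ h2
        refine ⟨?_, fun h4 => ?_, h3⟩
        · change z.1 - z.2.2 ≠ 0
          exact norm_pos_iff.1 (hd.trans_le h3)
        · have := hsep _ h4 _ h2
          rw [sub_self, norm_zero] at this
          exact absurd this (not_le.2 hd)
      · left
        have := (continuous_snd.comp continuous_snd).continuousAt (x := z) |>.eventually
          (notMem_tsupport_iff_eventuallyEq.1 h2)
        filter_upwards [this] with w hw
        have hw' : χ₂ w.2.2 = 0 := hw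
        simp [hb, cutAmp, hw']
    · left
      have := continuous_fst.continuousAt (x := z) |>.eventually
        (notMem_tsupport_iff_eventuallyEq.1 h1)
      filter_upwards [this] with w hw
      have hw' : χ₁ w.1 = 0 := hw
      simp [hb, cutAmp, hw']
  refine ⟨contDiff_iff_contDiffAt.2 fun z => ?_, fun k hk z => ?_⟩
  · rcases dich z with h | ⟨hz, -, -⟩
    · exact contDiffAt_const.congr_of_eventuallyEq h
    · exact sb.contDiffAt (hU.mem_nhds hz)
  · rcases dich z with h | ⟨hz, hq', hdz⟩
    · rw [(h.iteratedFDeriv ℝ k).eq_of_nhds, iteratedFDeriv_fun_zero]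
      have := (weight_pos (z.1 - z.2.2)).le
      simp only [Pi.zero_apply, norm_zero]
      positivity
    set y := z.1 - z.2.2 with hy
    have hy0 : y ≠ 0 := hz
    have hyn : 0 < ‖y‖ := norm_pos_iff.2 hy0
    have hpow2 : ∀ i ≤ 2 * n, ‖diffCLM n‖ ^ i ≤ 2 ^ (2 * n) := fun i hi =>
      (pow_le_pow_left₀ (norm_nonneg _) (norm_diffCLM_le n) i).trans
        (pow_le_pow_right₀ one_le_two hi)
    have b1 : ∀ i l, i + l ≤ 4 * n →
        ‖iteratedFDeriv ℝ i (fun z : Vec n × Vec n × Vec n => χ₁ z.1) z‖ ≤ K₁ * ‖y‖ ^ l := by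
      intro i l hil
      refine (norm_iteratedFDeriv_comp_clm_le isOpen_univ hχ₁.contDiffOn
        (ContinuousLinearMap.fst ℝ (Vec n) (Vec n × Vec n)) (Set.mem_univ _) i).trans ?_
      refine (mul_le_of_le_one_left (norm_nonneg _) (pow_le_one₀ (norm_nonneg _)
        (ContinuousLinearMap.norm_fst_le _ _ _))).trans ?_
      exact norm_iteratedFDeriv_le_of_notMem_tsupport hχ₁ hK₁ hq' l i hil z.1
    have b2 : ∀ i ≤ 2 * n,
        ‖iteratedFDeriv ℝ i (fun z : Vec n × Vec n × Vec n => χ₂ z.2.2) z‖ ≤ K₂ := by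
      intro i hi
      refine (norm_iteratedFDeriv_comp_clm_le isOpen_univ hχ₂.contDiffOn
        ((ContinuousLinearMap.snd ℝ (Vec n) (Vec n)).comp
          (ContinuousLinearMap.snd ℝ (Vec n) (Vec n × Vec n))) (Set.mem_univ _) i).trans ?_
      refine (mul_le_of_le_one_left (norm_nonneg _) (pow_le_one₀ (norm_nonneg _) ?_)).trans
        (hK₂ i hi _)
      exact (ContinuousLinearMap.opNorm_comp_le _ _).trans (mul_le_one₀
        (ContinuousLinearMap.norm_snd_le _ _ _) (norm_nonneg _)
        (ContinuousLinearMap.norm_snd_le _ _ _))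
    have b3 : ∀ i ≤ 2 * n,
        ‖iteratedFDeriv ℝ i (fun z : Vec n × Vec n × Vec n => divFun N j (z.1 - z.2.2)) z‖
          ≤ 2 ^ (2 * n) * C₁ * ‖y‖⁻¹ ^ (N + i) := by
      intro i hi
      refine (norm_iteratedFDeriv_comp_clm_le isOpen_compl_singleton (contDiffOn_divFun N j)
        (diffCLM n) hz i).trans ?_
      rw [mul_assoc]
      exact mul_le_mul (hpow2 i hi) (hC₁ j i hi y hy0) (norm_nonneg _) (by positivity)
    have b4 : ∀ i ≤ 2 * n,
        ‖iteratedFDeriv ℝ i (fun z : Vec n × Vec n × Vec n => decayFun (z.1 - z.2.2)) z‖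
          ≤ 2 ^ (2 * n) * C₂ * weight y := by
      intro i hi
      refine (norm_iteratedFDeriv_comp_clm_le isOpen_univ contDiff_decayFun.contDiffOn
        (diffCLM n) (Set.mem_univ _) i).trans ?_
      rw [mul_assoc]
      exact mul_le_mul (hpow2 i hi) (hC₂ i hi y) (norm_nonneg _) (by positivity)
    have b13 : ∀ i ≤ 2 * n, ∀ l ≤ 2 * n,
        ‖iteratedFDeriv ℝ i (fun z : Vec n × Vec n × Vec n => χ₁ z.1) z‖ *
        ‖iteratedFDeriv ℝ l (fun z : Vec n × Vec n × Vec n => divFun N j (z.1 - z.2.2)) z‖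
          ≤ 2 ^ (2 * n) * C₁ * K₁ * d⁻¹ ^ N := by
      intro i hi l hl
      have hdN : ‖y‖⁻¹ ^ N ≤ d⁻¹ ^ N := by gcongr
      rcases le_total 1 ‖y‖ with h1 | h1
      · calc _ ≤ (K₁ * ‖y‖ ^ 0) * (2 ^ (2 * n) * C₁ * ‖y‖⁻¹ ^ (N + l)) :=
              mul_le_mul (b1 i 0 (by omega)) (b3 l hl) (norm_nonneg _) (by positivity)
          _ ≤ (K₁ * ‖y‖ ^ 0) * (2 ^ (2 * n) * C₁ * ‖y‖⁻¹ ^ N) := by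
              have := pow_le_pow_of_le_one (inv_nonneg.2 hyn.le) (inv_le_one_of_one_le₀ h1)
                (Nat.le_add_right N l)
              gcongr
          _ = 2 ^ (2 * n) * C₁ * K₁ * ‖y‖⁻¹ ^ N := by ring
          _ ≤ _ := by gcongr
      · calc _ ≤ (K₁ * ‖y‖ ^ l) * (2 ^ (2 * n) * C₁ * ‖y‖⁻¹ ^ (N + l)) :=
              mul_le_mul (b1 i l (by omega)) (b3 l hl) (norm_nonneg _) (by positivity)
          _ = 2 ^ (2 * n) * C₁ * K₁ * ‖y‖⁻¹ ^ N := by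
              rw [pow_add, inv_pow, inv_pow]; field_simp
          _ ≤ _ := by gcongr
    have m1 := norm_iteratedFDeriv_mul_le_of_forall hU s1.contDiffOn s3 hz b13
    have m2 := norm_iteratedFDeriv_mul_le_of_forall hU s13 s2.contDiffOn hz
      (fun i hi l hl => mul_le_mul (m1 i hi) (b2 l hl) (norm_nonneg _) (by positivity))
    have hw := (weight_pos y).le
    have m3 := norm_iteratedFDeriv_mul_le_of_forall hU s132 s4.contDiffOn hz
      (fun i hi l hl => mul_le_mul (m2 i hi) (b4 l hl) (norm_nonneg _) (by positivity))
    have m4 := norm_iteratedFDeriv_mul_le_of_forall hU s1324 hα.contDiffOn hz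
      (fun i hi l hl => mul_le_mul (m3 i hi) (hK l hl z) (norm_nonneg _) (by positivity))
    refine (m4 k hk).trans (le_of_eq ?_)
    have h16 : (16 : ℝ) ^ (2 * n) = 2 ^ (2 * n) * 2 ^ (2 * n) * 2 ^ (2 * n) * 2 ^ (2 * n) := by
      rw [← mul_pow, ← mul_pow, ← mul_pow]; norm_num
    rw [h16]
    ring

end KernelBounds

section Representation

/-- The density of the standard exponential distribution. -/
noncomputable def expDens1 (t : ℝ) : ℝ := (Set.Ioi (0 : ℝ)).indicator (fun t => Real.exp (-t)) t

/-- The density of the product of `n` standard exponential distributions. -/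
noncomputable def expDens {n : ℕ} (r : Vec n) : ℝ := ∏ k, expDens1 (r k)

/-- The standard exponential distribution. -/
noncomputable def expLaw : Measure ℝ := volume.withDensity fun t => ENNReal.ofReal (expDens1 t)

lemma expDens1_nonneg (t : ℝ) : 0 ≤ expDens1 t :=
  Set.indicator_nonneg (fun _ _ => (Real.exp_pos _).le) t

lemma expDens1_le_one (t : ℝ) : expDens1 t ≤ 1 := by
  unfold expDens1
  refine Set.indicator_le' (g := fun _ => (1 : ℝ)) (fun x hx => ?_) (fun _ _ => zero_le_one) t
  exact Real.exp_le_one_iff.2 (by simpa using (Set.mem_Ioi.1 hx).le)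

lemma measurable_expDens1 : Measurable expDens1 :=
  (Real.measurable_exp.comp measurable_neg).indicator measurableSet_Ioi

lemma integrable_expDens1 : Integrable expDens1 := by
  unfold expDens1
  exact (integrable_indicator_iff measurableSet_Ioi).2 (integrableOn_exp_neg_Ioi 0)

lemma integral_expDens1 : ∫ t, expDens1 t = 1 := by
  unfold expDens1
  rw [integral_indicator measurableSet_Ioi, integral_exp_neg_Ioi_zero]

lemma expDens_nonneg {n : ℕ} (r : Vec n) : 0 ≤ expDens r :=
  Finset.prod_nonneg fun _ _ => expDens1_nonneg _

lemma expDens_le_one {n : ℕ} (r : Vec n) : expDens r ≤ 1 :=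
  Finset.prod_le_one (fun _ _ => expDens1_nonneg _) fun _ _ => expDens1_le_one _

lemma measurable_expDens {n : ℕ} : Measurable (expDens : Vec n → ℝ) :=
  Finset.measurable_prod _ fun k _ => measurable_expDens1.comp (measurable_pi_apply k)

lemma integrable_expDens {n : ℕ} : Integrable (expDens : Vec n → ℝ) :=
  Integrable.fintype_prod fun _ => integrable_expDens1

lemma integral_expDens {n : ℕ} : ∫ r : Vec n, expDens r = 1 := by
  unfold expDens
  rw [integral_fintype_prod_volume_eq_prod]
  simp [integral_expDens1]

lemma expLaw_apply {s : Set ℝ} (hs : MeasurableSet s) :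
    expLaw s = ENNReal.ofReal (∫ t, s.indicator expDens1 t) := by
  rw [expLaw, withDensity_apply _ hs, integral_indicator hs,
    ofReal_integral_eq_lintegral_ofReal integrable_expDens1.integrableOn
      (Filter.Eventually.of_forall expDens1_nonneg)]

instance : IsProbabilityMeasure expLaw :=
  ⟨by rw [expLaw_apply MeasurableSet.univ]; simp [integral_expDens1]⟩

lemma pi_expLaw {n : ℕ} : Measure.pi (fun _ : Fin n => expLaw)
    = volume.withDensity fun r : Vec n => ENNReal.ofReal (expDens r) := by
  refine Measure.pi_eq fun s hs => ?_
  have hms : MeasurableSet (Set.univ.pi s) := MeasurableSet.univ_pi hs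
  rw [withDensity_apply _ hms,
    ← ofReal_integral_eq_lintegral_ofReal integrable_expDens.integrableOn
      (Filter.Eventually.of_forall expDens_nonneg), ← integral_indicator hms]
  have h : (Set.univ.pi s).indicator (expDens : Vec n → ℝ)
      = fun r => ∏ k, (s k).indicator expDens1 (r k) := by
    funext r
    by_cases hr : r ∈ Set.univ.pi s
    · rw [Set.indicator_of_mem hr]
      exact Finset.prod_congr rfl fun k _ => (Set.indicator_of_mem (hr k (Set.mem_univ k)) _).symm
    · rw [Set.indicator_of_notMem hr]
      simp only [Set.mem_pi, Set.mem_univ, forall_true_left, not_forall] at hr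
      obtain ⟨k, hk⟩ := hr
      exact (Finset.prod_eq_zero (Finset.mem_univ k) (Set.indicator_of_notMem hk _)).symm
  rw [h, integral_fintype_prod_volume_eq_prod (fun k => (s k).indicator expDens1),
    ENNReal.ofReal_prod_of_nonneg fun k _ => integral_nonneg fun t =>
      Set.indicator_nonneg (fun _ _ => expDens1_nonneg _) t]
  exact Finset.prod_congr rfl fun k _ => (expLaw_apply (hs k)).symm

lemma measurePreserving_update {n : ℕ} (k : Fin n) :
    MeasurePreserving (fun x : Vec n × ℝ => Function.update x.1 k x.2)
      ((Measure.pi fun _ : Fin n => expLaw).prod expLaw) (Measure.pi fun _ : Fin n => expLaw) := by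
  have hmeas : Measurable (fun x : Vec n × ℝ => Function.update x.1 k x.2) := by
    refine measurable_pi_lambda _ fun i => ?_
    by_cases hi : i = k
    · subst hi; simpa using measurable_snd
    · simp only [Function.update_of_ne hi]
      exact (measurable_pi_apply i).comp measurable_fst
  refine ⟨hmeas, (Measure.pi_eq fun s hs => ?_).symm⟩
  rw [Measure.map_apply hmeas (MeasurableSet.univ_pi hs)]
  have h : (fun x : Vec n × ℝ => Function.update x.1 k x.2) ⁻¹' Set.univ.pi s
      = (Set.univ.pi (Function.update s k Set.univ)) ×ˢ s k := by
    ext ⟨r, t⟩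
    simp only [Set.mem_preimage, Set.mem_pi, Set.mem_univ, forall_true_left, Set.mem_prod]
    constructor
    · intro hr
      refine ⟨fun i => ?_, by simpa using hr k⟩
      by_cases hi : i = k
      · subst hi; simp
      · simpa [Function.update_of_ne hi] using hr i
    · rintro ⟨hr, ht⟩ i
      by_cases hi : i = k
      · subst hi; simpa using ht
      · simpa [Function.update_of_ne hi] using hr i
  rw [h, Measure.prod_prod, Measure.pi_pi,
    ← Finset.mul_prod_erase Finset.univ _ (Finset.mem_univ k),
    ← Finset.mul_prod_erase Finset.univ (fun i => expLaw (s i)) (Finset.mem_univ k)]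
  rw [Function.update_self, measure_univ, one_mul, mul_comm]
  congr 1
  exact Finset.prod_congr rfl fun i hi => by rw [Function.update_of_ne (Finset.ne_of_mem_erase hi)]

variable {E : Type*} [NormedAddCommGroup E] [NormedSpace ℝ E]

/-- The composition of the operators `1 + ∂_v` for `v` in a list. -/
noncomputable def oneAddDerivs (L : List E) (f : E → ℂ) : E → ℂ :=
  L.foldr (fun v g => g + dirDeriv v g) f

lemma contDiff_oneAddDerivs {f : E → ℂ} (hf : ContDiff ℝ (⊤ : ℕ∞) f) (L : List E) :
    ContDiff ℝ (⊤ : ℕ∞) (oneAddDerivs L f) := by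
  induction L with
  | nil => exact hf
  | cons v L ih => exact ih.add (contDiff_dirDeriv ih v)

lemma norm_iteratedFDeriv_oneAddDerivs_le {f : E → ℂ} (hf : ContDiff ℝ (⊤ : ℕ∞) f) (L : List E)
    (hL : ∀ v ∈ L, ‖v‖ ≤ 1) {z : E} {m : ℕ} {K : ℝ}
    (hK : ∀ k ≤ m + L.length, ‖iteratedFDeriv ℝ k f z‖ ≤ K) :
    ∀ k ≤ m, ‖iteratedFDeriv ℝ k (oneAddDerivs L f) z‖ ≤ 2 ^ L.length * K := by
  induction L generalizing m with
  | nil => simpa [oneAddDerivs] using hK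
  | cons v L ih =>
    intro k hk
    have hc := contDiff_oneAddDerivs hf L
    have h1 : ∀ k ≤ m + 1, ‖iteratedFDeriv ℝ k (oneAddDerivs L f) z‖ ≤ 2 ^ L.length * K :=
      ih (fun v hv => hL v (List.mem_cons_of_mem _ hv)) fun k hk =>
        hK k (by rw [List.length_cons]; omega)
    have h2 := norm_iteratedFDeriv_dirDeriv_le hc v z k
    change ‖iteratedFDeriv ℝ k (oneAddDerivs L f + dirDeriv v (oneAddDerivs L f)) z‖ ≤ _
    rw [iteratedFDeriv_add_apply (hc.of_le (by exact_mod_cast le_top)).contDiffAt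
      ((contDiff_dirDeriv hc v).of_le (by exact_mod_cast le_top)).contDiffAt]
    have h3 : ‖v‖ ≤ 1 := hL v List.mem_cons_self
    calc _ ≤ _ := norm_add_le _ _
      _ ≤ 2 ^ L.length * K + 1 * (2 ^ L.length * K) := by
          refine add_le_add (h1 k (by omega)) (h2.trans ?_)
          exact mul_le_mul h3 (h1 (k + 1) (by omega)) (norm_nonneg _) zero_le_one
      _ = _ := by rw [List.length_cons, pow_succ]; ring

lemma integral_expLaw (f : ℝ → ℂ) :
    ∫ t, f t ∂expLaw = ∫ t in Set.Ioi (0 : ℝ), (Real.exp (-t) : ℂ) * f t := by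
  have hm : Measurable fun t => ENNReal.ofReal (expDens1 t) := measurable_expDens1.ennreal_ofReal
  rw [expLaw, integral_withDensity_eq_integral_toReal_smul hm
    (Filter.Eventually.of_forall fun _ => ENNReal.ofReal_lt_top), ← integral_indicator measurableSet_Ioi]
  refine integral_congr_ae (Filter.Eventually.of_forall fun t => ?_)
  simp only [ENNReal.toReal_ofReal (expDens1_nonneg t)]
  unfold expDens1
  by_cases ht : t ∈ Set.Ioi (0 : ℝ)
  · simp only [Set.indicator_of_mem ht, Complex.real_smul]
  · simp only [Set.indicator_of_notMem ht, zero_smul]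

lemma eq_integral_expLaw {f : E → ℂ} (hf : ContDiff ℝ (⊤ : ℕ∞) f) {C C₁ : ℝ} (hC : ∀ z, ‖f z‖ ≤ C)
    (hC₁ : ∀ z, ‖iteratedFDeriv ℝ 1 f z‖ ≤ C₁) (v z : E) :
    f z = ∫ t, oneAddDerivs [v] f (z - t • v) ∂expLaw := by
  have hder : ∀ t ∈ Set.Ioi (0 : ℝ), HasDerivAt (fun t : ℝ => -((Real.exp (-t) : ℂ) * f (z - t • v)))
      ((Real.exp (-t) : ℂ) * oneAddDerivs [v] f (z - t • v)) t := by
    intro t _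
    have h1 : HasDerivAt (fun t : ℝ => (Real.exp (-t) : ℂ)) (-(Real.exp (-t)) : ℝ) t := by
      have := ((Real.hasDerivAt_exp (-t)).comp t (hasDerivAt_neg t)).ofReal_comp
      simpa using this
    have h2 : HasDerivAt (fun t : ℝ => z - t • v) (-v) t := by
      simpa using ((hasDerivAt_id t).smul_const v).const_sub z
    have h3 : HasDerivAt (fun t : ℝ => f (z - t • v)) (fderiv ℝ f (z - t • v) (-v)) t :=
      ((hf.differentiable (by simp)) (z - t • v)).hasFDerivAt.comp_hasDerivAt t h2
    have h4 : oneAddDerivs [v] f (z - t • v) = f (z - t • v) + fderiv ℝ f (z - t • v) v := rfl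
    have h5 := (h1.mul h3).neg
    rw [map_neg] at h5
    refine h5.congr_deriv ?_
    rw [h4]
    push_cast
    ring
  have hexp : IntegrableOn (fun t => Real.exp (-t)) (Set.Ioi 0) := integrableOn_exp_neg_Ioi 0
  have hInt : IntegrableOn (fun t : ℝ => (Real.exp (-t) : ℂ) * oneAddDerivs [v] f (z - t • v))
      (Set.Ioi 0) := by
    refine Integrable.mono' (hexp.mul_const (C + ‖v‖ * C₁)) ?_ (Filter.Eventually.of_forall fun t => ?_)
    · refine Continuous.aestronglyMeasurable ?_
      have := (contDiff_oneAddDerivs hf [v]).continuous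
      fun_prop
    · rw [norm_mul, Complex.norm_real, Real.norm_of_nonneg (Real.exp_pos _).le]
      refine mul_le_mul_of_nonneg_left ((norm_add_le _ _).trans (add_le_add (hC _) ?_))
        (Real.exp_pos _).le
      have := norm_iteratedFDeriv_dirDeriv_le hf v (z - t • v) 0
      rw [norm_iteratedFDeriv_zero] at this
      exact this.trans (mul_le_mul_of_nonneg_left (hC₁ _) (norm_nonneg _))
  have hlim : Filter.Tendsto (fun t : ℝ => -((Real.exp (-t) : ℂ) * f (z - t • v))) Filter.atTop
      (nhds 0) := by
    rw [tendsto_zero_iff_norm_tendsto_zero]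
    have h0 : Filter.Tendsto (fun t : ℝ => Real.exp (-t) * C) Filter.atTop (nhds 0) := by
      simpa using (Real.tendsto_exp_atBot.comp Filter.tendsto_neg_atTop_atBot).mul_const C
    refine squeeze_zero (fun _ => norm_nonneg _) (fun t => ?_) h0
    rw [norm_neg, norm_mul, Complex.norm_real, Real.norm_of_nonneg (Real.exp_pos _).le]
    exact mul_le_mul_of_nonneg_left (hC _) (Real.exp_pos _).le
  have hcont : ContinuousWithinAt (fun t : ℝ => -((Real.exp (-t) : ℂ) * f (z - t • v)))
      (Set.Ici 0) 0 := by
    have := hf.continuous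
    exact Continuous.continuousWithinAt (by fun_prop)
  have := integral_Ioi_of_hasDerivAt_of_tendsto hcont hder hInt hlim
  rw [integral_expLaw, this]
  simp

lemma eq_integral_pi_expLaw {n : ℕ} {f : E → ℂ} (hf : ContDiff ℝ (⊤ : ℕ∞) f) {K : ℝ}
    (hK : ∀ k ≤ n, ∀ z, ‖iteratedFDeriv ℝ k f z‖ ≤ K) (v : Fin n → E) (hv : ∀ i, ‖v i‖ ≤ 1) (z : E) (l : List (Fin n)) (hl : l.Nodup) :
    f z = ∫ r, oneAddDerivs (l.map v) f (z - (l.map fun k => r k • v k).sum)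
      ∂(Measure.pi fun _ : Fin n => expLaw) := by
  induction l with
  | nil => simp [oneAddDerivs]
  | cons k l ih =>
    have hk : k ∉ l := (List.nodup_cons.1 hl).1
    have hvl : ∀ l : List (Fin n), ∀ w ∈ l.map v, ‖w‖ ≤ 1 := by
      intro l w hw
      obtain ⟨i, -, rfl⟩ := List.mem_map.1 hw
      exact hv i
    have hlen : l.length + 1 ≤ n := by simpa using hl.length_le_card
    have hb : ∀ i ≤ 1, ∀ z, ‖iteratedFDeriv ℝ i (oneAddDerivs (l.map v) f) z‖
        ≤ 2 ^ (l.map v).length * K := fun i hi z =>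
      norm_iteratedFDeriv_oneAddDerivs_le hf _ (hvl l) (fun k hk => hK k
        (by rw [List.length_map] at hk; omega) z) i hi
    have hb' : ∀ z, ‖oneAddDerivs ((k :: l).map v) f z‖ ≤ 2 ^ ((k :: l).map v).length * K := by
      intro z
      rw [← norm_iteratedFDeriv_zero (𝕜 := ℝ)]
      exact norm_iteratedFDeriv_oneAddDerivs_le hf _ (hvl (k :: l)) (fun k hk => hK k
        (by rw [List.length_map, List.length_cons] at hk; omega) z) 0 le_rfl
    have hc := contDiff_oneAddDerivs hf (l.map v)
    have hc' := contDiff_oneAddDerivs hf ((k :: l).map v)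
    set Φ : Vec n → ℂ := fun r => oneAddDerivs ((k :: l).map v) f
      (z - ((k :: l).map fun k => r k • v k).sum) with hΦ
    have hsum : ∀ l : List (Fin n), Continuous fun r : Vec n => (l.map fun k => r k • v k).sum := by
      intro l
      exact continuous_list_sum _ fun i _ => by fun_prop
    have hΦc : Continuous Φ := hc'.continuous.comp (continuous_const.sub (hsum _))
    have hΦu : ∀ r t, Φ (Function.update r k t) = oneAddDerivs [v k] (oneAddDerivs (l.map v) f)
        (z - (l.map fun k => r k • v k).sum - t • v k) := by
      intro r t
      have : (l.map fun i => Function.update r k t i • v i) = l.map fun i => r i • v i := by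
        refine List.map_congr_left fun i hi => ?_
        rw [Function.update_of_ne]
        rintro rfl
        exact hk hi
      simp only [hΦ, List.map_cons, List.sum_cons, Function.update_self, this]
      rw [sub_sub, add_comm]
      rfl
    have hmp := measurePreserving_update k
    have hInt : Integrable Φ (Measure.pi fun _ : Fin n => expLaw) :=
      Integrable.of_bound hΦc.aestronglyMeasurable _ (Filter.Eventually.of_forall fun r => hb' _)
    have h1 : ∫ r, Φ r ∂(Measure.pi fun _ : Fin n => expLaw)
        = ∫ x : Vec n × ℝ, Φ (Function.update x.1 k x.2)
          ∂((Measure.pi fun _ : Fin n => expLaw).prod expLaw) := by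
      conv_lhs => rw [← hmp.map_eq]
      exact integral_map hmp.measurable.aemeasurable hΦc.aestronglyMeasurable
    have h2 : Integrable (fun x : Vec n × ℝ => Φ (Function.update x.1 k x.2))
        ((Measure.pi fun _ : Fin n => expLaw).prod expLaw) :=
      hmp.integrable_comp_of_integrable hInt
    change f z = ∫ r, Φ r ∂(Measure.pi fun _ : Fin n => expLaw)
    rw [h1, integral_prod _ h2, ih (List.nodup_cons.1 hl).2]
    refine integral_congr_ae (Filter.Eventually.of_forall fun r => ?_)
    simp only [hΦu]
    exact eq_integral_expLaw hc (fun z => by simpa using hb 0 zero_le_one z) (hb 1 le_rfl) (v k) _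

/-- The operator `∏ (1 + ∂_{v_k})` is inverted by convolution with a product of exponential
laws. -/
lemma eq_integral_expDens_mul {n : ℕ} {f : E → ℂ} (hf : ContDiff ℝ (⊤ : ℕ∞) f) {K : ℝ}
    (hK : ∀ k ≤ n, ∀ z, ‖iteratedFDeriv ℝ k f z‖ ≤ K) (v : Fin n → E) (hv : ∀ i, ‖v i‖ ≤ 1) (z : E) :
    f z = ∫ r : Vec n, (expDens r : ℂ) * oneAddDerivs (List.ofFn v) f (z - ∑ k, r k • v k) := by
  have hm : Measurable fun r : Vec n => ENNReal.ofReal (expDens r) :=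
    measurable_expDens.ennreal_ofReal
  rw [eq_integral_pi_expLaw hf hK v hv z (List.finRange n) (List.nodup_finRange n), pi_expLaw,
    integral_withDensity_eq_integral_toReal_smul hm
    (Filter.Eventually.of_forall fun _ => ENNReal.ofReal_lt_top)]
  refine integral_congr_ae (Filter.Eventually.of_forall fun r => ?_)
  simp only [ENNReal.toReal_ofReal (expDens_nonneg r), Complex.real_smul,
    ← List.ofFn_eq_map, List.sum_ofFn]

end Representation

section OscillatoryIntegrals

variable {n : ℕ}

lemma contDiff_phase : ContDiff ℝ (⊤ : ℕ∞)
    (fun x : Vec n × Vec n × Vec n => phase x.2.1 x.1 x.2.2) := by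
  have h (i : Fin n) : ContDiff ℝ (⊤ : ℕ∞) fun x : Vec n => x i := contDiff_apply ℝ ℝ i
  have hsum : ContDiff ℝ (⊤ : ℕ∞)
      (fun x : Vec n × Vec n × Vec n => ∑ i, x.2.1 i * (x.1 i - x.2.2 i)) :=
    ContDiff.sum fun i _ => ((h i).comp (contDiff_fst.comp contDiff_snd)).mul
      (((h i).comp contDiff_fst).sub ((h i).comp (contDiff_snd.comp contDiff_snd)))
  exact (contDiff_const.mul (Complex.ofRealCLM.contDiff.comp hsum)).cexp

lemma norm_phase (p q q' : Vec n) : ‖phase p q q'‖ = 1 := by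
  unfold phase
  rw [mul_comm]
  exact Complex.norm_exp_ofReal_mul_I _

lemma hasLineDerivAt_phase_right (p q q' v : Vec n) :
    HasLineDerivAt ℝ (fun q' => phase p q q')
      (-(Complex.I * ((∑ i, p i * v i : ℝ) : ℂ)) * phase p q q') q' v := by
  have h1 : HasDerivAt (fun t : ℝ => ∑ i, p i * (q i - (q' + t • v) i))
      (∑ i, p i * (-v i)) 0 := by
    refine HasDerivAt.fun_sum fun i _ => ?_
    refine HasDerivAt.const_mul _ ?_
    simpa using (((hasDerivAt_id (0 : ℝ)).mul_const (v i)).const_add (q' i)).const_sub (q i)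
  have h2 := ((h1.ofReal_comp).const_mul Complex.I).cexp
  refine h2.congr_deriv ?_
  simp only [phase, zero_smul, add_zero, mul_neg, Finset.sum_neg_distrib]
  push_cast
  ring

lemma hasDerivAt_phase_left (p q q' v : Vec n) (t : ℝ) :
    HasDerivAt (fun t : ℝ => phase (p + t • v) q q')
      (Complex.I * ((∑ i, v i * (q i - q' i) : ℝ) : ℂ) * phase (p + t • v) q q') t := by
  have h1 : HasDerivAt (fun t : ℝ => ∑ i, (p + t • v) i * (q i - q' i))
      (∑ i, v i * (q i - q' i)) t := by
    refine HasDerivAt.fun_sum fun i _ => ?_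
    refine HasDerivAt.mul_const ?_ _
    simpa using ((hasDerivAt_id t).mul_const (v i)).const_add (p i)
  have h2 := ((h1.ofReal_comp).const_mul Complex.I).cexp
  refine h2.congr_deriv ?_
  simp only [phase]
  ring

lemma hasCompactSupport_dirDerivs {E : Type*} [NormedAddCommGroup E] [NormedSpace ℝ E] {h : E → ℂ}
    (hc : HasCompactSupport h) (L : List E) : HasCompactSupport (dirDerivs L h) := by
  induction L with
  | nil => exact hc
  | cons v L ih => exact ih.fderiv_apply ℝ v

lemma dirDerivs_eq_zero_of_notMem_tsupport {E : Type*} [NormedAddCommGroup E] [NormedSpace ℝ E]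
    {h : E → ℂ} (L : List E) {x : E} (hx : x ∉ tsupport h) : dirDerivs L h x = 0 := by
  have key : tsupport (dirDerivs L h) ⊆ tsupport h := by
    induction L with
    | nil => exact subset_rfl
    | cons v L ih => exact (tsupport_fderiv_apply_subset ℝ v).trans ih
  exact image_eq_zero_of_notMem_tsupport fun h => hx (key h)

lemma integral_dirDerivs_mul_phase {h : Vec n → ℂ} (hs : ContDiff ℝ (⊤ : ℕ∞) h)
    (hc : HasCompactSupport h) (p q v : Vec n) (m : ℕ) :
    ∫ q', dirDerivs (List.replicate m v) h q' * phase p q q'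
      = (Complex.I * ((∑ i, p i * v i : ℝ) : ℂ)) ^ m * ∫ q', h q' * phase p q q' := by
  have hph : Continuous fun q' => phase p q q' :=
    contDiff_phase.continuous.comp (f := fun q' => (q, p, q')) (by fun_prop)
  induction m with
  | zero => simp [dirDerivs]
  | succ m ih =>
    set g := dirDerivs (List.replicate m v) h with hg
    have hgs : ContDiff ℝ (⊤ : ℕ∞) g := contDiff_dirDerivs hs _
    have hgc : HasCompactSupport g := hasCompactSupport_dirDerivs hc _
    have hds := (contDiff_dirDeriv hgs v).continuous
    have hdc : HasCompactSupport (dirDeriv v g) := hgc.fderiv_apply ℝ v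
    have hgcont := hgs.continuous
    have key := integral_bilinear_hasLineDerivAt_right_eq_neg_left_of_integrable (μ := volume)
      (f := g) (f' := dirDeriv v g) (g := fun q' => phase p q q')
      (g' := fun q' => -(Complex.I * ((∑ i, p i * v i : ℝ) : ℂ)) * phase p q q') (v := v)
      (B := ContinuousLinearMap.mul ℝ ℂ)
      ((hds.mul hph).integrable_of_hasCompactSupport hdc.mul_right)
      ((hgcont.mul (continuous_const.mul hph)).integrable_of_hasCompactSupport hgc.mul_right)
      ((hgcont.mul hph).integrable_of_hasCompactSupport hgc.mul_right)
      (fun x _ => ((hgs.differentiable (by simp)) x).hasFDerivAt.hasLineDerivAt v)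
      (fun x _ => hasLineDerivAt_phase_right p q x v)
    simp only [ContinuousLinearMap.mul_apply'] at key
    change ∫ q', dirDeriv v g q' * phase p q q' = _
    rw [← neg_eq_iff_eq_neg] at key
    rw [← key, pow_succ', mul_assoc, ← ih, ← integral_neg, ← integral_const_mul]
    exact integral_congr_ae (Filter.Eventually.of_forall fun q' => by simp only; ring)

/-- The inner integral of `Op`. -/
noncomputable def osc (F : Vec n × Vec n × Vec n → ℂ) (w : Vec n → ℂ) (q p : Vec n) : ℂ :=
  ∫ q', F (q, p, q') * phase p q q' * w q'

lemma continuous_osc_integrand {F : Vec n × Vec n × Vec n → ℂ} (hF : Continuous F) {w : Vec n → ℂ}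
    (hw : Continuous w) (q : Vec n) :
    Continuous fun x : Vec n × Vec n => F (q, x.1, x.2) * phase x.1 q x.2 * w x.2 := by
  have := contDiff_phase.continuous.comp (f := fun x : Vec n × Vec n => (q, x.1, x.2))
    (by fun_prop)
  exact ((hF.comp (by fun_prop)).mul this).mul (hw.comp continuous_snd)

lemma integrable_osc_integrand {F : Vec n × Vec n × Vec n → ℂ} (hF : Continuous F) {w : Vec n → ℂ}
    (hw : Continuous w) (hc : HasCompactSupport w) (q p : Vec n) :
    Integrable fun q' => F (q, p, q') * phase p q q' * w q' :=
  ((continuous_osc_integrand hF hw q).comp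
    (f := fun q' => (p, q')) (by fun_prop)).integrable_of_hasCompactSupport hc.mul_left

lemma exists_norm_osc_iter_le {F : Vec n × Vec n × Vec n → ℂ} (hF : BddDerivs F) {w : Vec n → ℂ}
    (hw : ContDiff ℝ (⊤ : ℕ∞) w) (hc : HasCompactSupport w) (q v : Vec n) (hv : ‖v‖ ≤ 1) (m : ℕ) :
    ∃ C, ∀ p, ‖((∑ i, p i * v i : ℝ) : ℂ) ^ m * osc F w q p‖ ≤ C := by
  choose CF hCF using hF.2
  have hw' : ∀ k : ℕ, ∃ C, ∀ x, ‖iteratedFDeriv ℝ k w x‖ ≤ C := fun k =>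
    (hc.iteratedFDeriv k).exists_bound_of_continuous
      (hw.continuous_iteratedFDeriv (by exact_mod_cast le_top))
  choose Cw hCw using hw'
  have hCF0 : ∀ k, 0 ≤ CF k := fun k => (norm_nonneg _).trans (hCF k 0)
  have hCw0 : ∀ k, 0 ≤ Cw k := fun k => (norm_nonneg _).trans (hCw k 0)
  set P : ℝ := (∑ k ∈ Finset.range (m + 1), CF k) * (∑ k ∈ Finset.range (m + 1), Cw k) with hP
  refine ⟨∫ x, (tsupport w).indicator (fun _ => 2 ^ m * P) x, fun p => ?_⟩
  set h : Vec n → ℂ := fun q' => F (q, p, q') * w q' with hh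
  set ι : Vec n →L[ℝ] Vec n × Vec n × Vec n :=
    (ContinuousLinearMap.inr ℝ (Vec n) (Vec n × Vec n)).comp
      (ContinuousLinearMap.inr ℝ (Vec n) (Vec n)) with hι
  have hι1 : ‖ι‖ ≤ 1 := by
    refine ContinuousLinearMap.opNorm_le_bound _ zero_le_one fun x => ?_
    simp [hι, Prod.norm_def]
  set G : Vec n × Vec n × Vec n → ℂ := fun z => F ((q, p, 0) + z) with hG
  have hGs : ContDiff ℝ (⊤ : ℕ∞) G := hF.1.comp (contDiff_const.add contDiff_id)
  have hGι : (fun q' => F (q, p, q')) = fun q' => G (ι q') := by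
    funext q'; simp [hG, hι]
  have hFs : ContDiff ℝ (⊤ : ℕ∞) fun q' => F (q, p, q') := hF.1.comp (by fun_prop)
  have hFb : ∀ k x, ‖iteratedFDeriv ℝ k (fun q' => F (q, p, q')) x‖ ≤ CF k := by
    intro k x
    rw [hGι]
    refine (norm_iteratedFDeriv_comp_clm_le isOpen_univ hGs.contDiffOn ι (Set.mem_univ _) k).trans ?_
    rw [hG, iteratedFDeriv_comp_add_left]
    exact (mul_le_of_le_one_left (norm_nonneg _) (pow_le_one₀ (norm_nonneg _) hι1)).trans (hCF k _)
  have hhs : ContDiff ℝ (⊤ : ℕ∞) h := hFs.mul hw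
  have hhc : HasCompactSupport h := hc.mul_left
  have hhb : ∀ x, ‖iteratedFDeriv ℝ m h x‖ ≤ 2 ^ m * P := fun x =>
    norm_iteratedFDeriv_mul_le_of_forall isOpen_univ hFs.contDiffOn hw.contDiffOn (Set.mem_univ x)
      (k := m) (P := P) (fun i hi j hj => mul_le_mul
        ((hFb i x).trans (Finset.single_le_sum (fun i _ => hCF0 i)
          (Finset.mem_range.2 (Nat.lt_succ_of_le hi))))
        ((hCw j x).trans (Finset.single_le_sum (fun i _ => hCw0 i)
          (Finset.mem_range.2 (Nat.lt_succ_of_le hj)))) (norm_nonneg _)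
        (Finset.sum_nonneg fun i _ => hCF0 i)) m le_rfl
  have hosc : osc F w q p = ∫ q', h q' * phase p q q' :=
    integral_congr_ae (Filter.Eventually.of_forall fun q' => by simp only [hh]; ring)
  have h1 := integral_dirDerivs_mul_phase hhs hhc p q v m
  have h2 : ‖((∑ i, p i * v i : ℝ) : ℂ) ^ m * osc F w q p‖
      = ‖∫ q', dirDerivs (List.replicate m v) h q' * phase p q q'‖ := by
    rw [h1, hosc, mul_pow, norm_mul, norm_mul, norm_mul, norm_pow Complex.I, Complex.norm_I, one_pow,
      one_mul]
  rw [h2]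
  refine norm_integral_le_of_norm_le ?_ (Filter.Eventually.of_forall fun q' => ?_)
  · exact (integrable_indicator_iff (isClosed_tsupport w).measurableSet).2
      (integrableOn_const (IsCompact.measure_lt_top hc).ne)
  · rw [norm_mul, norm_phase, mul_one]
    by_cases hq : q' ∈ tsupport w
    · rw [Set.indicator_of_mem hq]
      have h3 := norm_iteratedFDeriv_dirDerivs_le hhs (List.replicate m v)
        (fun u hu => (List.eq_of_mem_replicate hu) ▸ hv) q' 0
      rw [norm_iteratedFDeriv_zero, List.length_replicate, zero_add] at h3
      exact h3.trans (hhb q')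
    · rw [Set.indicator_of_notMem hq, dirDerivs_eq_zero_of_notMem_tsupport, norm_zero]
      exact fun hq' => hq (tsupport_mul_subset_right hq')

lemma integrable_osc [NeZero n] {F : Vec n × Vec n × Vec n → ℂ} (hF : BddDerivs F) {w : Vec n → ℂ}
    (hw : ContDiff ℝ (⊤ : ℕ∞) w) (hc : HasCompactSupport w) (q : Vec n) :
    Integrable (osc F w q) := by
  have hmeas : AEStronglyMeasurable (osc F w q) volume :=
    ((continuous_osc_integrand hF.1.continuous hw.continuous q).stronglyMeasurable.integral_prod_right
      (ν := volume)).aestronglyMeasurable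
  obtain ⟨C₀, hC₀⟩ := exists_norm_osc_iter_le hF hw hc q 0 (by simp) 0
  have hk : ∀ k : Fin n, ∃ C, ∀ p : Vec n, ‖(p k : ℂ) ^ (2 * n) * osc F w q p‖ ≤ C := by
    intro k
    obtain ⟨C, hC⟩ := exists_norm_osc_iter_le hF hw hc q (Pi.single k 1)
      (by rw [Pi.norm_single]; simp) (2 * n)
    refine ⟨C, fun p => ?_⟩
    simpa [Pi.single_apply] using hC p
  choose C hC using hk
  obtain ⟨D, -, hD⟩ := exists_norm_iteratedFDeriv_decayFun_le n 0
  refine Integrable.mono' (((integrable_weight n).const_mul D).mul_const (C₀ + ∑ k, C k)) hmeas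
    (Filter.Eventually.of_forall fun p => ?_)
  have h1 : osc F w q p = decayFun p * (osc F w q p + ∑ k, (p k : ℂ) ^ (2 * n) * osc F w q p) := by
    rw [← Finset.sum_mul, ← one_add_mul, ← mul_assoc, mul_comm (decayFun p), decayFun_mul, one_mul]
  rw [h1, norm_mul]
  have h2 := hD 0 le_rfl p
  rw [norm_iteratedFDeriv_zero] at h2
  refine mul_le_mul h2 ((norm_add_le _ _).trans (add_le_add ?_ ?_)) (norm_nonneg _)
    ((norm_nonneg _).trans h2)
  · simpa using hC₀ p
  · exact (norm_sum_le _ _).trans (Finset.sum_le_sum fun k _ => hC k p)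

end OscillatoryIntegrals

section PhaseIdentity

variable {n : ℕ}

/-- The `j`-th direction of the momentum variable. -/
def momentumDir (j : Fin n) : Vec n × Vec n × Vec n := (0, Pi.single j 1, 0)

lemma norm_momentumDir_le (j : Fin n) : ‖momentumDir j‖ ≤ 1 := by
  simp [momentumDir, Prod.norm_def, Pi.norm_single]

lemma BddDerivs.dirDerivs {F : Vec n × Vec n × Vec n → ℂ} (hF : BddDerivs F)
    (L : List (Vec n × Vec n × Vec n)) (hL : ∀ v ∈ L, ‖v‖ ≤ 1) : BddDerivs (dirDerivs L F) := by
  refine ⟨contDiff_dirDerivs hF.1 L, fun k => ?_⟩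
  obtain ⟨C, hC⟩ := hF.2 (k + L.length)
  exact ⟨C, fun z => (norm_iteratedFDeriv_dirDerivs_le hF.1 L hL z k).trans (hC z)⟩

lemma BddDerivs.momentumDerivs {F : Vec n × Vec n × Vec n → ℂ} (hF : BddDerivs F)
    (j : Fin n) (m : ℕ) : BddDerivs (_root_.dirDerivs (List.replicate m (momentumDir j)) F) :=
  hF.dirDerivs _ fun _ hv => List.eq_of_mem_replicate hv ▸ norm_momentumDir_le j

lemma contDiff_coord_sub (q : Vec n) (j : Fin n) :
    ContDiff ℝ (⊤ : ℕ∞) fun q' : Vec n => (((q - q') j : ℝ) : ℂ) :=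
  Complex.ofRealCLM.contDiff.comp
    ((contDiff_apply ℝ ℝ j).comp (contDiff_const.sub contDiff_id))

lemma hasLineDerivAt_osc {F : Vec n × Vec n × Vec n → ℂ} (hF : BddDerivs F) {w : Vec n → ℂ}
    (hw : Continuous w) (hc : HasCompactSupport w) (q p : Vec n) (j : Fin n) :
    HasLineDerivAt ℝ (osc F w q)
      (osc (dirDeriv (momentumDir j) F) w q p
        + Complex.I * osc F (fun q' => (((q - q') j : ℝ) : ℂ) * w q') q p) p (Pi.single j 1) := by
  obtain ⟨C₀, hC₀⟩ := hF.2 0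
  have hF' : BddDerivs (dirDeriv (momentumDir j) F) := hF.momentumDerivs j 1
  obtain ⟨C₁, hC₁⟩ := hF'.2 0
  simp only [norm_iteratedFDeriv_zero] at hC₀ hC₁
  set v : Vec n := Pi.single j 1 with hv
  have hy : Continuous fun q' : Vec n => (((q - q') j : ℝ) : ℂ) := (contDiff_coord_sub q j).continuous
  have hyc : HasCompactSupport fun q' : Vec n => (((q - q') j : ℝ) : ℂ) * w q' := hc.mul_left
  have hyw : Continuous fun q' : Vec n => (((q - q') j : ℝ) : ℂ) * w q' := hy.mul hw
  have hvsum : ∀ q' : Vec n, ∑ i, v i * (q i - q' i) = (q - q') j := by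
    intro q'
    simp [hv, Pi.single_apply]
  have key := hasDerivAt_integral_of_dominated_loc_of_deriv_le (𝕜 := ℝ) (μ := volume)
    (F := fun t q' => F (q, p + t • v, q') * phase (p + t • v) q q' * w q')
    (F' := fun t q' => dirDeriv (momentumDir j) F (q, p + t • v, q') * phase (p + t • v) q q' * w q'
      + Complex.I * (F (q, p + t • v, q') * phase (p + t • v) q q' * ((((q - q') j : ℝ) : ℂ) * w q')))
    (x₀ := 0) (s := Set.univ)
    (bound := fun q' => C₁ * ‖w q'‖ + C₀ * ‖(((q - q') j : ℝ) : ℂ) * w q'‖) Filter.univ_mem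
    (Filter.Eventually.of_forall fun t =>
      (integrable_osc_integrand hF.1.continuous hw hc q _).aestronglyMeasurable)
    (integrable_osc_integrand hF.1.continuous hw hc q _)
    (((integrable_osc_integrand hF'.1.continuous hw hc q _).add
      ((integrable_osc_integrand hF.1.continuous hyw hyc q _).const_mul
        Complex.I)).aestronglyMeasurable)
    (Filter.Eventually.of_forall fun q' t _ => ?_) ?_
    (Filter.Eventually.of_forall fun q' t _ => ?_)
  · have h2 := key.2
    simp only [zero_smul, add_zero] at h2
    rw [integral_add (integrable_osc_integrand hF'.1.continuous hw hc q _)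
      ((integrable_osc_integrand hF.1.continuous hyw hyc q _).const_mul Complex.I),
      integral_const_mul] at h2
    exact h2
  · refine (norm_add_le _ _).trans (add_le_add ?_ ?_)
    · rw [norm_mul, norm_mul, norm_phase, mul_one]
      exact mul_le_mul_of_nonneg_right (hC₁ _) (norm_nonneg _)
    · rw [norm_mul, Complex.norm_I, one_mul, norm_mul, norm_mul, norm_phase, mul_one]
      exact mul_le_mul_of_nonneg_right (hC₀ _) (norm_nonneg _)
  · exact ((hw.integrable_of_hasCompactSupport hc).norm.const_mul C₁).add
      ((hyw.integrable_of_hasCompactSupport hyc).norm.const_mul C₀)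
  · have h1 : HasDerivAt (fun t : ℝ => ((q, p + t • v, q') : Vec n × Vec n × Vec n))
        (momentumDir j) t := by
      refine HasDerivAt.prodMk (hasDerivAt_const _ _) (HasDerivAt.prodMk ?_ (hasDerivAt_const _ _))
      simpa using ((hasDerivAt_id t).smul_const v).const_add p
    have h2 : HasDerivAt (fun t : ℝ => F (q, p + t • v, q'))
        (dirDeriv (momentumDir j) F (q, p + t • v, q')) t :=
      ((hF.1.differentiable (by simp)) _).hasFDerivAt.comp_hasDerivAt t h1
    refine ((h2.mul (hasDerivAt_phase_left p q q' v t)).mul_const (w q')).congr_deriv ?_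
    rw [hvsum]
    ring

lemma integral_osc_coord_mul [NeZero n] {F : Vec n × Vec n × Vec n → ℂ} (hF : BddDerivs F)
    {w : Vec n → ℂ} (hw : ContDiff ℝ (⊤ : ℕ∞) w) (hc : HasCompactSupport w) (q : Vec n) (j : Fin n) :
    ∫ p, osc F (fun q' => (((q - q') j : ℝ) : ℂ) * w q') q p
      = Complex.I * ∫ p, osc (dirDeriv (momentumDir j) F) w q p := by
  have hF' : BddDerivs (dirDeriv (momentumDir j) F) := hF.momentumDerivs j 1
  have hyc : HasCompactSupport fun q' : Vec n => (((q - q') j : ℝ) : ℂ) * w q' := hc.mul_left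
  have i1 := integrable_osc hF' hw hc q
  have i2 := integrable_osc hF ((contDiff_coord_sub q j).mul hw) hyc q
  have i3 := integrable_osc hF hw hc q
  have i4 : Integrable fun p => osc (dirDeriv (momentumDir j) F) w q p
      + Complex.I * osc F (fun q' => (((q - q') j : ℝ) : ℂ) * w q') q p :=
    i1.add (i2.const_mul Complex.I)
  have key := integral_bilinear_hasLineDerivAt_right_eq_neg_left_of_integrable (μ := volume)
    (f := fun _ : Vec n => (1 : ℂ)) (f' := fun _ => 0) (g := osc F w q)
    (g' := fun p => osc (dirDeriv (momentumDir j) F) w q p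
        + Complex.I * osc F (fun q' => (((q - q') j : ℝ) : ℂ) * w q') q p) (v := Pi.single j 1)
    (B := ContinuousLinearMap.mul ℝ ℂ) (by simp)
    (by simp only [ContinuousLinearMap.mul_apply', one_mul]; exact i4)
    (by simp only [ContinuousLinearMap.mul_apply', one_mul]; exact i3)
    (fun x _ => by simpa using (hasFDerivAt_const (𝕜 := ℝ) (1 : ℂ) x).hasLineDerivAt (Pi.single j 1))
    (fun x _ => hasLineDerivAt_osc hF hw.continuous hc q x j)
  simp only [ContinuousLinearMap.mul_apply', one_mul, zero_mul, integral_zero, neg_zero] at key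
  rw [integral_add i1 (i2.const_mul Complex.I), integral_const_mul] at key
  linear_combination (-Complex.I) * key +
    (∫ p, osc F (fun q' => (((q - q') j : ℝ) : ℂ) * w q') q p) * Complex.I_sq

lemma integral_osc_coord_pow_mul [NeZero n] {F : Vec n × Vec n × Vec n → ℂ} (hF : BddDerivs F)
    {w : Vec n → ℂ} (hw : ContDiff ℝ (⊤ : ℕ∞) w) (hc : HasCompactSupport w) (q : Vec n) (j : Fin n)
    (m : ℕ) :
    ∫ p, osc F (fun q' => (((q - q') j : ℝ) : ℂ) ^ m * w q') q p
      = Complex.I ^ m * ∫ p, osc (dirDerivs (List.replicate m (momentumDir j)) F) w q p := by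
  induction m generalizing w with
  | zero => simp [dirDerivs]
  | succ m ih =>
    have h := ih ((contDiff_coord_sub q j).mul hw) hc.mul_left
    rw [integral_osc_coord_mul (hF.momentumDerivs j m) hw hc q j, ← mul_assoc, ← pow_succ] at h
    rw [List.replicate_succ]
    refine Eq.trans ?_ h
    simp only [pow_succ, mul_assoc]

lemma osc_sum_right {F : Vec n × Vec n × Vec n → ℂ} (hF : Continuous F) {ι : Type*} (s : Finset ι)
    {w : ι → Vec n → ℂ} (hw : ∀ i, Continuous (w i)) (hc : ∀ i, HasCompactSupport (w i))
    (q p : Vec n) : osc F (fun q' => ∑ i ∈ s, w i q') q p = ∑ i ∈ s, osc F (w i) q p := by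
  unfold osc
  simp only [Finset.mul_sum]
  exact integral_finsetSum s fun i _ => integrable_osc_integrand hF (hw i) (hc i) q p

lemma osc_add_right {F : Vec n × Vec n × Vec n → ℂ} (hF : Continuous F)
    {w w' : Vec n → ℂ} (hw : Continuous w) (hc : HasCompactSupport w) (hw' : Continuous w')
    (hc' : HasCompactSupport w')
    (q p : Vec n) : osc F (fun q' => w q' + w' q') q p = osc F w q p + osc F w' q p := by
  unfold osc
  simp only [mul_add]
  exact integral_add (integrable_osc_integrand hF hw hc q p)
    (integrable_osc_integrand hF hw' hc' q p)

/-- The operator `1 + (-1)^n ∑ ∂_{p_k}^{2n}`, corresponding to multiplication by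
`1 + ∑ y_k^{2n}`. -/
noncomputable def momentumOp (G : Vec n × Vec n × Vec n → ℂ) : Vec n × Vec n × Vec n → ℂ :=
  fun z => G z + ∑ k, (-1) ^ n * dirDerivs (List.replicate (2 * n) (momentumDir k)) G z

lemma osc_momentumOp {G : Vec n × Vec n × Vec n → ℂ} (hG : BddDerivs G) {w : Vec n → ℂ}
    (hw : Continuous w) (hc : HasCompactSupport w) (q p : Vec n) :
    osc (momentumOp G) w q p = osc G w q p + ∑ k, (-1) ^ n *
      osc (dirDerivs (List.replicate (2 * n) (momentumDir k)) G) w q p := by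
  have i1 := integrable_osc_integrand hG.1.continuous hw hc q p
  have i2 := fun k => (integrable_osc_integrand (hG.momentumDerivs k (2 * n)).1.continuous hw hc
    q p).const_mul ((-1) ^ n)
  unfold osc
  simp only [← integral_const_mul]
  rw [← integral_finsetSum _ fun k _ => i2 k, ← integral_add i1 (integrable_finsetSum _ fun k _ => i2 k)]
  refine integral_congr_ae (Filter.Eventually.of_forall fun q' => ?_)
  simp only [momentumOp, add_mul, Finset.sum_mul, mul_assoc]

lemma integrable_osc_momentumOp [NeZero n] {G : Vec n × Vec n × Vec n → ℂ} (hG : BddDerivs G)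
    {w : Vec n → ℂ} (hw : ContDiff ℝ (⊤ : ℕ∞) w) (hc : HasCompactSupport w) (q : Vec n) :
    Integrable (osc (momentumOp G) w q) := by
  have h : osc (momentumOp G) w q = fun p => osc G w q p + ∑ k, (-1) ^ n *
      osc (dirDerivs (List.replicate (2 * n) (momentumDir k)) G) w q p :=
    funext fun p => osc_momentumOp hG hw.continuous hc q p
  rw [h]
  exact (integrable_osc hG hw hc q).add (integrable_finsetSum _ fun k _ =>
    (integrable_osc (hG.momentumDerivs k _) hw hc q).const_mul _)

lemma integral_osc_momentumOp [NeZero n] {F : Vec n × Vec n × Vec n → ℂ} (hF : BddDerivs F)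
    {w : Vec n → ℂ} (hw : ContDiff ℝ (⊤ : ℕ∞) w) (hc : HasCompactSupport w) (q : Vec n)
    (j : Fin n) (N : ℕ) :
    ∫ p, osc F (fun q' => (((q - q') j : ℝ) : ℂ) ^ N
        * ((1 + ∑ k, (((q - q') k : ℝ) : ℂ) ^ (2 * n)) * w q')) q p
      = Complex.I ^ N * ∫ p, osc (momentumOp (dirDerivs (List.replicate N (momentumDir j)) F)) w q p := by
  set G := dirDerivs (List.replicate N (momentumDir j)) F with hG
  have hGb : BddDerivs G := hF.momentumDerivs j N
  have hwk : ∀ k, ContDiff ℝ (⊤ : ℕ∞) fun q' : Vec n => (((q - q') k : ℝ) : ℂ) ^ (2 * n) * w q' :=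
    fun k => ((contDiff_coord_sub q k).pow _).mul hw
  have hck : ∀ k, HasCompactSupport fun q' : Vec n => (((q - q') k : ℝ) : ℂ) ^ (2 * n) * w q' :=
    fun k => hc.mul_left
  have hws : ContDiff ℝ (⊤ : ℕ∞) fun q' : Vec n =>
      (1 + ∑ k, (((q - q') k : ℝ) : ℂ) ^ (2 * n)) * w q' :=
    (contDiff_const.add (ContDiff.sum fun k _ => (contDiff_coord_sub q k).pow _)).mul hw
  rw [integral_osc_coord_pow_mul hF hws hc.mul_left q j N, ← hG]
  congr 1
  have h1 : ∀ p, osc G (fun q' => (1 + ∑ k, (((q - q') k : ℝ) : ℂ) ^ (2 * n)) * w q') q p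
      = osc G w q p + ∑ k, osc G (fun q' => (((q - q') k : ℝ) : ℂ) ^ (2 * n) * w q') q p := by
    intro p
    have hc' : HasCompactSupport fun q' : Vec n => ∑ k, (((q - q') k : ℝ) : ℂ) ^ (2 * n) * w q' := by
      simp only [← Finset.sum_mul]
      exact hc.mul_left
    rw [← osc_sum_right hGb.1.continuous _ (fun k => (hwk k).continuous) hck,
      ← osc_add_right hGb.1.continuous hw.continuous hc
        (continuous_finsetSum _ fun k _ => (hwk k).continuous) hc']
    simp only [add_mul, one_mul, Finset.sum_mul]
  simp only [h1, osc_momentumOp hGb hw.continuous hc]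
  rw [integral_add (integrable_osc hGb hw hc q)
      (integrable_finsetSum _ fun k _ => integrable_osc hGb (hwk k) (hck k) q),
    integral_add (integrable_osc hGb hw hc q)
      (integrable_finsetSum _ fun k _ =>
        (integrable_osc (hGb.momentumDerivs k _) hw hc q).const_mul _),
    integral_finsetSum _ fun k _ => integrable_osc hGb (hwk k) (hck k) q,
    integral_finsetSum _ fun k _ =>
      (integrable_osc (hGb.momentumDerivs k _) hw hc q).const_mul _]
  congr 1
  refine Finset.sum_congr rfl fun k _ => ?_
  rw [integral_osc_coord_pow_mul hGb hw hc q k, integral_const_mul, pow_mul, Complex.I_sq]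

/-- Integration by parts in the momentum variable, for cut-offs with disjoint supports. -/
lemma mul_integral_osc_eq_sum [NeZero n] {F : Vec n × Vec n × Vec n → ℂ} (hF : BddDerivs F)
    {χ₁ χ₂ u : Vec n → ℂ} (hu : ContDiff ℝ (⊤ : ℕ∞) u) (hc : HasCompactSupport u) (N : ℕ)
    (hcut : ∀ j, ContDiff ℝ (⊤ : ℕ∞) (cutAmp N j χ₁ χ₂ fun _ => 1))
    (hsep : ∀ q, χ₁ q * χ₂ q = 0) (q : Vec n) :
    (∀ j, Integrable (osc (cutAmp N j χ₁ χ₂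
      (momentumOp (dirDerivs (List.replicate N (momentumDir j)) F))) u q)) ∧
    χ₁ q * ∫ p, osc F (fun q' => χ₂ q' * u q') q p
      = Complex.I ^ N * ∑ j, ∫ p, osc (cutAmp N j χ₁ χ₂
        (momentumOp (dirDerivs (List.replicate N (momentumDir j)) F))) u q p := by
  set w : Fin n → Vec n → ℂ := fun j q' => cutAmp N j χ₁ χ₂ (fun _ => 1) (q, 0, q') * u q' with hw
  have hws : ∀ j, ContDiff ℝ (⊤ : ℕ∞) (w j) := fun j => ((hcut j).comp (by fun_prop)).mul hu
  have hwc : ∀ j, HasCompactSupport (w j) := fun j => hc.mul_left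
  have h1 : ∀ j p, osc (cutAmp N j χ₁ χ₂
      (momentumOp (dirDerivs (List.replicate N (momentumDir j)) F))) u q p
      = osc (momentumOp (dirDerivs (List.replicate N (momentumDir j)) F)) (w j) q p := by
    intro j p
    refine integral_congr_ae (Filter.Eventually.of_forall fun q' => ?_)
    simp only [cutAmp, hw]
    ring
  refine ⟨fun j => ?_, ?_⟩
  · rw [funext (h1 j)]
    exact integrable_osc_momentumOp (hF.momentumDerivs j N) (hws j) (hwc j) q
  simp only [h1]
  rw [Finset.mul_sum]
  simp only [← integral_osc_momentumOp hF (hws _) (hwc _) q _ N]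
  have hws' : ∀ j, ContDiff ℝ (⊤ : ℕ∞) fun q' : Vec n => (((q - q') j : ℝ) : ℂ) ^ N
        * ((1 + ∑ k, (((q - q') k : ℝ) : ℂ) ^ (2 * n)) * w j q') := fun j =>
    ((contDiff_coord_sub q j).pow _).mul
      ((contDiff_const.add (ContDiff.sum fun k _ => (contDiff_coord_sub q k).pow _)).mul (hws j))
  have hwc' : ∀ j, HasCompactSupport fun q' : Vec n => (((q - q') j : ℝ) : ℂ) ^ N
        * ((1 + ∑ k, (((q - q') k : ℝ) : ℂ) ^ (2 * n)) * w j q') := fun j =>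
    (hwc j).mul_left.mul_left
  rw [← integral_finsetSum _ fun j _ => integrable_osc hF (hws' j) (hwc' j) q, ← integral_const_mul]
  refine integral_congr_ae (Filter.Eventually.of_forall fun p => ?_)
  simp only
  rw [← osc_sum_right hF.1.continuous _ (fun j => (hws' j).continuous) hwc']
  unfold osc
  rw [← integral_const_mul]
  refine integral_congr_ae (Filter.Eventually.of_forall fun q' => ?_)
  simp only [hw, cutAmp]
  by_cases hq : q - q' = 0
  · have hqq : q' = q := (sub_eq_zero.1 hq).symm
    subst hqq
    have h0 : ∀ A B D : ℂ, χ₁ q' * A * χ₂ q' * B * 1 * D = χ₁ q' * χ₂ q' * (A * B * D) := by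
      intros; ring
    have h2 : χ₁ q' * (F (q', p, q') * phase p q' q' * (χ₂ q' * u q'))
      = χ₁ q' * χ₂ q' * (F (q', p, q') * phase p q' q' * u q') := by ring
    rw [h2]
    simp only [h0, hsep, zero_mul, mul_zero, Finset.sum_const_zero]
  · have h2 := sum_pow_mul_divFun N hq
    have h3 := decayFun_mul (q - q')
    have h4 : ∑ j, (((q - q') j : ℝ) : ℂ) ^ N * ((1 + ∑ k, (((q - q') k : ℝ) : ℂ) ^ (2 * n)) *
        (χ₁ q * divFun N j (q - q') * χ₂ q' * decayFun (q - q') * 1 * u q'))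
      = (∑ j, (((q - q') j : ℝ) : ℂ) ^ N * divFun N j (q - q')) *
        ((1 + ∑ k, (((q - q') k : ℝ) : ℂ) ^ (2 * n)) * decayFun (q - q')) * (χ₁ q * χ₂ q' * u q') := by
      rw [Finset.sum_mul, Finset.sum_mul]
      exact Finset.sum_congr rfl fun j _ => by ring
    rw [h4, h2, h3]
    ring

end PhaseIdentity

section SquareIntegralBounds

lemma sq_lintegral_mul_le {α : Type*} [MeasurableSpace α] {μ : Measure α} {f g : α → ENNReal}
    (hf : AEMeasurable f μ) (hg : AEMeasurable g μ) :
    (∫⁻ x, f x * g x ∂μ) ^ 2 ≤ (∫⁻ x, f x ^ 2 ∂μ) * ∫⁻ x, g x ^ 2 ∂μ := by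
  have h := ENNReal.lintegral_mul_le_Lp_mul_Lq μ Real.HolderConjugate.two_two hf hg
  simp only [Pi.mul_apply, ENNReal.rpow_ofNat] at h
  have hs : ∀ x : ENNReal, (x ^ (1 / (2 : ℝ))) ^ 2 = x := fun x => by
    rw [← ENNReal.rpow_natCast, ← ENNReal.rpow_mul]; norm_num
  calc (∫⁻ x, f x * g x ∂μ) ^ 2 ≤ _ := pow_le_pow_left' h 2
    _ = _ := by rw [mul_pow, hs, hs]

lemma enorm_integral_mul_sq_le {α : Type*} [MeasurableSpace α] {μ : Measure α} {f g : α → ℂ}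
    (hf : AEStronglyMeasurable f μ) (hg : AEStronglyMeasurable g μ) :
    ‖∫ x, f x * g x ∂μ‖ₑ ^ 2 ≤ (∫⁻ x, ‖f x‖ₑ ^ 2 ∂μ) * ∫⁻ x, ‖g x‖ₑ ^ 2 ∂μ := by
  refine (pow_le_pow_left' (enorm_integral_le_lintegral_enorm _) 2).trans ?_
  simp only [enorm_mul]
  exact sq_lintegral_mul_le hf.enorm hg.enorm

variable {n : ℕ}

lemma integrable_ofReal_expDens : Integrable fun r : Vec n => (expDens r : ℂ) :=
  integrable_expDens.ofReal

lemma norm_ofReal_expDens_le (r : Vec n) : ‖(expDens r : ℂ)‖ ≤ 1 := by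
  rw [Complex.norm_real, Real.norm_of_nonneg (expDens_nonneg r)]; exact expDens_le_one r

lemma measurable_ofReal_expDens : Measurable fun r : Vec n => (expDens r : ℂ) :=
  Complex.measurable_ofReal.comp measurable_expDens

lemma lintegral_expDens_sub_sq_le (q : Vec n) : ∫⁻ x, ‖(expDens (q - x) : ℂ)‖ₑ ^ 2 ≤ 1 := by
  rw [lintegral_sub_left_eq_self (fun x : Vec n => ‖(expDens x : ℂ)‖ₑ ^ 2) q]
  calc ∫⁻ x : Vec n, ‖(expDens x : ℂ)‖ₑ ^ 2 ≤ ∫⁻ x : Vec n, ENNReal.ofReal (expDens x) := by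
        refine lintegral_mono fun x => ?_
        have h := norm_ofReal_expDens_le x
        rw [← ofReal_norm, ← ENNReal.ofReal_pow (norm_nonneg _), Complex.norm_real,
          Real.norm_of_nonneg (expDens_nonneg x)]
        refine ENNReal.ofReal_le_ofReal ?_
        have := expDens_nonneg x
        have := expDens_le_one x
        nlinarith
    _ = 1 := by
        rw [← ofReal_integral_eq_lintegral_ofReal integrable_expDens
          (Filter.Eventually.of_forall expDens_nonneg), integral_expDens, ENNReal.ofReal_one]

lemma phase_eq_mul (p q q' : Vec n) : phase p q q' = phase p q 0 * phase p 0 q' := by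
  simp only [phase]
  rw [← Complex.exp_add, ← mul_add, ← Complex.ofReal_add, ← Finset.sum_add_distrib]
  congr 3
  refine Finset.sum_congr rfl fun i _ => ?_
  simp only [Pi.zero_apply]; ring

lemma phase_zero_right (p q : Vec n) : phase p q 0 = phase (-q) 0 p := by
  simp only [phase]
  congr 3
  refine Finset.sum_congr rfl fun i _ => ?_
  simp only [Pi.zero_apply, Pi.neg_apply]; ring

/-- The Fourier transform of `u` localized by the exponential density based at `s`. -/
noncomputable def localFourier (u : Vec n → ℂ) (s p : Vec n) : ℂ :=
  ∫ q', phase p 0 q' * ((expDens (q' - s) : ℂ) * u q')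

lemma continuous_phase {X : Type*} [TopologicalSpace X] {f g h : X → Vec n} (hf : Continuous f)
    (hg : Continuous g) (hh : Continuous h) : Continuous fun x => phase (f x) (g x) (h x) :=
  contDiff_phase.continuous.comp (f := fun x => (g x, f x, h x)) (by fun_prop)

lemma stronglyMeasurable_localFourier {u : Vec n → ℂ} (hu : Continuous u) :
    StronglyMeasurable fun x : Vec n × Vec n => localFourier u x.1 x.2 := by
  have : StronglyMeasurable fun x : (Vec n × Vec n) × Vec n =>
      phase x.1.2 0 x.2 * ((expDens (x.2 - x.1.1) : ℂ) * u x.2) := by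
    refine (continuous_phase (by fun_prop) (by fun_prop) (by fun_prop)).stronglyMeasurable.mul
      (StronglyMeasurable.mul ?_ (hu.comp continuous_snd).stronglyMeasurable)
    exact (measurable_ofReal_expDens.comp (measurable_snd.sub
      (measurable_fst.comp measurable_fst))).stronglyMeasurable
  exact this.integral_prod_right

lemma lintegral_localFourier_sq_le {u : Vec n → ℂ} (hu : Continuous u) (hc : HasCompactSupport u) :
    ∫⁻ s, ∫⁻ p, ‖localFourier u s p‖ₑ ^ 2 ≤ ENNReal.ofReal ((2 * π) ^ n) * ∫⁻ x, ‖u x‖ₑ ^ 2 := by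
  have hm : ∀ s : Vec n, Measurable fun q' : Vec n => (expDens (q' - s) : ℂ) := fun s =>
    measurable_ofReal_expDens.comp (measurable_id.sub_const s)
  have h1 : ∀ s, ∫⁻ p, ‖localFourier u s p‖ₑ ^ 2
      = ENNReal.ofReal ((2 * π) ^ n) * ∫⁻ q', ‖(expDens (q' - s) : ℂ)‖ₑ ^ 2 * ‖u q'‖ₑ ^ 2 := by
    intro s
    simp only [localFourier]
    rw [lintegral_enorm_sq_phase_integral]
    · simp only [enorm_mul, mul_pow]
    · exact (hu.integrable_of_hasCompactSupport hc).bdd_mul (c := 1) (hm s).aestronglyMeasurable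
        (Filter.Eventually.of_forall fun x => norm_ofReal_expDens_le _)
    · refine (hu.memLp_of_hasCompactSupport (p := 2) hc).mono
        ((hm s).aestronglyMeasurable.mul hu.aestronglyMeasurable)
        (Filter.Eventually.of_forall fun x => ?_)
      rw [norm_mul]
      exact mul_le_of_le_one_left (norm_nonneg _) (norm_ofReal_expDens_le _)
  simp_rw [h1]
  have hm2 : Measurable fun x : Vec n × Vec n => (expDens (x.2 - x.1) : ℂ) :=
    measurable_ofReal_expDens.comp (measurable_snd.sub measurable_fst)
  have hm3 : Measurable fun x : Vec n × Vec n => ‖(expDens (x.2 - x.1) : ℂ)‖ₑ ^ 2 * ‖u x.2‖ₑ ^ 2 :=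
    (hm2.enorm.pow_const 2).mul ((hu.measurable.comp measurable_snd).enorm.pow_const 2)
  rw [lintegral_const_mul _ hm3.lintegral_prod_right']
  refine mul_le_mul' le_rfl ?_
  rw [lintegral_lintegral_swap hm3.aemeasurable]
  refine lintegral_mono fun q' => ?_
  simp only
  have hm4 : Measurable fun s : Vec n => ‖(expDens (q' - s) : ℂ)‖ₑ ^ 2 :=
    (measurable_ofReal_expDens.comp (measurable_id.const_sub q')).enorm.pow_const 2
  rw [lintegral_mul_const _ hm4]
  exact mul_le_of_le_one_left' (lintegral_expDens_sub_sq_le q')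

/-- The Fourier transform of `u` against an amplitude. -/
noncomputable def ampFourier (b : Vec n × Vec n × Vec n → ℂ) (u : Vec n → ℂ) (x p : Vec n) : ℂ :=
  ∫ q', b (x, p, q') * phase p 0 q' * u q'

lemma stronglyMeasurable_ampFourier {b : Vec n × Vec n × Vec n → ℂ} (hb : Continuous b)
    {u : Vec n → ℂ} (hu : Continuous u) :
    StronglyMeasurable fun x : Vec n × Vec n => ampFourier b u x.1 x.2 := by
  have : Continuous fun x : (Vec n × Vec n) × Vec n =>
      b (x.1.1, x.1.2, x.2) * phase x.1.2 0 x.2 * u x.2 :=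
    ((hb.comp (by fun_prop)).mul (continuous_phase (by fun_prop) (by fun_prop) (by fun_prop))).mul
      (hu.comp continuous_snd)
  exact this.stronglyMeasurable.integral_prod_right

lemma norm_ampFourier_le {b : Vec n × Vec n × Vec n → ℂ} {K : ℝ} (hK : ∀ z, ‖b z‖ ≤ K)
    {u : Vec n → ℂ} (hu : Integrable u) (x p : Vec n) :
    ‖ampFourier b u x p‖ ≤ K * ∫ q', ‖u q'‖ := by
  rw [← integral_const_mul]
  refine norm_integral_le_of_norm_le (hu.norm.const_mul K) (Filter.Eventually.of_forall fun q' => ?_)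
  rw [norm_mul, norm_mul, norm_phase, mul_one]
  exact mul_le_mul_of_nonneg_right (hK _) (norm_nonneg _)

lemma ampFourier_eq_integral_localFourier {b B : Vec n × Vec n × Vec n → ℂ} (hB : Continuous B)
    {K : ℝ} (hK : ∀ z, ‖B z‖ ≤ K)
    (hrep : ∀ x p q', b (x, p, q') = ∫ s, (expDens (q' - s) : ℂ) * B (x, p, s))
    {u : Vec n → ℂ} (hu : Continuous u) (hc : HasCompactSupport u) (x p : Vec n) :
    ampFourier b u x p = ∫ s, B (x, p, s) * localFourier u s p := by
  have hE : Integrable fun y : Vec n => (expDens (-y) : ℂ) := integrable_ofReal_expDens.comp_neg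
  have h0 := (Integrable.convolution_integrand (μ := volume) (ν := volume)
    (ContinuousLinearMap.mul ℝ ℂ)
    (hu.integrable_of_hasCompactSupport hc) hE).swap
  have hcont : Continuous fun y : Vec n × Vec n => B (x, p, y.2) * phase p 0 y.1 :=
    (hB.comp (by fun_prop)).mul (continuous_phase (by fun_prop) (by fun_prop) (by fun_prop))
  have h1 : Integrable (Function.uncurry fun q' s : Vec n =>
      B (x, p, s) * (phase p 0 q' * ((expDens (q' - s) : ℂ) * u q'))) (volume.prod volume) := by
    refine (h0.bdd_mul (c := K) hcont.aestronglyMeasurable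
      (Filter.Eventually.of_forall fun y => ?_)).congr (Filter.Eventually.of_forall fun y => ?_)
    · rw [norm_mul, norm_phase, mul_one]; exact hK _
    · simp [Function.uncurry]; ring
  calc ampFourier b u x p
      = ∫ q', ∫ s, B (x, p, s) * (phase p 0 q' * ((expDens (q' - s) : ℂ) * u q')) := by
        refine integral_congr_ae (Filter.Eventually.of_forall fun q' => ?_)
        simp only
        rw [hrep, mul_assoc, ← integral_mul_const]
        refine integral_congr_ae (Filter.Eventually.of_forall fun s => ?_)
        simp only; ring
    _ = _ := by
        rw [integral_integral_swap h1]
        refine integral_congr_ae (Filter.Eventually.of_forall fun s => ?_)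
        simp only [localFourier]
        rw [integral_const_mul]

lemma weight_le_one (y : Vec n) : weight y ≤ 1 := by
  unfold weight
  exact inv_le_one_of_one_le₀ (one_le_pow₀ (by linarith [norm_nonneg y]))

lemma continuous_weight : Continuous (weight : Vec n → ℝ) := by
  unfold weight
  exact Continuous.inv₀ (by fun_prop) fun y => by positivity

/-- Schur's test for a convolution kernel. -/
lemma lintegral_sq_le_of_convolution_bound {κ : Vec n → ENNReal} (hκ : Measurable κ)
    (hκt : ∫⁻ y, κ y ≠ ⊤) {f g : Vec n → Vec n → ℂ}
    (hg : Measurable fun y : Vec n × Vec n => g y.1 y.2)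
    (hfg : ∀ x p, ‖f x p‖ₑ ≤ ∫⁻ s, κ (x - s) * ‖g s p‖ₑ) :
    ∫⁻ x, ∫⁻ p, ‖f x p‖ₑ ^ 2 ≤ (∫⁻ y, κ y) ^ 2 * ∫⁻ s, ∫⁻ p, ‖g s p‖ₑ ^ 2 := by
  have h1 : ∀ x p, ‖f x p‖ₑ ^ 2 ≤ (∫⁻ y, κ y) * ∫⁻ s, κ (x - s) * ‖g s p‖ₑ ^ 2 := by
    intro x p
    have hLp : Measurable fun s => ‖g s p‖ₑ :=
      (hg.comp (measurable_id.prodMk measurable_const)).enorm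
    have hκx : Measurable fun s => κ (x - s) := hκ.comp (measurable_id.const_sub x)
    have hs : ∀ y : ENNReal, (y ^ (1 / (2 : ℝ))) ^ 2 = y := fun x => by
      rw [← ENNReal.rpow_natCast, ← ENNReal.rpow_mul]; norm_num
    calc ‖f x p‖ₑ ^ 2
        ≤ (∫⁻ s, κ (x - s) ^ (1 / (2 : ℝ)) * (κ (x - s) ^ (1 / (2 : ℝ)) * ‖g s p‖ₑ)) ^ 2 := by
          refine pow_le_pow_left' ((hfg x p).trans_eq (lintegral_congr fun s => ?_)) 2
          rw [← mul_assoc, ← pow_two, hs]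
      _ ≤ _ := sq_lintegral_mul_le (hκx.pow_const _).aemeasurable
          ((hκx.pow_const _).mul hLp).aemeasurable
      _ = _ := by
          simp only [mul_pow, hs]
          rw [lintegral_sub_left_eq_self κ x]
  have hL2 : Measurable fun y : Vec n × Vec n => ‖g y.1 y.2‖ₑ ^ 2 := hg.enorm.pow_const 2
  have hG : Measurable fun y : (Vec n × Vec n) × Vec n =>
      κ (y.1.1 - y.2) * ‖g y.2 y.1.2‖ₑ ^ 2 :=
    (hκ.comp ((measurable_fst.comp measurable_fst).sub measurable_snd)).mul
      (hL2.comp (measurable_snd.prodMk (measurable_snd.comp measurable_fst)))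
  have hG1 := hG.lintegral_prod_right' (ν := volume)
  calc ∫⁻ x, ∫⁻ p, ‖f x p‖ₑ ^ 2
      ≤ ∫⁻ x, ∫⁻ p, (∫⁻ y, κ y) * ∫⁻ s, κ (x - s) * ‖g s p‖ₑ ^ 2 :=
        lintegral_mono fun x => lintegral_mono fun p => h1 x p
    _ = ∫⁻ x, (∫⁻ y, κ y) * ∫⁻ p, ∫⁻ s, κ (x - s) * ‖g s p‖ₑ ^ 2 :=
        lintegral_congr fun x => lintegral_const_mul' _ _ hκt
    _ = (∫⁻ y, κ y) * ∫⁻ x, ∫⁻ p, ∫⁻ s, κ (x - s) * ‖g s p‖ₑ ^ 2 := lintegral_const_mul' _ _ hκt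
    _ = (∫⁻ y, κ y) * ∫⁻ p, ∫⁻ x, ∫⁻ s, κ (x - s) * ‖g s p‖ₑ ^ 2 := by
        rw [lintegral_lintegral_swap (f := fun x p => ∫⁻ s, κ (x - s) * ‖g s p‖ₑ ^ 2)
          hG1.aemeasurable]
    _ = (∫⁻ y, κ y) * ∫⁻ p, ∫⁻ s, ∫⁻ x, κ (x - s) * ‖g s p‖ₑ ^ 2 := by
        congr 1
        refine lintegral_congr fun p => lintegral_lintegral_swap
          (f := fun x s => κ (x - s) * ‖g s p‖ₑ ^ 2) ?_
        exact (hG.comp (g := fun y : (Vec n × Vec n) × Vec n =>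
            κ (y.1.1 - y.2) * ‖g y.2 y.1.2‖ₑ ^ 2) (f := fun y : Vec n × Vec n => ((y.1, p), y.2))
          ((measurable_fst.prodMk measurable_const).prodMk measurable_snd)).aemeasurable
    _ = (∫⁻ y, κ y) * ∫⁻ p, ∫⁻ s, (∫⁻ y, κ y) * ‖g s p‖ₑ ^ 2 := by
        congr 1
        refine lintegral_congr fun p => lintegral_congr fun s => ?_
        rw [lintegral_mul_const _ (by exact hκ.comp (measurable_id.sub_const s)),
          lintegral_sub_right_eq_self κ s]
    _ = (∫⁻ y, κ y) * ((∫⁻ y, κ y) * ∫⁻ p, ∫⁻ s, ‖g s p‖ₑ ^ 2) := by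
        congr 1
        rw [← lintegral_const_mul' _ _ hκt]
        exact lintegral_congr fun p => lintegral_const_mul' _ _ hκt
    _ = _ := by
        rw [lintegral_lintegral_swap (f := fun s p => ‖g s p‖ₑ ^ 2) hL2.aemeasurable]
        ring

lemma lintegral_ampFourier_sq_le [NeZero n] {b B : Vec n × Vec n × Vec n → ℂ} (hB : Continuous B)
    {K : ℝ} (hK0 : 0 ≤ K) (hK : ∀ z, ‖B z‖ ≤ K * weight (z.1 - z.2.2))
    (hrep : ∀ x p q', b (x, p, q') = ∫ s, (expDens (q' - s) : ℂ) * B (x, p, s))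
    {u : Vec n → ℂ} (hu : Continuous u) (hc : HasCompactSupport u) :
    ∫⁻ x, ∫⁻ p, ‖ampFourier b u x p‖ₑ ^ 2
      ≤ ENNReal.ofReal ((2 * π) ^ n * (K * ∫ y : Vec n, weight y) ^ 2) * ∫⁻ x, ‖u x‖ₑ ^ 2 := by
  have hK' : ∀ z, ‖B z‖ ≤ K := fun z =>
    (hK z).trans (mul_le_of_le_one_right hK0 (weight_le_one _))
  set W : ℝ := ∫ y : Vec n, weight y with hW
  have hW0 : 0 ≤ W := integral_nonneg fun y => (weight_pos y).le
  set κ : Vec n → ENNReal := fun y => ENNReal.ofReal (K * weight y) with hκ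
  have hκm : Measurable κ := (continuous_weight.measurable.const_mul K).ennreal_ofReal
  have hκi : ∫⁻ y, κ y = ENNReal.ofReal (K * W) := by
    rw [hW, ← integral_const_mul, ofReal_integral_eq_lintegral_ofReal
      ((integrable_weight n).const_mul K)
      (Filter.Eventually.of_forall fun y => mul_nonneg hK0 (weight_pos y).le)]
  have h2 := lintegral_sq_le_of_convolution_bound hκm (by rw [hκi]; exact ENNReal.ofReal_ne_top)
    (f := ampFourier b u) (g := localFourier u) (stronglyMeasurable_localFourier hu).measurable
    (fun x p => by
      rw [ampFourier_eq_integral_localFourier hB hK' hrep hu hc]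
      refine (enorm_integral_le_lintegral_enorm _).trans (lintegral_mono fun s => ?_)
      simp only
      rw [enorm_mul]
      refine mul_le_mul' ?_ le_rfl
      rw [← ofReal_norm]
      exact ENNReal.ofReal_le_ofReal (hK _))
  rw [hκi] at h2
  refine h2.trans ((mul_le_mul' le_rfl (lintegral_localFourier_sq_le hu hc)).trans_eq ?_)
  rw [ENNReal.ofReal_mul (p := (2 * π) ^ n) (by positivity),
    ENNReal.ofReal_pow (p := K * W) (by positivity)]
  ring

end SquareIntegralBounds

section CalderonVaillancourt

variable {n : ℕ}

/-- The coordinate directions of the first slot. -/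
def positionDir (k : Fin n) : Vec n × Vec n × Vec n := (Pi.single k 1, 0, 0)

/-- The coordinate directions of the third slot. -/
def positionDir' (k : Fin n) : Vec n × Vec n × Vec n := (0, 0, Pi.single k 1)

lemma norm_positionDir_le (k : Fin n) : ‖positionDir k‖ ≤ 1 := by
  simp [positionDir, Prod.norm_def, Pi.norm_single]

lemma norm_positionDir'_le (k : Fin n) : ‖positionDir' k‖ ≤ 1 := by
  simp [positionDir', Prod.norm_def, Pi.norm_single]

lemma sum_smul_positionDir (r : Vec n) : ∑ k, r k • positionDir k = (r, 0, 0) := by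
  simp only [positionDir, Prod.smul_mk, smul_zero]
  refine Prod.ext ?_ (Prod.ext ?_ ?_)
  · rw [Prod.fst_sum]; exact (pi_eq_sum_univ' r).symm ▸ by simp [Pi.single_apply]
  · rw [Prod.snd_sum, Prod.fst_sum]; simp
  · rw [Prod.snd_sum, Prod.snd_sum]; simp

lemma sum_smul_positionDir' (r : Vec n) : ∑ k, r k • positionDir' k = (0, 0, r) := by
  simp only [positionDir', Prod.smul_mk, smul_zero]
  refine Prod.ext ?_ (Prod.ext ?_ ?_)
  · rw [Prod.fst_sum]; simp
  · rw [Prod.snd_sum, Prod.fst_sum]; simp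
  · rw [Prod.snd_sum, Prod.snd_sum]; exact (pi_eq_sum_univ' r).symm ▸ by simp [Pi.single_apply]

lemma eq_integral_expDens_first {f : Vec n × Vec n × Vec n → ℂ} (hf : ContDiff ℝ (⊤ : ℕ∞) f) {K : ℝ}
    (hK : ∀ k ≤ n, ∀ z, ‖iteratedFDeriv ℝ k f z‖ ≤ K) (q p q' : Vec n) :
    f (q, p, q') = ∫ x, (expDens (q - x) : ℂ) *
      oneAddDerivs (List.ofFn positionDir) f (x, p, q') := by
  rw [eq_integral_expDens_mul hf hK positionDir norm_positionDir_le,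
    ← integral_sub_left_eq_self (fun x => (expDens (q - x) : ℂ) *
      oneAddDerivs (List.ofFn positionDir) f (x, p, q')) volume q]
  simp [sum_smul_positionDir]

lemma eq_integral_expDens_third {f : Vec n × Vec n × Vec n → ℂ} (hf : ContDiff ℝ (⊤ : ℕ∞) f) {K : ℝ}
    (hK : ∀ k ≤ n, ∀ z, ‖iteratedFDeriv ℝ k f z‖ ≤ K) (q p q' : Vec n) :
    f (q, p, q') = ∫ s, (expDens (q' - s) : ℂ) *
      oneAddDerivs (List.ofFn positionDir') f (q, p, s) := by
  rw [eq_integral_expDens_mul hf hK positionDir' norm_positionDir'_le,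
    ← integral_sub_left_eq_self (fun s => (expDens (q' - s) : ℂ) *
      oneAddDerivs (List.ofFn positionDir') f (q, p, s)) volume q']
  simp [sum_smul_positionDir']

lemma osc_eq_integral_ampFourier {b b₁ : Vec n × Vec n × Vec n → ℂ} (hb₁ : Continuous b₁)
    {K : ℝ} (hK : ∀ z, ‖b₁ z‖ ≤ K)
    (hrep : ∀ q p q', b (q, p, q') = ∫ x, (expDens (q - x) : ℂ) * b₁ (x, p, q'))
    {u : Vec n → ℂ} (hu : Continuous u) (hc : HasCompactSupport u) (q p : Vec n) :
    osc b u q p = ∫ x, (expDens (q - x) : ℂ) * (phase p q 0 * ampFourier b₁ u x p) := by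
  have h0 : Integrable (fun y : Vec n × Vec n => u y.1 * (expDens (q - y.2) : ℂ))
      (volume.prod volume) :=
    (hu.integrable_of_hasCompactSupport hc).mul_prod (integrable_ofReal_expDens.comp_sub_left q)
  have hcont : Continuous fun y : Vec n × Vec n => b₁ (y.2, p, y.1) * phase p q y.1 :=
    (hb₁.comp (by fun_prop)).mul (continuous_phase (by fun_prop) (by fun_prop) (by fun_prop))
  have h1 : Integrable (Function.uncurry fun q' x : Vec n =>
      (expDens (q - x) : ℂ) * (phase p q 0 * (b₁ (x, p, q') * phase p 0 q' * u q')))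
      (volume.prod volume) := by
    refine (h0.bdd_mul (c := K) hcont.aestronglyMeasurable
      (Filter.Eventually.of_forall fun y => ?_)).congr (Filter.Eventually.of_forall fun y => ?_)
    · rw [norm_mul, norm_phase, mul_one]; exact hK _
    · simp only [Function.uncurry]; rw [phase_eq_mul p q y.1]; ring
  calc osc b u q p
      = ∫ q', ∫ x, (expDens (q - x) : ℂ) * (phase p q 0 * (b₁ (x, p, q') * phase p 0 q' * u q')) := by
        refine integral_congr_ae (Filter.Eventually.of_forall fun q' => ?_)
        simp only
        rw [hrep, mul_assoc, ← integral_mul_const]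
        refine integral_congr_ae (Filter.Eventually.of_forall fun x => ?_)
        simp only
        rw [phase_eq_mul p q q']; ring
    _ = _ := by
        rw [integral_integral_swap h1]
        refine integral_congr_ae (Filter.Eventually.of_forall fun x => ?_)
        simp only [ampFourier]
        rw [integral_const_mul, integral_const_mul]

lemma lintegral_setIntegral_osc_sq_le {b b₁ : Vec n × Vec n × Vec n → ℂ} (hb₁ : Continuous b₁)
    {K : ℝ} (hK : ∀ z, ‖b₁ z‖ ≤ K)
    (hrep : ∀ q p q', b (q, p, q') = ∫ x, (expDens (q - x) : ℂ) * b₁ (x, p, q'))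
    {u : Vec n → ℂ} (hu : Continuous u) (hc : HasCompactSupport u) {s : Set (Vec n)}
    (hs : MeasurableSet s) (hsf : volume s ≠ ⊤) :
    ∫⁻ q, ‖∫ p in s, osc b u q p‖ₑ ^ 2
      ≤ ENNReal.ofReal ((2 * π) ^ n) * ∫⁻ x, ∫⁻ p, ‖ampFourier b₁ u x p‖ₑ ^ 2 := by
  have hsf' : IsFiniteMeasure (volume.restrict s) := ⟨by simpa using hsf.lt_top⟩
  have hMm := stronglyMeasurable_ampFourier hb₁ hu
  have hMb := norm_ampFourier_le hK (hu.integrable_of_hasCompactSupport hc)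
  set D : ℝ := K * ∫ q', ‖u q'‖
  set H : Vec n → Vec n → ℂ := fun x q => ∫ p in s, phase p q 0 * ampFourier b₁ u x p with hH
  have hphm : Continuous fun y : (Vec n × Vec n) × Vec n => phase y.2 y.1.2 0 :=
    continuous_phase (by fun_prop) (by fun_prop) (by fun_prop)
  have hHm : StronglyMeasurable fun y : Vec n × Vec n => H y.1 y.2 := by
    have : StronglyMeasurable fun y : (Vec n × Vec n) × Vec n =>
        phase y.2 y.1.2 0 * ampFourier b₁ u y.1.1 y.2 :=
      hphm.stronglyMeasurable.mul (hMm.comp_measurable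
        ((measurable_fst.comp measurable_fst).prodMk measurable_snd))
    exact this.integral_prod_right
  have hH2 : Measurable fun y : Vec n × Vec n => ‖H y.2 y.1‖ₑ ^ 2 :=
    (hHm.measurable.comp measurable_swap).enorm.pow_const 2
  have h1 : ∀ q, ∫ p in s, osc b u q p = ∫ x, (expDens (q - x) : ℂ) * H x q := by
    intro q
    simp_rw [osc_eq_integral_ampFourier hb₁ hK hrep hu hc]
    rw [integral_integral_swap]
    · refine integral_congr_ae (Filter.Eventually.of_forall fun x => ?_)
      simp only [hH]
      rw [integral_const_mul]
    · have h0 : Integrable (fun y : Vec n × Vec n => (1 : ℂ) * (expDens (q - y.2) : ℂ))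
          ((volume.restrict s).prod volume) :=
        (integrable_const 1).mul_prod (integrable_ofReal_expDens.comp_sub_left q)
      have hm : StronglyMeasurable fun y : Vec n × Vec n =>
          phase y.1 q 0 * ampFourier b₁ u y.2 y.1 :=
        (continuous_phase (by fun_prop) (by fun_prop) (by fun_prop)).stronglyMeasurable.mul
          (hMm.comp_measurable measurable_swap)
      refine (h0.bdd_mul (c := D) hm.aestronglyMeasurable
        (Filter.Eventually.of_forall fun y => ?_)).congr (Filter.Eventually.of_forall fun y => ?_)
      · rw [norm_mul, norm_phase, one_mul]; exact hMb _ _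
      · simp only [Function.uncurry]; ring
  calc ∫⁻ q, ‖∫ p in s, osc b u q p‖ₑ ^ 2
      ≤ ∫⁻ q, ∫⁻ x, ‖H x q‖ₑ ^ 2 := by
        refine lintegral_mono fun q => ?_
        simp only
        rw [h1]
        refine (enorm_integral_mul_sq_le ?_ ?_).trans
          (mul_le_of_le_one_left' (lintegral_expDens_sub_sq_le q))
        · exact (measurable_ofReal_expDens.comp (measurable_id.const_sub q)).aestronglyMeasurable
        · exact (hHm.comp_measurable (measurable_id.prodMk measurable_const)).aestronglyMeasurable
    _ = ∫⁻ x, ∫⁻ q, ‖H x q‖ₑ ^ 2 :=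
        lintegral_lintegral_swap (f := fun q x => ‖H x q‖ₑ ^ 2) hH2.aemeasurable
    _ ≤ ∫⁻ x, ENNReal.ofReal ((2 * π) ^ n) * ∫⁻ p, ‖ampFourier b₁ u x p‖ₑ ^ 2 := by
        refine lintegral_mono fun x => ?_
        simp only
        have hx : StronglyMeasurable fun p => ampFourier b₁ u x p :=
          hMm.comp_measurable (measurable_const.prodMk measurable_id)
        have hbd : MemLp (fun p => ampFourier b₁ u x p) ⊤ (volume.restrict s) :=
          memLp_top_of_bound hx.aestronglyMeasurable D (Filter.Eventually.of_forall (hMb x))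
        have e1 : ∀ q, H x q
            = ∫ p, phase (-q) 0 p * s.indicator (fun p => ampFourier b₁ u x p) p := by
          intro q
          simp only [hH]
          rw [← integral_indicator hs]
          refine integral_congr_ae (Filter.Eventually.of_forall fun p => ?_)
          simp only [← phase_zero_right, Set.indicator]
          split_ifs <;> simp
        simp_rw [e1]
        rw [lintegral_neg_eq_self (μ := volume) (fun q => ‖∫ p, phase q 0 p *
          s.indicator (fun p => ampFourier b₁ u x p) p‖ₑ ^ 2), lintegral_enorm_sq_phase_integral]
        · refine mul_le_mul' le_rfl (lintegral_mono fun p => ?_)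
          simp only
          gcongr
          exact enorm_indicator_le_enorm_self _ _
        · exact (integrable_indicator_iff hs).2
            (memLp_one_iff_integrable.1 (hbd.mono_exponent le_top))
        · exact (memLp_indicator_iff_restrict hs).2 (hbd.mono_exponent le_top)
    _ = _ := lintegral_const_mul' _ _ ENNReal.ofReal_ne_top

lemma stronglyMeasurable_integral_osc {b : Vec n × Vec n × Vec n → ℂ} (hb : Continuous b)
    {u : Vec n → ℂ} (hu : Continuous u) (s : Set (Vec n)) :
    StronglyMeasurable fun q => ∫ p in s, osc b u q p := by
  have h0 : Continuous fun x : (Vec n × Vec n) × Vec n =>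
      b (x.1.1, x.1.2, x.2) * phase x.1.2 x.1.1 x.2 * u x.2 :=
    ((hb.comp (by fun_prop)).mul (continuous_phase (by fun_prop) (by fun_prop)
      (by fun_prop))).mul (hu.comp continuous_snd)
  have h1 : StronglyMeasurable fun x : Vec n × Vec n => osc b u x.1 x.2 :=
    h0.stronglyMeasurable.integral_prod_right
  exact h1.integral_prod_right (ν := volume.restrict s)

/-- A Calderón–Vaillancourt bound for amplitudes decaying away from the diagonal. -/
lemma lintegral_integral_osc_sq_le [NeZero n] {b : Vec n × Vec n × Vec n → ℂ}
    (hb : ContDiff ℝ (⊤ : ℕ∞) b) {K : ℝ} (hK0 : 0 ≤ K)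
    (hK : ∀ k ≤ 2 * n, ∀ z, ‖iteratedFDeriv ℝ k b z‖ ≤ K * weight (z.1 - z.2.2))
    {u : Vec n → ℂ} (hu : Continuous u) (hc : HasCompactSupport u)
    (hInt : ∀ q, Integrable (osc b u q)) :
    ∫⁻ q, ‖∫ p, osc b u q p‖ₑ ^ 2
      ≤ ENNReal.ofReal (((2 * π) ^ n * (4 ^ n * ∫ y : Vec n, weight y) * K) ^ 2) *
        ∫⁻ x, ‖u x‖ₑ ^ 2 := by
  set b₁ := oneAddDerivs (List.ofFn positionDir) b with hb₁
  set B := oneAddDerivs (List.ofFn positionDir') b₁ with hB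
  have hb₁s : ContDiff ℝ (⊤ : ℕ∞) b₁ := contDiff_oneAddDerivs hb _
  have hBs : ContDiff ℝ (⊤ : ℕ∞) B := contDiff_oneAddDerivs hb₁s _
  have hL : ∀ v ∈ List.ofFn (positionDir (n := n)), ‖v‖ ≤ 1 := by
    intro v hv
    obtain ⟨k, rfl⟩ := (List.mem_ofFn' _ _).1 hv
    exact norm_positionDir_le k
  have hL' : ∀ v ∈ List.ofFn (positionDir' (n := n)), ‖v‖ ≤ 1 := by
    intro v hv
    obtain ⟨k, rfl⟩ := (List.mem_ofFn' _ _).1 hv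
    exact norm_positionDir'_le k
  have hb₁K : ∀ k ≤ n, ∀ z, ‖iteratedFDeriv ℝ k b₁ z‖ ≤ 2 ^ n * (K * weight (z.1 - z.2.2)) := by
    intro k hk z
    have := norm_iteratedFDeriv_oneAddDerivs_le (m := n) (z := z) hb _ hL
      (K := K * weight (z.1 - z.2.2)) (fun k hk => hK k (by simpa [two_mul] using hk) z) k hk
    simpa using this
  have hBK : ∀ z, ‖B z‖ ≤ 4 ^ n * K * weight (z.1 - z.2.2) := by
    intro z
    have := norm_iteratedFDeriv_oneAddDerivs_le (m := 0) (z := z) hb₁s _ hL'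
      (K := 2 ^ n * (K * weight (z.1 - z.2.2))) (fun k hk => hb₁K k (by simpa using hk) z) 0 le_rfl
    rw [norm_iteratedFDeriv_zero, List.length_ofFn] at this
    refine this.trans_eq ?_
    rw [show (4 : ℝ) = 2 * 2 by norm_num, mul_pow]
    ring
  have hw : ∀ z : Vec n × Vec n × Vec n, K * weight (z.1 - z.2.2) ≤ K := fun z =>
    mul_le_of_le_one_right hK0 (weight_le_one _)
  have hb₁K' : ∀ k ≤ n, ∀ z, ‖iteratedFDeriv ℝ k b₁ z‖ ≤ 2 ^ n * K := fun k hk z =>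
    (hb₁K k hk z).trans (mul_le_mul_of_nonneg_left (hw z) (by positivity))
  have hrep := eq_integral_expDens_first hb (K := K) fun k hk z =>
    (hK k (by omega) z).trans (hw z)
  have hrep' := eq_integral_expDens_third hb₁s hb₁K'
  have hb₁0 : ∀ z, ‖b₁ z‖ ≤ 2 ^ n * K := fun z => by simpa using hb₁K' 0 (Nat.zero_le _) z
  have hmain : ∀ m : ℕ, ∫⁻ q, ‖∫ p in Metric.ball 0 (m : ℝ), osc b u q p‖ₑ ^ 2
      ≤ ENNReal.ofReal (((2 * π) ^ n * (4 ^ n * ∫ y : Vec n, weight y) * K) ^ 2) *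
        ∫⁻ x, ‖u x‖ₑ ^ 2 := by
    intro m
    refine (lintegral_setIntegral_osc_sq_le hb₁s.continuous hb₁0 hrep hu hc measurableSet_ball
      measure_ball_lt_top.ne).trans ((mul_le_mul' le_rfl (lintegral_ampFourier_sq_le hBs.continuous
        (by positivity) hBK hrep' hu hc)).trans_eq ?_)
    rw [← mul_assoc, ← ENNReal.ofReal_mul (by positivity)]
    congr 2
    ring
  have hlim : ∀ q, Filter.Tendsto (fun m : ℕ => ‖∫ p in Metric.ball 0 (m : ℝ), osc b u q p‖ₑ ^ 2)
      Filter.atTop (nhds (‖∫ p, osc b u q p‖ₑ ^ 2)) := by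
    intro q
    have := tendsto_setIntegral_of_monotone (μ := volume) (f := osc b u q)
      (s := fun m : ℕ => Metric.ball (0 : Vec n) (m : ℝ)) (fun m => measurableSet_ball)
      (fun i j hij => Metric.ball_subset_ball (by exact_mod_cast hij)) (hInt q).integrableOn
    rw [Metric.iUnion_ball_nat, setIntegral_univ] at this
    exact ((ENNReal.continuous_pow 2).tendsto _).comp ((continuous_enorm.tendsto _).comp this)
  have hmeas : ∀ m : ℕ, Measurable fun q => ‖∫ p in Metric.ball 0 (m : ℝ), osc b u q p‖ₑ ^ 2 :=
    fun m => (stronglyMeasurable_integral_osc hb.continuous hu _).measurable.enorm.pow_const 2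
  calc ∫⁻ q, ‖∫ p, osc b u q p‖ₑ ^ 2
      = ∫⁻ q, Filter.liminf (fun m : ℕ => ‖∫ p in Metric.ball 0 (m : ℝ), osc b u q p‖ₑ ^ 2)
          Filter.atTop := lintegral_congr fun q => (hlim q).liminf_eq.symm
    _ ≤ Filter.liminf (fun m : ℕ => ∫⁻ q, ‖∫ p in Metric.ball 0 (m : ℝ), osc b u q p‖ₑ ^ 2)
          Filter.atTop := lintegral_liminf_le hmeas
    _ ≤ _ := Filter.liminf_le_of_le (h := fun c hc => by
        obtain ⟨m, hm⟩ := hc.exists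
        exact hm.trans (hmain m))

end CalderonVaillancourt

section DisjointSupports

variable {n : ℕ}

lemma dirDerivs_replicate_momentumDir {a : Vec n → Vec n → Vec n → ℂ}
    (ha : ContDiff ℝ (⊤ : ℕ∞) (uncurry3 a)) (N : ℕ) (j : Fin n) :
    dirDerivs (List.replicate N (momentumDir j)) (uncurry3 a)
      = uncurry3 (d2B (fun i => if i = j then N else 0) a) := by
  rw [uncurry3_d2B ha]
  refine dirDerivs_perm (Multiset.coe_eq_coe.1 ?_) ha
  rw [coe_dirList, Multiset.coe_replicate, Finset.sum_eq_single j]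
  · simp [Multiset.nsmul_singleton, momentumDir]
  · intro i _ hi; simp [hi]
  · simp

lemma contDiff_momentumOp {G : Vec n × Vec n × Vec n → ℂ} (hG : ContDiff ℝ (⊤ : ℕ∞) G) :
    ContDiff ℝ (⊤ : ℕ∞) (momentumOp G) :=
  hG.add (ContDiff.sum fun _ _ => contDiff_const.mul (contDiff_dirDerivs hG _))

lemma norm_iteratedFDeriv_momentumOp_le {G : Vec n × Vec n × Vec n → ℂ}
    (hG : ContDiff ℝ (⊤ : ℕ∞) G) {m : ℕ} {K : ℝ} {z : Vec n × Vec n × Vec n}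
    (hK : ∀ k ≤ m + 2 * n, ‖iteratedFDeriv ℝ k G z‖ ≤ K) {k : ℕ} (hk : k ≤ m) :
    ‖iteratedFDeriv ℝ k (momentumOp G) z‖ ≤ (n + 1) * K := by
  have hD : ∀ i : Fin n, ContDiff ℝ (⊤ : ℕ∞)
      (dirDerivs (List.replicate (2 * n) (momentumDir i)) G) := fun i => contDiff_dirDerivs hG _
  have hle : ((k : ℕ∞) : WithTop ℕ∞) ≤ ((⊤ : ℕ∞) : WithTop ℕ∞) := by exact_mod_cast le_top
  have h0 : momentumOp G = G + ∑ i, (((-1) ^ n : ℂ) •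
      dirDerivs (List.replicate (2 * n) (momentumDir i)) G) := by
    funext z
    simp [momentumOp]
  rw [h0, iteratedFDeriv_add_apply (hG.of_le hle).contDiffAt, iteratedFDeriv_sum_apply]
  · calc _ ≤ K + ∑ i : Fin n, K := by
          refine (norm_add_le _ _).trans (add_le_add (hK k (by omega)) ((norm_sum_le _ _).trans
            (Finset.sum_le_sum fun i _ => ?_)))
          rw [iteratedFDeriv_const_smul_apply ((hD i).of_le hle).contDiffAt, norm_smul, norm_pow,
            norm_neg, norm_one, one_pow, one_mul]
          refine (norm_iteratedFDeriv_dirDerivs_le hG _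
            (fun v hv => List.eq_of_mem_replicate hv ▸ norm_momentumDir_le i) z k).trans ?_
          rw [List.length_replicate]
          exact hK _ (by omega)
      _ = _ := by rw [Finset.sum_const, Finset.card_univ, Fintype.card_fin, nsmul_eq_mul]; ring
  · exact fun i _ => (contDiff_const.smul ((hD i).of_le hle)).contDiffAt
  · have : ContDiff ℝ (k : ℕ∞) (∑ i, (((-1) ^ n : ℂ) •
        dirDerivs (List.replicate (2 * n) (momentumDir i)) G)) := by
      rw [show (∑ i, (((-1) ^ n : ℂ) • dirDerivs (List.replicate (2 * n) (momentumDir i)) G))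
        = fun z => ∑ i, (-1) ^ n * dirDerivs (List.replicate (2 * n) (momentumDir i)) G z by
          funext z; simp]
      exact ContDiff.sum fun i _ => contDiff_const.mul ((hD i).of_le hle)
    exact this.contDiffAt

lemma L2_le_of_lintegral_le {f u : Vec n → ℂ} (hu : Continuous u) (hc : HasCompactSupport u) {D : ℝ}
    (hD : 0 ≤ D) (h : ∫⁻ q, ‖f q‖ₑ ^ 2 ≤ ENNReal.ofReal (D ^ 2) * ∫⁻ q, ‖u q‖ₑ ^ 2) :
    L2 f ≤ D * L2 u := by
  have key : ∀ g : Vec n → ℂ, Integrable (fun q => ‖g q‖ ^ 2) →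
      ENNReal.ofReal (∫ q, ‖g q‖ ^ 2) = ∫⁻ q, ‖g q‖ₑ ^ 2 := by
    intro g hg
    rw [ofReal_integral_eq_lintegral_ofReal hg (Filter.Eventually.of_forall fun q => by positivity)]
    refine lintegral_congr fun q => ?_
    rw [ENNReal.ofReal_pow (norm_nonneg _), ofReal_norm]
  have hu2 : Integrable fun q => ‖u q‖ ^ 2 := by
    refine (by fun_prop : Continuous fun q => ‖u q‖ ^ 2).integrable_of_hasCompactSupport ?_
    exact hc.comp_left (g := fun z : ℂ => ‖z‖ ^ 2) (by simp)
  have hU : 0 ≤ ∫ q, ‖u q‖ ^ 2 := integral_nonneg fun q => by positivity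
  have hle : ∫ q, ‖f q‖ ^ 2 ≤ D ^ 2 * ∫ q, ‖u q‖ ^ 2 := by
    by_cases hf : Integrable fun q => ‖f q‖ ^ 2
    · rw [← key f hf, ← key u hu2, ← ENNReal.ofReal_mul (by positivity)] at h
      exact (ENNReal.ofReal_le_ofReal_iff (by positivity)).1 h
    · rw [integral_undef hf]; positivity
  calc L2 f ≤ √(D ^ 2 * ∫ q, ‖u q‖ ^ 2) := Real.sqrt_le_sqrt hle
    _ = D * L2 u := by rw [Real.sqrt_mul (by positivity), Real.sqrt_sq hD, L2]

lemma enorm_sum_sq_le {ι : Type*} (s : Finset ι) (f : ι → ℂ) :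
    ‖∑ i ∈ s, f i‖ₑ ^ 2 ≤ s.card * ∑ i ∈ s, ‖f i‖ₑ ^ 2 := by
  have h : ‖∑ i ∈ s, f i‖₊ ^ 2 ≤ s.card * ∑ i ∈ s, ‖f i‖₊ ^ 2 :=
    (pow_le_pow_left' (nnnorm_sum_le s f) 2).trans sq_sum_le_card_mul_sum_sq
  have := ENNReal.coe_le_coe.2 h
  push_cast at this
  exact this

lemma setDist_le_norm_sub {S T : Set (Vec n)} {x y : Vec n} (hx : x ∈ S) (hy : y ∈ T) :
    setDist S T ≤ ‖x - y‖ := by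
  rw [← dist_eq_norm]
  refine csInf_le ⟨0, ?_⟩ ⟨x, hx, y, hy, rfl⟩
  rintro d ⟨x, -, y, -, rfl⟩
  exact dist_nonneg

end DisjointSupports

/-- The `L²` bound for `Op(a)` between cut-offs with separated supports, with constants expressed
through derivative bounds of the cut-offs and of `∂_{p_j}^N a`. -/
lemma exists_L2_cutoff_Op_le (n N : ℕ) [NeZero n] : ∃ C, 0 ≤ C ∧
    ∀ (a : Vec n → Vec n → Vec n → ℂ) (χ₁ χ₂ u : Vec n → ℂ) (K₁ K₂ K d : ℝ),
      BddDerivs (uncurry3 a) → ContDiff ℝ (⊤ : ℕ∞) χ₁ → ContDiff ℝ (⊤ : ℕ∞) χ₂ →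
      ContDiff ℝ (⊤ : ℕ∞) u → HasCompactSupport u → 0 < d →
      (∀ q ∈ tsupport χ₁, ∀ q' ∈ tsupport χ₂, d ≤ ‖q - q'‖) →
      (∀ k ≤ 4 * n, ∀ q, ‖iteratedFDeriv ℝ k χ₁ q‖ ≤ K₁) →
      (∀ k ≤ 4 * n, ∀ q, ‖iteratedFDeriv ℝ k χ₂ q‖ ≤ K₂) →
      (∀ j, ∀ k ≤ 4 * n, ∀ z, ‖iteratedFDeriv ℝ k
        (dirDerivs (List.replicate N (momentumDir j)) (uncurry3 a)) z‖ ≤ K) →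
      L2 (fun q => χ₁ q * Op a (fun q' => χ₂ q' * u q') q)
        ≤ C * d⁻¹ ^ N * K₁ * K₂ * K * L2 u := by
  obtain ⟨C₀, hC₀, hcut⟩ := exists_cutAmp_bound n N
  set c : ℝ := (2 * Real.pi) ^ (-(n : ℤ)) with hc'
  set W : ℝ := ∫ y : Vec n, weight y with hW
  have hW0 : 0 ≤ W := integral_nonneg fun y => (weight_pos y).le
  set A : ℝ := (2 * π) ^ n * (4 ^ n * W) with hA
  have hc0 : 0 < c := by positivity
  refine ⟨c * n * (A * (C₀ * (n + 1))), by positivity, ?_⟩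
  intro a χ₁ χ₂ u K₁ K₂ K d ha hχ₁ hχ₂ hu huc hd hsep hK₁ hK₂ hK
  have hK₁0 : 0 ≤ K₁ := (norm_nonneg _).trans (hK₁ 0 (Nat.zero_le _) 0)
  have hK₂0 : 0 ≤ K₂ := (norm_nonneg _).trans (hK₂ 0 (Nat.zero_le _) 0)
  have hK0 : 0 ≤ K := (norm_nonneg _).trans (hK 0 0 (Nat.zero_le _) 0)
  set G : Fin n → Vec n × Vec n × Vec n → ℂ := fun j =>
    dirDerivs (List.replicate N (momentumDir j)) (uncurry3 a) with hG
  have hGs : ∀ j, ContDiff ℝ (⊤ : ℕ∞) (G j) := fun j => contDiff_dirDerivs ha.1 _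
  set b : Fin n → Vec n × Vec n × Vec n → ℂ := fun j => cutAmp N j χ₁ χ₂ (momentumOp (G j)) with hb
  have hbb := fun j => hcut j χ₁ χ₂ (momentumOp (G j)) K₁ K₂ ((n + 1) * K) d hχ₁ hχ₂
    (contDiff_momentumOp (hGs j)) hd hsep hK₁ (fun k hk => hK₂ k (by omega))
    (fun k hk z => norm_iteratedFDeriv_momentumOp_le (hGs j)
      (fun k hk => hK j k (by omega) z) hk)
  have h1s : ∀ j, ContDiff ℝ (⊤ : ℕ∞) (cutAmp N j χ₁ χ₂ fun _ => 1) := fun j =>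
    (hcut j χ₁ χ₂ (fun _ => 1) K₁ K₂ 1 d hχ₁ hχ₂ contDiff_const hd hsep hK₁
      (fun k hk => hK₂ k (by omega)) (fun k hk z => by
        rcases Nat.eq_zero_or_pos k with rfl | hk0
        · simp
        · rw [iteratedFDeriv_const_of_ne hk0.ne']; simp)).1
  have hprod : ∀ q, χ₁ q * χ₂ q = 0 := by
    intro q
    by_contra hne
    have := hsep q (subset_tsupport _ (left_ne_zero_of_mul hne)) q
      (subset_tsupport _ (right_ne_zero_of_mul hne))
    rw [sub_self, norm_zero] at this
    linarith
  have hmain := mul_integral_osc_eq_sum ha hu huc N h1s hprod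
  set Kb : ℝ := C₀ * d⁻¹ ^ N * K₁ * K₂ * ((n + 1) * K) with hKb
  have hKb0 : 0 ≤ Kb := by positivity
  have hI : ∀ j, ∫⁻ q, ‖∫ p, osc (b j) u q p‖ₑ ^ 2
      ≤ ENNReal.ofReal ((A * Kb) ^ 2) * ∫⁻ x, ‖u x‖ₑ ^ 2 := fun j =>
    lintegral_integral_osc_sq_le (hbb j).1 hKb0 (hbb j).2 hu.continuous huc
      fun q => (hmain q).1 j
  have hIm : ∀ j, Measurable fun q => ‖∫ p, osc (b j) u q p‖ₑ ^ 2 := fun j => by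
    have := stronglyMeasurable_integral_osc (hbb j).1.continuous hu.continuous Set.univ
    simp only [setIntegral_univ] at this
    exact this.measurable.enorm.pow_const 2
  have heq : ∀ q, χ₁ q * Op a (fun q' => χ₂ q' * u q') q
      = (c : ℂ) * (Complex.I ^ N * ∑ j, ∫ p, osc (b j) u q p) := by
    intro q
    rw [← (hmain q).2]
    change χ₁ q * ((c : ℂ) * ∫ p, osc (uncurry3 a) (fun q' => χ₂ q' * u q') q p) = _
    ring
  have hpt : ∀ q, ‖χ₁ q * Op a (fun q' => χ₂ q' * u q') q‖ₑ ^ 2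
      ≤ ENNReal.ofReal (c ^ 2) * (n * ∑ j, ‖∫ p, osc (b j) u q p‖ₑ ^ 2) := by
    intro q
    have hc1 : ‖(c : ℂ)‖ₑ = ENNReal.ofReal c := by
      rw [← ofReal_norm, Complex.norm_real, Real.norm_of_nonneg hc0.le]
    have hI1 : ‖Complex.I ^ N‖ₑ = 1 := by
      rw [← ofReal_norm, norm_pow, Complex.norm_I, one_pow, ENNReal.ofReal_one]
    rw [heq, enorm_mul, enorm_mul, hc1, hI1, one_mul, mul_pow, ENNReal.ofReal_pow hc0.le]
    refine mul_le_mul' le_rfl ((enorm_sum_sq_le _ _).trans_eq ?_)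
    rw [Finset.card_univ, Fintype.card_fin]
  refine (L2_le_of_lintegral_le hu.continuous huc (D := c * n * (A * Kb)) (by positivity) ?_).trans_eq
    (by rw [hKb]; ring)
  calc _ ≤ ∫⁻ q, ENNReal.ofReal (c ^ 2) * (n * ∑ j, ‖∫ p, osc (b j) u q p‖ₑ ^ 2) :=
        lintegral_mono hpt
    _ = ENNReal.ofReal (c ^ 2) * (n * ∑ j, ∫⁻ q, ‖∫ p, osc (b j) u q p‖ₑ ^ 2) := by
        rw [lintegral_const_mul' _ _ ENNReal.ofReal_ne_top,
          lintegral_const_mul' _ _ (ENNReal.natCast_ne_top n), lintegral_finsetSum _ fun j _ => hIm j]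
    _ ≤ ENNReal.ofReal (c ^ 2) * (n * ∑ _j : Fin n,
          ENNReal.ofReal ((A * Kb) ^ 2) * ∫⁻ x, ‖u x‖ₑ ^ 2) :=
        mul_le_mul' le_rfl (mul_le_mul' le_rfl (Finset.sum_le_sum fun j _ => hI j))
    _ = _ := by
        rw [Finset.sum_const, Finset.card_univ, Fintype.card_fin, nsmul_eq_mul, mul_pow (c * n),
          mul_pow c, ENNReal.ofReal_mul (by positivity), ENNReal.ofReal_mul (by positivity),
          ENNReal.ofReal_pow (Nat.cast_nonneg n), ENNReal.ofReal_natCast]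
        ring

/-- **Proposition 3.4 (2).**  For every `N ≥ 0` there are `C > 0` and `M ≥ 0` such that
`‖χ₁ Op(a) χ₂ u‖_{L²} ≤ C dist(supp χ₁, supp χ₂)^{-N} |χ₁|_M |χ₂|_M
(∑_{|B| = N} |∂_p^B a|_{M,0,0}) ‖u‖_{L²}`
for all `a ∈ BS⁰₀(1)`, all `u ∈ C_c^∞(ℝⁿ)` and all `χ₁, χ₂ ∈ 𝓑` whose supports have
positive distance. -/
theorem Op_disjoint_supports
    (n : ℕ) [NeZero n] (N : ℕ) :
    ∃ C > 0, ∃ M : ℕ, ∀ a : Vec n → Vec n → Vec n → ℂ, IsBisymbolOne 0 0 a →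
      ∀ u : Vec n → ℂ, ContDiff ℝ (⊤ : ℕ∞) u → HasCompactSupport u →
        ∀ χ₁ χ₂ : Vec n → ℂ, InBClass χ₁ → InBClass χ₂ →
          0 < setDist (tsupport χ₁) (tsupport χ₂) →
          L2 (fun q => χ₁ q * Op a (fun q' => χ₂ q' * u q') q)
            ≤ C * setDist (tsupport χ₁) (tsupport χ₂) ^ (-(N : ℤ)) *
                bSeminorm M χ₁ * bSeminorm M χ₂ *
                (∑ B : Fin n → Fin (N + 1),
                  if fullLen (fun i => (B i : ℕ)) = N then
                    bisymSeminormOne M 0 0 (d2B (fun i => (B i : ℕ)) a)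
                  else 0) * L2 u := by
  obtain ⟨C, hC, h⟩ := exists_L2_cutoff_Op_le n N
  have hn : (1 : ℝ) ≤ n := by exact_mod_cast Nat.one_le_iff_ne_zero.2 (NeZero.ne n)
  refine ⟨C * ((n : ℝ) ^ (4 * n)) * ((n : ℝ) ^ (4 * n)) * ((3 * n : ℝ) ^ (4 * n)) + 1, by positivity,
    4 * n, ?_⟩
  intro a ha u hu huc χ₁ χ₂ hχ₁ hχ₂ hd
  have hF := ha.bddDerivs
  set d := setDist (tsupport χ₁) (tsupport χ₂) with hd'
  set S : ℝ := ∑ B : Fin n → Fin (N + 1), if fullLen (fun i => (B i : ℕ)) = N then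
    bisymSeminormOne (4 * n) 0 0 (d2B (fun i => (B i : ℕ)) a) else 0 with hS
  have hterm : ∀ B ∈ (Finset.univ : Finset (Fin n → Fin (N + 1))),
      0 ≤ if fullLen (fun i => (B i : ℕ)) = N then
        bisymSeminormOne (4 * n) 0 0 (d2B (fun i => (B i : ℕ)) a) else 0 := by
    intro B _
    split_ifs
    exacts [bisymSeminormOne_nonneg _ _, le_rfl]
  have hS0 : 0 ≤ S := Finset.sum_nonneg hterm
  have hpow : ∀ x : ℝ, 1 ≤ x → ∀ k ≤ 4 * n, x ^ k ≤ x ^ (4 * n) := fun x hx k hk =>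
    pow_le_pow_right₀ hx hk
  have hχ : ∀ χ : Vec n → ℂ, InBClass χ → ∀ k ≤ 4 * n, ∀ q,
      ‖iteratedFDeriv ℝ k χ q‖ ≤ (n : ℝ) ^ (4 * n) * bSeminorm (4 * n) χ := fun χ hχ k hk q =>
    (norm_iteratedFDeriv_le_bSeminorm hχ hk q).trans
      (mul_le_mul_of_nonneg_right (hpow _ hn k hk) (bSeminorm_nonneg _ _))
  have hG : ∀ j : Fin n, ∀ k ≤ 4 * n, ∀ z, ‖iteratedFDeriv ℝ k
      (dirDerivs (List.replicate N (momentumDir j)) (uncurry3 a)) z‖ ≤ (3 * n : ℝ) ^ (4 * n) * S := by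
    intro j k hk z
    have hb := hF.momentumDerivs j N
    rw [dirDerivs_replicate_momentumDir hF.1] at hb ⊢
    have hle : bisymSeminormOne (4 * n) 0 0 (d2B (fun i => if i = j then N else 0) a) ≤ S := by
      have := Finset.single_le_sum hterm
        (Finset.mem_univ (fun i => if i = j then Fin.last N else 0))
      have hB : (fun i => ((if i = j then Fin.last N else 0 : Fin (N + 1)) : ℕ))
          = fun i => if i = j then N else 0 := by
        funext i
        split_ifs <;> simp
      rw [hB, if_pos (by simp [fullLen])] at this
      exact this
    exact (norm_iteratedFDeriv_le_bisymSeminormOne hb hk z).trans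
      (mul_le_mul (hpow _ (by linarith) k hk) hle (bisymSeminormOne_nonneg _ _) (by positivity))
  refine (h a χ₁ χ₂ u _ _ _ d hF hχ₁.1 hχ₂.1 hu huc hd
    (fun q hq q' hq' => setDist_le_norm_sub hq hq') (hχ χ₁ hχ₁) (hχ χ₂ hχ₂) hG).trans ?_
  have hL : 0 ≤ L2 u := Real.sqrt_nonneg _
  have h1 := bSeminorm_nonneg (4 * n) χ₁
  have h2 := bSeminorm_nonneg (4 * n) χ₂
  rw [zpow_neg, zpow_natCast, ← inv_pow]
  have hP : 0 ≤ d⁻¹ ^ N * bSeminorm (4 * n) χ₁ * bSeminorm (4 * n) χ₂ * S * L2 u := by positivity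
  linarith
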